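/- Let F be a number field with odd class number and unit group E_F, and let k/F be a quadratic extension in which exactly two prime ideals 𝔭₁ and 𝔭₂ of odd norm ramify (and which is unramified at all primes above 2 and at all infinite places). Then the class number h of k is odd if and only if (E_F/𝔭₁) = −1 (i.e. 𝔭₁ is not primary); and in that case the norm index satisfies (E_F : N_{k/F}E_k) = 2, and in fact (E_F : E_F ∩ N_{k/F}k^×) = 2. -/

import Mathlib

open NumberField
open scoped Classical

/-- The quadratic residue symbol `[α/𝔭] ∈ {±1}`, determined by Euler's congruence
`[α/𝔭] ≡ α^((N𝔭 - 1)/2) (mod 𝔭)`. -/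
noncomputable def quadResSym (F : Type*) [Field F] [NumberField F]
    (𝔭 : Ideal (𝓞 F)) (α : 𝓞 F) : ℤ :=
  if α ^ ((Ideal.absNorm 𝔭 - 1) / 2) - 1 ∈ 𝔭 then 1 else -1

/-- An ideal `𝔭` is primary if `[ε/𝔭] = 1` for every unit `ε`, i.e. `(E_F/𝔭) = +1`. -/
def IsPrimaryIdeal (F : Type*) [Field F] [NumberField F] (𝔭 : Ideal (𝓞 F)) : Prop :=
  ∀ ε : (𝓞 F)ˣ, quadResSym F 𝔭 (ε : 𝓞 F) = 1

/-- A prime ideal `𝔭` of `F` is ramified in `K` if some prime of `K` appears at least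
twice in the factorization of `𝔭 O_K`. -/
def IsRamifiedIn (F K : Type*) [Field F] [NumberField F] [Field K] [NumberField K]
    [Algebra F K] (𝔭 : Ideal (𝓞 F)) : Prop :=
  ∃ 𝔓 : Ideal (𝓞 K), 𝔓.IsPrime ∧ 𝔓 ^ 2 ∣ Ideal.map (algebraMap (𝓞 F) (𝓞 K)) 𝔭

/-- `K/F` is unramified at all infinite places: every real embedding of `F`
extends to a real embedding of `K`. -/
def UnramifiedAtInfinitePlaces (F K : Type*) [Field F] [Field K] [Algebra F K] : Prop :=
  ∀ φ : F →+* ℝ, ∃ ψ : K →+* ℝ, ψ.comp (algebraMap F K) = φ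

/-- The subgroup `N_{K/F} E_K` of norms of units, inside the unit group `E_F`. -/
noncomputable def relUnitNormRange (F K : Type*) [Field F] [NumberField F] [Field K]
    [NumberField K] [Algebra F K] : Subgroup (𝓞 F)ˣ :=
  (Units.map (RingOfIntegers.norm F : 𝓞 K →* 𝓞 F)).range

/-- The subgroup `E_F ∩ N_{K/F} K^×` of `E_F`: units of `F` that are norms of elements
of `K^×`. -/
noncomputable def unitsNormsFromField (F K : Type*) [Field F] [NumberField F] [Field K]
    [NumberField K] [Algebra F K] : Subgroup (𝓞 F)ˣ :=
  Subgroup.comap (Units.map (algebraMap (𝓞 F) F).toMonoidHom)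
    (Units.map (Algebra.norm F : K →* F)).range

open NumberField
open scoped Classical

section HerbrandAbs
open Module AddSubgroup

lemma fr_range_ker {A B : Type*} [AddCommGroup A] [AddCommGroup B] [Module.Finite ℤ A]
    (f : A →ₗ[ℤ] B) : finrank ℤ f.range + finrank ℤ f.ker = finrank ℤ A := by
  rw [← Submodule.finrank_quotient_add_finrank f.ker, f.quotKerEquivRange.finrank_eq]

lemma fin_index_two (T : Type*) [AddCommGroup T] [Finite T] :
    (nsmulAddMonoidHom (α := T) 2).range.index = Nat.card (nsmulAddMonoidHom (α := T) 2).ker :=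
  AddSubgroup.index_range

lemma fg_index_two_aux (A : Type*) [AddCommGroup A] [Module.Finite ℤ A] (n : ℕ) (T : Type*)
    [AddCommGroup T] [Finite T] (f : A ≃+ (Fin n →₀ ℤ) × T) :
    (nsmulAddMonoidHom (α := A) 2).range.index =
      2 ^ finrank ℤ A * Nat.card (nsmulAddMonoidHom (α := A) 2).ker := by
  have h1 : finrank ℤ A = n := by
    have := fr_range_ker ((LinearMap.fst ℤ (Fin n →₀ ℤ) T).comp f.toIntLinearEquiv.toLinearMap)
    rw [← this]
    have h0 : finrank ℤ ((LinearMap.fst ℤ (Fin n →₀ ℤ) T).comp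
        f.toIntLinearEquiv.toLinearMap).ker = 0 := by
      rw [Module.finrank_eq_zero_iff_isTorsion]
      rintro ⟨x, hx⟩
      have hc : Nat.card T ≠ 0 := Nat.card_pos.ne'
      refine ⟨⟨(Nat.card T : ℤ), mem_nonZeroDivisors_of_ne_zero (by exact_mod_cast hc)⟩, ?_⟩
      have hx' : (f x).1 = 0 := hx
      ext
      change (Nat.card T : ℤ) • x = 0
      apply f.injective
      rw [map_zsmul, map_zero]
      ext1
      · simp [hx']
      · simp
    have h2 : ((LinearMap.fst ℤ (Fin n →₀ ℤ) T).comp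
        f.toIntLinearEquiv.toLinearMap).range = ⊤ := by
      rw [LinearMap.range_eq_top]
      exact Prod.fst_surjective.comp f.surjective
    rw [h0, h2, finrank_top]; simp
  have h2 : (nsmulAddMonoidHom (α := A) 2).range.index =
      (nsmulAddMonoidHom (α := (Fin n →₀ ℤ) × T) 2).range.index := by
    rw [← index_map_equiv _ f, AddEquiv.map_range_nsmulAddMonoidHom]
  have h3 : (nsmulAddMonoidHom (α := (Fin n →₀ ℤ) × T) 2).range =
      (nsmulAddMonoidHom (α := (Fin n →₀ ℤ)) 2).range.prod (nsmulAddMonoidHom (α := T) 2).range := by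
    ext ⟨a, b⟩
    simp [AddSubgroup.mem_prod, Prod.ext_iff]
  have h4 : Nat.card (nsmulAddMonoidHom (α := A) 2).ker =
      Nat.card (nsmulAddMonoidHom (α := T) 2).ker := by
    refine Nat.card_congr ⟨fun x => ⟨(f x).2, ?_⟩, fun y => ⟨f.symm (0, y), ?_⟩, ?_, ?_⟩
    · have := x.2
      simp only [AddMonoidHom.mem_ker, nsmulAddMonoidHom_apply] at this ⊢
      rw [← Prod.smul_snd, ← map_nsmul, this]; simp
    · have := y.2
      simp only [AddMonoidHom.mem_ker, nsmulAddMonoidHom_apply] at this ⊢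
      rw [← map_nsmul]; simp [Prod.ext_iff, this]
    · intro x
      have hx := x.2
      simp only [AddMonoidHom.mem_ker, nsmulAddMonoidHom_apply] at hx
      ext
      apply f.injective
      have : (f x).1 = 0 := by
        have h : 2 • (f x).1 = 0 := by rw [← Prod.smul_fst, ← map_nsmul, hx]; simp
        simpa using h
      ext1 <;> simp [this]
    · intro y; simp
  rw [h2, h3, index_prod, fin_index_two T, AddSubgroup.index_range_nsmul, h1, h4]
  simp

lemma fg_index_two (A : Type*) [AddCommGroup A] [Module.Finite ℤ A] :
    (nsmulAddMonoidHom (α := A) 2).range.index =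
      2 ^ finrank ℤ A * Nat.card (nsmulAddMonoidHom (α := A) 2).ker := by
  have hfg : AddGroup.FG A := Module.Finite.iff_addGroup_fg.mp inferInstance
  obtain ⟨n, ι, hι, p, hp, e, ⟨f⟩⟩ := AddCommGroup.equiv_free_prod_directSum_zmod A
  have : ∀ i, NeZero (p i ^ e i) := fun i => ⟨pow_ne_zero _ (hp i).ne_zero⟩
  have hT : Finite (DirectSum ι fun i => ZMod (p i ^ e i)) := by
    classical
    exact Finite.of_equiv _ (DirectSum.addEquivProd (fun i => ZMod (p i ^ e i))).symm.toEquiv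
  exact fg_index_two_aux A n _ f

/-- abstract Herbrand quotient computation. -/
lemma herbrand_abs (M : Type*) [AddCommGroup M] [Module.Finite ℤ M] (s : M →+ M)
    (hs : ∀ x, s (s x) = x) (m : ℕ) (hm : 1 ≤ m) (hM : finrank ℤ M = 2 * m - 1)
    (P Q N D : AddSubgroup M)
    (hP : ∀ x, x ∈ P ↔ s x = x) (hQ : ∀ x, x ∈ Q ↔ s x = - x)
    (hN : ∀ x, x ∈ N ↔ ∃ y, y + s y = x) (hD : ∀ x, x ∈ D ↔ ∃ y, y - s y = x)
    (hPr : finrank ℤ P = m - 1)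
    (hP2 : Nat.card (nsmulAddMonoidHom (α := P) 2).ker = 2)
    (hQ2 : Nat.card (nsmulAddMonoidHom (α := Q) 2).ker = 2) :
    D.relIndex Q = 2 * N.relIndex P ∧ N.relIndex P ≠ 0 := by
  have fin1 : ∀ S : AddSubgroup M, Module.Finite ℤ S := fun S =>
    (inferInstance : Module.Finite ℤ S.toIntSubmodule)
  set fN : M →+ M := AddMonoidHom.id M + s
  set fD : M →+ M := AddMonoidHom.id M - s
  have eN : N = (⊤ : AddSubgroup M).map fN := by
    ext x; simp [hN, fN]
  have eD : D = (⊤ : AddSubgroup M).map fD := by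
    ext x; simp [hD, fD]
  have kN : fN.ker = Q := by
    ext x; simp [hQ, fN, AddMonoidHom.mem_ker, eq_neg_iff_add_eq_zero, add_comm]
  have kD : fD.ker = P := by
    ext x; rw [hP]; simp only [fD, AddMonoidHom.mem_ker, AddMonoidHom.sub_apply, AddMonoidHom.id_apply, sub_eq_zero]; exact eq_comm
  have mN : (P ⊔ Q).map fN = P.map (nsmulAddMonoidHom 2) := by
    rw [AddSubgroup.map_sup, ← kN]
    have : (fN.ker).map fN = ⊥ := by
      ext x; simp only [AddSubgroup.mem_map, AddMonoidHom.mem_ker, mem_bot]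
      constructor
      · rintro ⟨y, hy, rfl⟩; exact hy
      · rintro rfl; exact ⟨0, by simp⟩
    rw [this, sup_bot_eq]
    ext x; simp only [AddSubgroup.mem_map]
    refine exists_congr fun y => and_congr_right fun hy => ?_
    rw [hP] at hy; simp [fN, hy, two_nsmul]
  have mD : (P ⊔ Q).map fD = Q.map (nsmulAddMonoidHom 2) := by
    rw [AddSubgroup.map_sup, ← kD]
    have : (fD.ker).map fD = ⊥ := by
      ext x; simp only [AddSubgroup.mem_map, AddMonoidHom.mem_ker, mem_bot]
      constructor
      · rintro ⟨y, hy, rfl⟩; exact hy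
      · rintro rfl; exact ⟨0, by simp⟩
    rw [this, bot_sup_eq]
    ext x; simp only [AddSubgroup.mem_map]
    refine exists_congr fun y => and_congr_right fun hy => ?_
    rw [hQ] at hy; simp [fD, hy, two_nsmul]
  have r1 : (P.map (nsmulAddMonoidHom 2)).relIndex N = (P ⊔ Q).index := by
    rw [← mN, eN, relIndex_map_map, kN, top_sup_eq, relIndex_top_right, sup_assoc, sup_idem]
  have r2 : (Q.map (nsmulAddMonoidHom 2)).relIndex D = (P ⊔ Q).index := by
    rw [← mD, eD, relIndex_map_map, kD, top_sup_eq, relIndex_top_right, sup_comm, ← sup_assoc,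
      sup_idem]
  have le1 : P.map (nsmulAddMonoidHom 2) ≤ N := by
    rw [← mN, eN]; exact AddSubgroup.map_mono le_top
  have le2 : Q.map (nsmulAddMonoidHom 2) ≤ D := by
    rw [← mD, eD]; exact AddSubgroup.map_mono le_top
  have le3 : N ≤ P := by
    intro x hx; rw [hN] at hx; obtain ⟨y, rfl⟩ := hx
    rw [hP]; simp [hs, add_comm]
  have le4 : D ≤ Q := by
    intro x hx; rw [hD] at hx; obtain ⟨y, rfl⟩ := hx
    rw [hQ]; simp [hs]
  have t1 := relIndex_mul_relIndex _ _ _ le1 le3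
  have t2 := relIndex_mul_relIndex _ _ _ le2 le4
  have i1 : (P.map (nsmulAddMonoidHom 2)).relIndex P = 2 ^ (m - 1) * 2 := by
    rw [relIndex, addSubgroupOf_map_nsmulAddMonoidHom_eq_range, fg_index_two, hP2, hPr]
  have frQ : finrank ℤ Q = m := by
    have a1 := fr_range_ker fN.toIntLinearMap
    have a2 : finrank ℤ fN.toIntLinearMap.ker = finrank ℤ Q := by
      have : fN.toIntLinearMap.ker = Q.toIntSubmodule := by rw [← kN]; ext; simp
      rw [this]; rfl
    have a3 : finrank ℤ fN.toIntLinearMap.range = finrank ℤ N := by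
      have : fN.toIntLinearMap.range = N.toIntSubmodule := by rw [eN, ← AddMonoidHom.range_eq_map]; rfl
      rw [this]; rfl
    have a4 : finrank ℤ N = finrank ℤ P := by
      apply le_antisymm
      · exact Submodule.finrank_mono (s := N.toIntSubmodule) (t := P.toIntSubmodule) le3
      · have b1 := fr_range_ker ((nsmulAddMonoidHom (α := M) 2).comp P.subtype).toIntLinearMap
        have b2 : finrank ℤ ((nsmulAddMonoidHom (α := M) 2).comp P.subtype).toIntLinearMap.ker
            = 0 := by
          rw [Module.finrank_eq_zero_iff_isTorsion]
          rintro ⟨x, hx⟩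
          refine ⟨⟨2, mem_nonZeroDivisors_of_ne_zero (by norm_num)⟩, ?_⟩
          ext
          have : (2 : ℕ) • (x : M) = 0 := hx
          change (2 : ℤ) • (x : M) = 0
          rw [two_zsmul, ← two_nsmul, this]
        have b3 : ((nsmulAddMonoidHom (α := M) 2).comp P.subtype).toIntLinearMap.range ≤
            N.toIntSubmodule := by
          rintro _ ⟨x, rfl⟩
          exact le1 ⟨x, x.2, rfl⟩
        have b4 := Submodule.finrank_mono b3
        have b5 : finrank ℤ N.toIntSubmodule = finrank ℤ N := rfl
        omega
    omega
  have i2 : (Q.map (nsmulAddMonoidHom 2)).relIndex Q = 2 ^ m * 2 := by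
    rw [relIndex, addSubgroupOf_map_nsmulAddMonoidHom_eq_range, fg_index_two, hQ2, frQ]
  rw [i1, r1] at t1
  rw [i2, r2] at t2
  obtain ⟨m, rfl⟩ : ∃ k, m = k + 1 := ⟨m - 1, by omega⟩
  have hpos : (P ⊔ Q).index ≠ 0 := by
    intro h; rw [h] at t1; simp at t1
  constructor
  · apply mul_left_cancel₀ hpos
    rw [t2, mul_left_comm, t1]; simp; ring
  · intro h; rw [h] at t1; simp at t1
end HerbrandAbs

open NumberField
open scoped Classical

section Quad
variable {F K : Type*} [Field F] [Field K] [Algebra F K]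

structure QS (σ : K ≃ₐ[F] K) : Prop where
  inv : ∀ x, σ (σ x) = x
  nrm : ∀ x, algebraMap F K (Algebra.norm F x) = x * σ x
  fix : ∀ x, σ x = x → ∃ y, algebraMap F K y = x
  neg : ∃ θ : K, θ ≠ 0 ∧ σ θ = -θ

lemma QS.exists [CharZero F] (hdeg : Module.finrank F K = 2) : ∃ σ : K ≃ₐ[F] K, QS σ := by
  have hfd : FiniteDimensional F K := Module.finite_of_finrank_pos (by omega)
  have hq : Algebra.IsQuadraticExtension F K := ⟨hdeg⟩
  have hgal : IsGalois F K := inferInstance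
  have hcard : Nat.card (K ≃ₐ[F] K) = 2 := by rw [IsGalois.card_aut_eq_finrank, hdeg]
  have : Nontrivial (K ≃ₐ[F] K) := Finite.one_lt_card_iff_nontrivial.mp (by omega)
  obtain ⟨σ, hσ⟩ := exists_ne (1 : K ≃ₐ[F] K)
  have hall : ∀ τ : K ≃ₐ[F] K, τ = 1 ∨ τ = σ := by
    intro τ
    by_contra! h
    have := Nat.card_eq_two_iff' (1 : K ≃ₐ[F] K) |>.mp hcard
    obtain ⟨y, hy, hy2⟩ := this
    exact h.2 ((hy2 _ h.1).trans (hy2 _ hσ).symm)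
  have hs2 : σ * σ = 1 := by
    rcases hall (σ * σ) with h | h
    · exact h
    · exact absurd (mul_left_cancel (h.trans (mul_one σ).symm)) hσ
  have hinv : ∀ x, σ (σ x) = x := fun x => by
    have := congrArg (fun t : K ≃ₐ[F] K => t x) hs2; simpa using this
  have huniv : (Finset.univ : Finset (K ≃ₐ[F] K)) = {1, σ} := by
    ext τ; simpa using hall τ
  have hfix : ∀ x, σ x = x → ∃ y, algebraMap F K y = x := by
    intro x hx
    have := (IsGalois.mem_range_algebraMap_iff_fixed (F := F) (E := K) x).mpr (by
      intro τ; rcases hall τ with rfl | rfl <;> simp [hx])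
    simpa using this
  refine ⟨σ, hinv, fun x => ?_, hfix, ?_⟩
  · rw [Algebra.norm_eq_prod_automorphisms, huniv, Finset.prod_pair hσ.symm]; simp
  · have : ∃ x, σ x ≠ x := by
      by_contra! h; exact hσ (by ext x; exact h x)
    obtain ⟨x, hx⟩ := this
    exact ⟨x - σ x, sub_ne_zero.mpr hx.symm, by simp [hinv]⟩

/-- Hilbert 90. -/
lemma QS.h90 {σ : K ≃ₐ[F] K} (h : QS σ) (η : K) (hη : η * σ η = 1) :
    ∃ α : K, α ≠ 0 ∧ α = η * σ α := by
  by_cases h1 : 1 + η = 0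
  · obtain ⟨θ, h0, hθ⟩ := h.neg
    refine ⟨θ, h0, ?_⟩
    have : η = -1 := by linear_combination h1
    rw [hθ, this]; ring
  · refine ⟨1 + η, h1, ?_⟩
    rw [map_add, map_one, mul_add, hη]; ring
end Quad

section QuadNF
variable {F K : Type*} [Field F] [NumberField F] [Field K] [NumberField K] [Algebra F K]

noncomputable def sig (σ : K ≃ₐ[F] K) : 𝓞 K ≃+* 𝓞 K := RingOfIntegers.mapRingEquiv σ.toRingEquiv

@[simp] lemma coe_sig (σ : K ≃ₐ[F] K) (x : 𝓞 K) : ((sig σ x : 𝓞 K) : K) = σ x := rfl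

lemma QS.sig_sig {σ : K ≃ₐ[F] K} (h : QS σ) (x : 𝓞 K) : sig σ (sig σ x) = x := by
  apply RingOfIntegers.ext; simp [h.inv]

@[simp] lemma sig_alg (σ : K ≃ₐ[F] K) (x : 𝓞 F) :
    sig σ (algebraMap (𝓞 F) (𝓞 K) x) = algebraMap (𝓞 F) (𝓞 K) x := by
  apply RingOfIntegers.ext
  simp [← IsScalarTower.algebraMap_apply (𝓞 F) (𝓞 K) K,
    IsScalarTower.algebraMap_apply (𝓞 F) F K]

lemma QS.sig_norm {σ : K ≃ₐ[F] K} (h : QS σ) (x : 𝓞 K) :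
    algebraMap (𝓞 F) (𝓞 K) (RingOfIntegers.norm F x) = x * sig σ x := by
  apply RingOfIntegers.ext
  rw [RingOfIntegers.coe_algebraMap_norm, h.nrm]; simp

lemma QS.sig_fix {σ : K ≃ₐ[F] K} (h : QS σ) (x : 𝓞 K) (hx : sig σ x = x) :
    ∃ y, algebraMap (𝓞 F) (𝓞 K) y = x := by
  obtain ⟨y, hy⟩ := h.fix x (by rw [← coe_sig, hx])
  have hi : IsIntegral ℤ y := by
    rw [← isIntegral_algebraMap_iff (algebraMap F K).injective, hy]
    exact RingOfIntegers.isIntegral_coe x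
  refine ⟨⟨y, hi⟩, ?_⟩
  apply RingOfIntegers.ext
  rw [← hy]; rfl

/-- integral Hilbert 90 -/
lemma QS.h90int {σ : K ≃ₐ[F] K} (h : QS σ) (η : 𝓞 K) (hη : η * sig σ η = 1) :
    ∃ α : 𝓞 K, α ≠ 0 ∧ α = η * sig σ α := by
  obtain ⟨a, ha, hae⟩ := h.h90 (η : K) (by rw [← coe_sig, ← map_mul, hη, map_one])
  obtain ⟨b, c, hc, rfl⟩ := IsFractionRing.div_surjective (A := 𝓞 K) a
  have hc0 : c ≠ 0 := nonZeroDivisors.ne_zero hc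
  have hb0 : b ≠ 0 := by rintro rfl; simp at ha
  have hsc : sig σ c ≠ 0 := by simpa using hc0
  have key : b * sig σ c = η * sig σ b * c := by
    apply RingOfIntegers.ext
    have h1 : ((c : 𝓞 K) : K) ≠ 0 := by simpa using hc0
    have h2 : σ ((c : 𝓞 K) : K) ≠ 0 := by simpa using hc0
    change (b : K) / (c : K) = η * σ ((b : K) / (c : K)) at hae
    rw [map_div₀] at hae
    field_simp at hae
    change (b : K) * σ (c : K) = η * σ (b : K) * (c : K)
    linear_combination hae
  refine ⟨b * sig σ c, mul_ne_zero hb0 hsc, ?_⟩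
  rw [map_mul, h.sig_sig, key]; ring

lemma units_finrank (K : Type*) [Field K] [NumberField K] :
    Module.finrank ℤ (Additive (𝓞 K)ˣ) = Fintype.card (InfinitePlace K) - 1 := by
  have := Units.finrank_modTorsion K
  rw [Units.rank] at this
  rw [← this]
  set f : Additive (𝓞 K)ˣ →+ Additive ((𝓞 K)ˣ ⧸ Units.torsion K) :=
    MonoidHom.toAdditive (QuotientGroup.mk' (Units.torsion K)) with hf
  have hsurj : Function.Surjective f := QuotientGroup.mk'_surjective (Units.torsion K)
  set g := AddMonoidHom.toIntLinearMap (M := Additive (𝓞 K)ˣ)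
    (M₂ := Additive ((𝓞 K)ˣ ⧸ Units.torsion K)) f with hg
  have h1 := fr_range_ker g
  rw [LinearMap.range_eq_top.mpr (by exact hsurj), finrank_top] at h1
  rw [← h1]
  have : Module.finrank ℤ g.ker = 0 := by
    rw [Module.finrank_eq_zero_iff_isTorsion]
    rintro ⟨x, hx⟩
    have hx' : QuotientGroup.mk' (Units.torsion K) x.toMul = 1 := hx
    have hx2 : x.toMul ∈ Units.torsion K := by simpa using hx'
    rw [Units.torsion, CommGroup.mem_torsion, isOfFinOrder_iff_pow_eq_one] at hx2
    obtain ⟨n, hn, hx3⟩ := hx2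
    refine ⟨⟨(n : ℤ), mem_nonZeroDivisors_of_ne_zero (by exact_mod_cast hn.ne')⟩, ?_⟩
    apply Subtype.ext
    change (n : ℤ) • x = 0
    rw [natCast_zsmul]
    exact hx3
  omega

lemma QS.infinite {σ : K ≃ₐ[F] K} (h : QS σ) (hdeg : Module.finrank F K = 2)
    (hinf : UnramifiedAtInfinitePlaces F K) :
    Fintype.card (InfinitePlace K) = 2 * Fintype.card (InfinitePlace F) := by
  have hq : Algebra.IsQuadraticExtension F K := ⟨hdeg⟩
  have hgal : IsGalois F K := inferInstance
  have : IsUnramifiedAtInfinitePlaces F K := by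
    constructor
    intro w
    rw [InfinitePlace.isUnramified_iff]
    by_contra! hw
    obtain ⟨hw1, hw2⟩ := hw
    rw [InfinitePlace.not_isComplex_iff_isReal] at hw2
    obtain ⟨ψ, hψ⟩ := hinf (InfinitePlace.embedding_of_isReal hw2)
    set w' : InfinitePlace K := InfinitePlace.mk ((algebraMap ℝ ℂ).comp ψ) with hw'
    have hr : w'.IsReal := by
      refine ⟨_, ?_, rfl⟩
      rw [ComplexEmbedding.isReal_iff]
      ext x
      simp [ComplexEmbedding.conjugate]
    have hc : w'.comap (algebraMap F K) = w.comap (algebraMap F K) := by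
      rw [hw', InfinitePlace.comap_mk, RingHom.comp_assoc, hψ]
      conv_rhs => rw [← InfinitePlace.mk_embedding (w.comap (algebraMap F K))]
      congr 1
      ext x
      simp
    obtain ⟨τ, hτ⟩ := InfinitePlace.exists_smul_eq_of_comap_eq (k := F) hc
    rw [← hτ, InfinitePlace.isReal_smul_iff] at hw1
    exact hw1 hr
  rw [IsUnramifiedAtInfinitePlaces.card_infinitePlace F, hdeg, mul_comm]

/-- norm one units -/
noncomputable def unitsQ (F K : Type*) [Field F] [NumberField F] [Field K] [NumberField K]
    [Algebra F K] : Subgroup (𝓞 K)ˣ := (Units.map (RingOfIntegers.norm F : 𝓞 K →* 𝓞 F)).ker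

noncomputable def usig (σ : K ≃ₐ[F] K) : (𝓞 K)ˣ →* (𝓞 K)ˣ := Units.map (sig σ : 𝓞 K →* 𝓞 K)

@[simp] lemma coe_usig (σ : K ≃ₐ[F] K) (u : (𝓞 K)ˣ) : ((usig σ u : (𝓞 K)ˣ) : 𝓞 K) = sig σ u := rfl

noncomputable def unitsD (σ : K ≃ₐ[F] K) : Subgroup (𝓞 K)ˣ :=
  (MonoidHom.id (𝓞 K)ˣ / usig σ).range

lemma mem_unitsD (σ : K ≃ₐ[F] K) (u : (𝓞 K)ˣ) :
    u ∈ unitsD σ ↔ ∃ ξ : (𝓞 K)ˣ, ξ / usig σ ξ = u := Iff.rfl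

lemma QS.mem_unitsQ {σ : K ≃ₐ[F] K} (h : QS σ) (u : (𝓞 K)ˣ) :
    u ∈ unitsQ F K ↔ u * usig σ u = 1 := by
  rw [unitsQ, MonoidHom.mem_ker]
  have hinj : Function.Injective (algebraMap (𝓞 F) (𝓞 K)) := FaithfulSMul.algebraMap_injective _ _
  rw [Units.ext_iff, Units.ext_iff, ← hinj.eq_iff]
  simp only [Units.coe_map, Units.val_one, map_one, Units.val_mul, coe_usig]
  rw [← h.sig_norm]

lemma herbrand {σ : K ≃ₐ[F] K} (h : QS σ) (hdeg : Module.finrank F K = 2)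
    (hinf : UnramifiedAtInfinitePlaces F K) :
    (unitsD σ).relIndex (unitsQ F K) = 2 * (relUnitNormRange F K).index ∧
      (relUnitNormRange F K).index ≠ 0 := by
  have hinj : Function.Injective (algebraMap (𝓞 F) (𝓞 K)) := FaithfulSMul.algebraMap_injective _ _
  set ι : (𝓞 F)ˣ →* (𝓞 K)ˣ := Units.map (algebraMap (𝓞 F) (𝓞 K) : 𝓞 F →* 𝓞 K) with hι
  have hιi : Function.Injective ι := Units.map_injective hinj
  set P : Subgroup (𝓞 K)ˣ := ι.range with hP
  have hPfix : ∀ u, u ∈ P ↔ usig σ u = u := by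
    intro u
    constructor
    · rintro ⟨v, rfl⟩
      ext1; simp [ι]
    · intro hu
      obtain ⟨y, hy⟩ := h.sig_fix u (by rw [← coe_usig, hu])
      obtain ⟨z, hz⟩ := h.sig_fix (u⁻¹ : (𝓞 K)ˣ) (by rw [← coe_usig, map_inv, hu])
      refine ⟨⟨y, z, ?_, ?_⟩, ?_⟩
      · apply hinj; rw [map_mul, hy, hz]; simp
      · apply hinj; rw [map_mul, hy, hz]; simp
      · ext1; simp [ι, hy]
  set N : Subgroup (𝓞 K)ˣ := (relUnitNormRange F K).map ι with hN
  have hNi : N.relIndex P = (relUnitNormRange F K).index := by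
    rw [hN, hP, MonoidHom.range_eq_map, Subgroup.relIndex_map_map, (MonoidHom.ker_eq_bot_iff ι).mpr hιi]
    simp
  have hcard : ∀ S : Subgroup (𝓞 K)ˣ, (-1 : (𝓞 K)ˣ) ∈ S →
      Nat.card (nsmulAddMonoidHom (α := S.toAddSubgroup) 2).ker = 2 := by
    intro S hS
    rw [Nat.card_eq_two_iff]
    refine ⟨0, ⟨⟨Additive.ofMul (-1), hS⟩, ?_⟩, ?_, ?_⟩
    · rw [AddMonoidHom.mem_ker]
      ext1
      change (-1 : (𝓞 K)ˣ) ^ 2 = 1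
      simp
    · intro h0
      have h1 : (1 : (𝓞 K)ˣ) = -1 := congrArg (fun t => ((t : S.toAddSubgroup) : Additive (𝓞 K)ˣ).toMul) (congrArg Subtype.val h0)
      have h2 := congrArg Units.val h1
      have h3 : (2 : 𝓞 K) = 0 := by
        simp only [Units.val_one, Units.val_neg] at h2
        linear_combination h2
      exact two_ne_zero h3
    · rw [Set.eq_univ_iff_forall]
      rintro ⟨⟨x, hxS⟩, hx⟩
      rw [AddMonoidHom.mem_ker] at hx
      have h1 : x.toMul ^ 2 = (1 : (𝓞 K)ˣ) := congrArg (fun t => ((t : S.toAddSubgroup) : Additive (𝓞 K)ˣ).toMul) hx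
      have h2 : ((x.toMul : (𝓞 K)ˣ) : 𝓞 K) ^ 2 = 1 := by
        rw [← Units.val_pow_eq_pow_val, h1, Units.val_one]
      rcases mul_self_eq_one_iff.mp ((pow_two _).symm.trans h2) with h3 | h3
      · left; ext1; ext1; exact Units.ext h3
      · right; ext1; ext1; exact Units.ext h3
  have hm1 : 1 ≤ Fintype.card (InfinitePlace F) := Fintype.card_pos
  have := herbrand_abs (Additive (𝓞 K)ˣ) (usig σ).toAdditive ?_ (Fintype.card (InfinitePlace F))
    hm1 (by rw [units_finrank, h.infinite hdeg hinf]) P.toAddSubgroup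
    (unitsQ F K).toAddSubgroup N.toAddSubgroup (unitsD σ).toAddSubgroup ?_ ?_ ?_ ?_ ?_
    (hcard _ ?_) (hcard _ ?_)
  · rw [Subgroup.relIndex_toAddSubgroup, Subgroup.relIndex_toAddSubgroup, hNi] at this
    exact this
  · intro x; exact Units.ext (h.sig_sig _)
  · intro x; exact hPfix x.toMul
  · intro x
    refine (h.mem_unitsQ x.toMul).trans ?_
    change _ ↔ usig σ x.toMul = (x.toMul)⁻¹
    rw [eq_comm (a := usig σ _), inv_eq_iff_mul_eq_one]
  · intro x
    change x.toMul ∈ N ↔ ∃ y : (𝓞 K)ˣ, y * usig σ y = x.toMul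
    rw [hN, Subgroup.mem_map]
    constructor
    · rintro ⟨_, ⟨y, rfl⟩, hy⟩
      refine ⟨y, ?_⟩
      rw [← hy]; ext1; exact (h.sig_norm _).symm
    · rintro ⟨y, hy⟩
      refine ⟨_, ⟨y, rfl⟩, ?_⟩
      rw [← hy]; ext1; exact (h.sig_norm _)
  · intro x; exact Iff.rfl
  · rw [← units_finrank F]
    have e1 : (𝓞 F)ˣ ≃* P := MonoidHom.ofInjective hιi
    have e2 : Additive (𝓞 F)ˣ ≃+ P.toAddSubgroup := MulEquiv.toAdditive e1
    exact e2.toIntLinearEquiv.finrank_eq.symm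
  · exact (hPfix _).mpr (by ext1; simp)
  · exact (h.mem_unitsQ _).mpr (by ext1; simp)
end QuadNF

open NumberField
open scoped Classical

section IdealTools
variable {F : Type*} [Field F] [NumberField F]

lemma princ_pow (I : Ideal (𝓞 F)) : ∃ x, I ^ (classNumber F) = Ideal.span {x} := by
  by_cases hI : I = ⊥
  · refine ⟨0, ?_⟩
    have : classNumber F ≠ 0 := classNumber_ne_zero F
    rw [hI, ← Ideal.zero_eq_bot, zero_pow this]; simp
  · have hm : I ∈ nonZeroDivisors (Ideal (𝓞 F)) := mem_nonZeroDivisors_of_ne_zero hI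
    have h1 : (ClassGroup.mk0 ⟨I, hm⟩) ^ (classNumber F) = 1 := by
      rw [classNumber]; exact pow_card_eq_one
    rw [← map_pow] at h1
    have h2 : Submodule.IsPrincipal (I ^ classNumber F) :=
      (ClassGroup.mk0_eq_one_iff (pow_mem hm _)).mp h1
    exact ⟨_, (Submodule.IsPrincipal.span_singleton_generator (I ^ classNumber F)).symm⟩

lemma princ_of_coprime_pow (I : Ideal (𝓞 F)) (hI : I ≠ ⊥) (n : ℕ) (hn : n.Coprime (classNumber F))
    (x : 𝓞 F) (hx : I ^ n = Ideal.span {x}) : ∃ y, I = Ideal.span {y} := by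
  have hm : I ∈ nonZeroDivisors (Ideal (𝓞 F)) := mem_nonZeroDivisors_of_ne_zero hI
  have h1 : (ClassGroup.mk0 ⟨I, hm⟩) ^ (classNumber F) = 1 := by
    rw [classNumber]; exact pow_card_eq_one
  have h2 : (ClassGroup.mk0 ⟨I, hm⟩) ^ n = 1 := by
    rw [← map_pow]
    exact (ClassGroup.mk0_eq_one_iff (pow_mem hm _)).mpr (by rw [hx]; exact ⟨⟨x, rfl⟩⟩)
  have h3 : ClassGroup.mk0 ⟨I, hm⟩ = 1 := by
    have := Nat.dvd_gcd (orderOf_dvd_of_pow_eq_one h2) (orderOf_dvd_of_pow_eq_one h1)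
    rw [hn] at this
    exact orderOf_eq_one_iff.mp (Nat.dvd_one.mp this)
  have h4 := (ClassGroup.mk0_eq_one_iff hm).mp h3
  exact ⟨_, (Submodule.IsPrincipal.span_singleton_generator I).symm⟩

variable {K : Type*} [Field K] [NumberField K] [Algebra F K]

lemma map_inj {I J : Ideal (𝓞 F)}
    (h : I.map (algebraMap (𝓞 F) (𝓞 K)) = J.map (algebraMap (𝓞 F) (𝓞 K))) : I = J := by
  rw [← Ideal.comap_map_eq_self_of_faithfullyFlat (B := 𝓞 K) I, h,
    Ideal.comap_map_eq_self_of_faithfullyFlat]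

lemma map_ne_bot {I : Ideal (𝓞 F)} (h : I ≠ ⊥) : I.map (algebraMap (𝓞 F) (𝓞 K)) ≠ ⊥ := by
  intro h'; apply h; apply map_inj (K := K); rw [h', Ideal.map_bot]

lemma exists_unit_of_span_eq {x y : 𝓞 F} (h : Ideal.span {x} = Ideal.span {y}) :
    ∃ u : (𝓞 F)ˣ, x = u * y := by
  rw [Ideal.span_singleton_eq_span_singleton] at h
  obtain ⟨u, hu⟩ := h.symm
  exact ⟨u, by rw [← hu, mul_comm]⟩

lemma mul_sq_princ (hF : Odd (classNumber F)) (I : Ideal (𝓞 F)) (hI : I ≠ ⊥) (x : 𝓞 F)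
    (hx : I ^ 2 = Ideal.span {x}) : ∃ y, I = Ideal.span {y} :=
  princ_of_coprime_pow I hI 2 ((Nat.coprime_two_left).mpr hF) x hx

lemma descend (hF : Odd (classNumber F)) {σ : K ≃ₐ[F] K} (h : QS σ) (η : (𝓞 K)ˣ) (α : 𝓞 K)
    (hα : α ≠ 0) (hηα : α = η * sig σ α) (I : Ideal (𝓞 F))
    (hI : Ideal.span {α} = I.map (algebraMap (𝓞 F) (𝓞 K))) : η ∈ unitsD σ := by
  have hI0 : I ≠ ⊥ := by
    rintro rfl; rw [Ideal.map_bot, Ideal.span_singleton_eq_bot] at hI; exact hα hI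
  have h2 : I ^ 2 = Ideal.span {RingOfIntegers.norm F α} := by
    apply map_inj (K := K)
    rw [Ideal.map_pow, ← hI, Ideal.map_span, Set.image_singleton, h.sig_norm,
      Ideal.span_singleton_pow, Ideal.span_singleton_eq_span_singleton]
    refine ⟨η⁻¹, ?_⟩
    rw [pow_two]
    nth_rw 2 [hηα]
    rw [← mul_assoc, mul_comm]; simp only [← mul_assoc]
    rw [mul_comm _ (α : 𝓞 K), mul_assoc α, Units.inv_mul, mul_one]
  obtain ⟨b, hb⟩ := mul_sq_princ hF I hI0 _ h2
  rw [hb, Ideal.map_span, Set.image_singleton] at hI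
  obtain ⟨ξ, hξ⟩ := exists_unit_of_span_eq hI
  have hb0 : algebraMap (𝓞 F) (𝓞 K) b ≠ 0 := by
    intro h0; rw [h0, mul_zero] at hξ; exact hα hξ
  rw [mem_unitsD]
  refine ⟨ξ, ?_⟩
  rw [div_eq_iff_eq_mul]
  ext1
  apply mul_right_cancel₀ hb0
  rw [← hξ, hηα, hξ]; simp [mul_assoc]

lemma inv_ideal_of_unit {σ : K ≃ₐ[F] K} (h : QS σ) (I : Ideal (𝓞 K)) (hI : ∀ z ∈ I, sig σ z ∈ I)
    (x : 𝓞 K) (θ : (𝓞 K)ˣ) (hx : x - sig σ x = θ) :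
    I = (I.comap (algebraMap (𝓞 F) (𝓞 K))).map (algebraMap (𝓞 F) (𝓞 K)) := by
  apply le_antisymm _ Ideal.map_comap_le
  have hθ : sig σ (θ : 𝓞 K) = - θ := by rw [← hx, map_sub, h.sig_sig]; ring
  have hθi : sig σ ((θ⁻¹ : (𝓞 K)ˣ) : 𝓞 K) = - (θ⁻¹ : (𝓞 K)ˣ) := by
    have : sig σ ((θ⁻¹ : (𝓞 K)ˣ) : 𝓞 K) * sig σ (θ : 𝓞 K) = 1 := by
      rw [← map_mul, Units.inv_mul, map_one]
    rw [hθ] at this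
    calc _ = sig σ ((θ⁻¹ : (𝓞 K)ˣ) : 𝓞 K) * (-θ) * (- (θ⁻¹ : (𝓞 K)ˣ)) := by
          rw [mul_assoc, neg_mul_neg, Units.mul_inv, mul_one]
      _ = _ := by rw [this, one_mul]
  intro z hz
  obtain ⟨t, ht⟩ := h.sig_fix ((z - sig σ z) * (θ⁻¹ : (𝓞 K)ˣ)) (by
    rw [map_mul, map_sub, h.sig_sig, hθi]; ring)
  have htI : algebraMap (𝓞 F) (𝓞 K) t ∈ I := by
    rw [ht]; exact I.mul_mem_right _ (I.sub_mem hz (hI z hz))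
  have hθt : algebraMap (𝓞 F) (𝓞 K) t * θ = z - sig σ z := by
    rw [ht, mul_assoc, Units.inv_mul, mul_one]
  obtain ⟨s, hs⟩ := h.sig_fix (z - algebraMap (𝓞 F) (𝓞 K) t * x) (by
    rw [map_sub, map_mul, sig_alg]; rw [← hx] at hθt; linear_combination hθt)
  have hsI : algebraMap (𝓞 F) (𝓞 K) s ∈ I := by
    rw [hs]; exact I.sub_mem hz (I.mul_mem_right _ htI)
  have : z = algebraMap (𝓞 F) (𝓞 K) s + algebraMap (𝓞 F) (𝓞 K) t * x := by rw [hs]; ring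
  rw [this]
  exact Ideal.add_mem _ (Ideal.mem_map_of_mem _ hsI) (Ideal.mul_mem_right _ _ (Ideal.mem_map_of_mem _ htI))
end IdealTools

section LemV
universe u
open Polynomial in
lemma exists_quad {F : Type u} [Field F] [NumberField F] (e : F) (he : ¬ IsSquare e) :
    ∃ (K : Type u) (_ : Field K) (_ : NumberField K) (_ : Algebra F K), Module.finrank F K = 2 ∧
      (∃ θ : K, θ ^ 2 = algebraMap F K e) ∧
      ∀ φ : F →+* ℝ, 0 ≤ φ e → ∃ ψ : K →+* ℝ, ψ.comp (algebraMap F K) = φ := by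
  have hirr : Irreducible (X ^ 2 - C e : F[X]) := X_pow_sub_C_irreducible_of_prime Nat.prime_two
    (fun b hb => he ⟨b, by rw [← hb, pow_two]⟩)
  have : Fact (Irreducible (X ^ 2 - C e : F[X])) := ⟨hirr⟩
  have hmon : (X ^ 2 - C e : F[X]).Monic := monic_X_pow_sub_C e two_ne_zero
  have hfin : Module.Finite F (AdjoinRoot (X ^ 2 - C e : F[X])) := hmon.finite_adjoinRoot
  refine ⟨AdjoinRoot (X ^ 2 - C e : F[X]), inferInstance, NumberField.of_module_finite F _,
    inferInstance, ?_, ⟨AdjoinRoot.root _, ?_⟩, ?_⟩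
  · rw [(AdjoinRoot.powerBasis hirr.ne_zero).finrank, AdjoinRoot.powerBasis_dim, natDegree_X_pow_sub_C]
  · have := AdjoinRoot.eval₂_root (X ^ 2 - C e : F[X])
    simp only [eval₂_sub, eval₂_pow, eval₂_X, eval₂_C] at this
    exact sub_eq_zero.mp this
  · intro φ hφ
    refine ⟨AdjoinRoot.lift φ (Real.sqrt (φ e)) ?_, ?_⟩
    · simp [Real.sq_sqrt hφ]
    · ext x; exact AdjoinRoot.lift_of (f := (X ^ 2 - C e : F[X])) (by simp [Real.sq_sqrt hφ])

lemma unit_sq_of_field_sq {F : Type*} [Field F] [NumberField F] (ε : (𝓞 F)ˣ)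
    (h : IsSquare ((ε : 𝓞 F) : F)) : ∃ u : (𝓞 F)ˣ, ε = u ^ 2 := by
  obtain ⟨y, hy⟩ := h
  have hi : IsIntegral ℤ y := by
    apply IsIntegral.of_pow (n := 2) two_pos
    rw [pow_two, ← hy]; exact RingOfIntegers.isIntegral_coe _
  set Y : 𝓞 F := ⟨y, hi⟩ with hY
  have hYe : Y * Y = ε := by apply RingOfIntegers.ext; exact hy.symm
  have hu : IsUnit Y := isUnit_of_mul_isUnit_left (hYe ▸ ε.isUnit)
  refine ⟨hu.unit, ?_⟩
  ext1; rw [pow_two]; exact hYe.symm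

theorem lemmaV {F : Type u} [Field F] [NumberField F] (hF : Odd (classNumber F)) (ε : (𝓞 F)ˣ)
    (β γ : 𝓞 F) (h4 : (ε : 𝓞 F) = β ^ 2 - 4 * γ) (hpos : ∀ φ : F →+* ℝ, 0 < φ (ε : 𝓞 F)) :
    ∃ u : (𝓞 F)ˣ, ε = u ^ 2 := by
  by_contra hns
  have he : ¬ IsSquare ((ε : 𝓞 F) : F) := fun h => hns (unit_sq_of_field_sq ε h)
  obtain ⟨K, _, _, _, hdeg, ⟨θ, hθ⟩, hext⟩ := exists_quad _ he
  obtain ⟨σ, hσ⟩ := QS.exists hdeg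
  have hσθ : σ θ = - θ := by
    have h1 : (σ θ) ^ 2 = θ ^ 2 := by rw [← map_pow, hθ, AlgEquiv.commutes]
    rcases sq_eq_sq_iff_eq_or_eq_neg.mp h1 with h | h
    · obtain ⟨y, hy⟩ := hσ.fix θ h
      exfalso; apply he; refine ⟨y, (algebraMap F K).injective ?_⟩
      rw [← hθ, ← hy, map_mul, pow_two]
    · exact h
  have hιi : ∀ z : 𝓞 F, IsIntegral ℤ (algebraMap F K z) := fun z =>
    (RingOfIntegers.isIntegral_coe z).map (algebraMap F K).toIntAlgHom
  have hθi : IsIntegral ℤ θ := by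
    apply IsIntegral.of_pow (n := 2) two_pos
    rw [hθ]; exact hιi _
  have hxi : IsIntegral ℤ ((θ + algebraMap F K β) / 2) := by
    have hq : ((θ + algebraMap F K β) / 2) ^ 2 - algebraMap F K β * ((θ + algebraMap F K β) / 2)
        + algebraMap F K γ = 0 := by
      have : ((ε : 𝓞 F) : F) = (β : F) ^ 2 - 4 * (γ : F) := by
        have := congrArg (algebraMap (𝓞 F) F) h4
        rw [map_sub, map_pow, map_mul, map_ofNat] at this; exact this
      have h2 := congrArg (algebraMap F K) this
      rw [← hθ] at h2
      simp only [map_sub, map_pow, map_mul, map_ofNat] at h2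
      field_simp
      linear_combination h2
    have h3 : IsIntegral (𝓞 F) ((θ + algebraMap F K β) / 2) := by
      refine ⟨Polynomial.X ^ 2 - Polynomial.C β * Polynomial.X + Polynomial.C γ, by monicity!, ?_⟩
      simpa [IsScalarTower.algebraMap_apply (𝓞 F) F K] using hq
    exact isIntegral_trans (R := ℤ) (A := 𝓞 F) _ h3
  set x : 𝓞 K := ⟨_, hxi⟩ with hx
  set Θ : 𝓞 K := ⟨θ, hθi⟩ with hΘ
  have hΘ2 : Θ * Θ = algebraMap (𝓞 F) (𝓞 K) ε := by
    apply RingOfIntegers.ext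
    exact (pow_two θ).symm.trans hθ
  have hΘu : IsUnit Θ := isUnit_of_mul_isUnit_left (hΘ2 ▸ (ε.isUnit.map _))
  have hxx : x - sig σ x = hΘu.unit := by
    apply RingOfIntegers.ext
    change (θ + algebraMap F K β) / 2 - σ ((θ + algebraMap F K β) / 2) = θ
    rw [map_div₀, map_add, hσθ, AlgEquiv.commutes, map_ofNat]; ring
  have hH := herbrand hσ hdeg (fun φ => hext φ (hpos φ).le)
  have hnle : ¬ unitsQ F K ≤ unitsD σ := by
    intro hle
    rw [← Subgroup.relIndex_eq_one] at hle
    omega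
  obtain ⟨η, hη, hηD⟩ := Set.not_subset.mp hnle
  have hη' := (hσ.mem_unitsQ η).mp hη
  obtain ⟨α, hα0, hα⟩ := hσ.h90int η (by have := congrArg Units.val hη'; simpa using this)
  refine hηD (descend hF hσ η α hα0 hα _ (inv_ideal_of_unit hσ _ ?_ x _ hxx))
  intro z hz
  rw [Ideal.mem_span_singleton] at hz ⊢
  obtain ⟨c, rfl⟩ := hz
  rw [map_mul]
  apply Dvd.dvd.mul_right
  exact ⟨((η⁻¹ : (𝓞 K)ˣ) : 𝓞 K), by nth_rw 2 [hα]; rw [mul_comm, ← mul_assoc, Units.inv_mul, one_mul]⟩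
end LemV

open NumberField
open scoped Classical

section Ram
variable {F K : Type*} [Field F] [NumberField F] [Field K] [NumberField K] [Algebra F K]

lemma absNorm_map (hdeg : Module.finrank F K = 2) (I : Ideal (𝓞 F)) :
    Ideal.absNorm (I.map (algebraMap (𝓞 F) (𝓞 K))) = Ideal.absNorm I ^ 2 := by
  rw [Ideal.absNorm_algebraMap, ← hdeg]
  congr 1
  exact (IsFractionRing.finrank_eq (𝓞 F) F (𝓞 K) K).symm

lemma QS.mem_map_sig {σ : K ≃ₐ[F] K} (h : QS σ) (I : Ideal (𝓞 K)) (x : 𝓞 K) :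
    x ∈ I.map (sig σ) ↔ sig σ x ∈ I := by
  rw [Ideal.mem_map_of_equiv]
  constructor
  · rintro ⟨y, hy, rfl⟩; rwa [h.sig_sig]
  · intro hx; exact ⟨_, hx, h.sig_sig x⟩

lemma QS.map_map_sig {σ : K ≃ₐ[F] K} (h : QS σ) (I : Ideal (𝓞 K)) :
    (I.map (sig σ)).map (sig σ) = I := by
  ext x; rw [h.mem_map_sig, h.mem_map_sig, h.sig_sig]

lemma QS.map_sig_map {σ : K ≃ₐ[F] K} (h : QS σ) (I : Ideal (𝓞 F)) :
    (I.map (algebraMap (𝓞 F) (𝓞 K))).map (sig σ) = I.map (algebraMap (𝓞 F) (𝓞 K)) := by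
  have h1 : ∀ J : Ideal (𝓞 F), (J.map (algebraMap (𝓞 F) (𝓞 K))).map (sig σ)
      ≤ J.map (algebraMap (𝓞 F) (𝓞 K)) := by
    intro J
    rw [Ideal.map_le_iff_le_comap, Ideal.map_le_iff_le_comap]
    intro x hx
    simp only [Ideal.mem_comap, sig_alg]
    exact Ideal.mem_map_of_mem _ hx
  apply le_antisymm (h1 I)
  conv_lhs => rw [← h.map_map_sig (I.map _)]
  exact Ideal.map_mono (h1 I)

lemma QS.map_sig_span {σ : K ≃ₐ[F] K} (x : 𝓞 K) :
    (Ideal.span {x}).map (sig σ) = Ideal.span {sig σ x} := by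
  rw [Ideal.map_span, Set.image_singleton]

lemma prime_comap_eq (p : Ideal (𝓞 F)) (hp : p.IsPrime) (hp0 : p ≠ ⊥) (P : Ideal (𝓞 K))
    (hP : P.IsPrime) (hle : p.map (algebraMap (𝓞 F) (𝓞 K)) ≤ P) :
    P.comap (algebraMap (𝓞 F) (𝓞 K)) = p := by
  have hpm : p.IsMaximal := hp.isMaximal hp0
  refine (hpm.eq_of_le (Ideal.comap_ne_top _ hP.ne_top) (Ideal.map_le_iff_le_comap.mp hle)).symm

lemma res_inj (p : Ideal (𝓞 F)) (P : Ideal (𝓞 K)) (h : P.comap (algebraMap (𝓞 F) (𝓞 K)) = p) :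
    ∃ f : (𝓞 F) ⧸ p →+* (𝓞 K) ⧸ P, Function.Injective f ∧ ∀ a, f (Ideal.Quotient.mk p a) =
      Ideal.Quotient.mk P (algebraMap (𝓞 F) (𝓞 K) a) := by
  refine ⟨Ideal.quotientMap P (algebraMap (𝓞 F) (𝓞 K)) h.ge, ?_, fun a => rfl⟩
  exact Ideal.quotientMap_injective' h.le

lemma ram_facts (hdeg : Module.finrank F K = 2) {σ : K ≃ₐ[F] K} (h : QS σ) (p : Ideal (𝓞 F))
    (hp : p.IsPrime) (hp0 : p ≠ ⊥) (hr : IsRamifiedIn F K p) :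
    ∃ P : Ideal (𝓞 K), P.IsPrime ∧ P ≠ ⊥ ∧ p.map (algebraMap (𝓞 F) (𝓞 K)) = P ^ 2 ∧
      P.comap (algebraMap (𝓞 F) (𝓞 K)) = p ∧
      (∀ x : 𝓞 K, ∃ a : 𝓞 F, x - algebraMap (𝓞 F) (𝓞 K) a ∈ P) ∧
      (∀ x : 𝓞 K, sig σ x - x ∈ P) ∧ P.map (sig σ) = P := by
  obtain ⟨P, hP, J, hJ⟩ := hr
  have hm0 : p.map (algebraMap (𝓞 F) (𝓞 K)) ≠ ⊥ := map_ne_bot hp0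
  have hP0 : P ≠ ⊥ := by
    rintro rfl; apply hm0; rw [hJ, pow_two, Ideal.bot_mul, Ideal.bot_mul]
  have hJ0 : J ≠ ⊥ := by
    rintro rfl; apply hm0; rw [hJ, Ideal.mul_bot]
  have hle : p.map (algebraMap (𝓞 F) (𝓞 K)) ≤ P := by
    rw [hJ, pow_two, mul_assoc]; exact Ideal.le_of_dvd ⟨_, rfl⟩
  have hc := prime_comap_eq p hp hp0 P hP hle
  obtain ⟨f, hfi, hf⟩ := res_inj p P hc
  have hfinP : Finite (𝓞 K ⧸ P) := (Ideal.absNorm_ne_zero_iff P).mp (by rwa [Ne, Ideal.absNorm_eq_zero_iff])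
  have hfinp : Finite (𝓞 F ⧸ p) := (Ideal.absNorm_ne_zero_iff p).mp (by rwa [Ne, Ideal.absNorm_eq_zero_iff])
  have hN : Ideal.absNorm p ≤ Ideal.absNorm P := by
    rw [Ideal.absNorm_apply, Ideal.absNorm_apply, Submodule.cardQuot_apply, Submodule.cardQuot_apply]
    exact Nat.card_le_card_of_injective f hfi
  have hN2 : Ideal.absNorm p ^ 2 = Ideal.absNorm P ^ 2 * Ideal.absNorm J := by
    rw [← absNorm_map hdeg, hJ, map_mul, map_pow]
  have hJp : Ideal.absNorm J ≠ 0 := by rwa [Ne, Ideal.absNorm_eq_zero_iff]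
  have hPp : Ideal.absNorm P ≠ 0 := by rwa [Ne, Ideal.absNorm_eq_zero_iff]
  have hJ1 : Ideal.absNorm J = 1 := by
    have h1 : Ideal.absNorm p ^ 2 ≤ Ideal.absNorm P ^ 2 := Nat.pow_le_pow_left hN 2
    have h2 : 0 < Ideal.absNorm P ^ 2 := by positivity
    by_contra hne
    have : 2 ≤ Ideal.absNorm J := by omega
    nlinarith
  have hNeq : Ideal.absNorm p = Ideal.absNorm P := by
    rw [hJ1, mul_one] at hN2; exact Nat.pow_left_injective two_ne_zero hN2
  have hJt : J = 1 := by rw [Ideal.one_eq_top]; exact Ideal.absNorm_eq_one_iff.mp hJ1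
  have hmap : p.map (algebraMap (𝓞 F) (𝓞 K)) = P ^ 2 := by rw [hJ, hJt, mul_one]
  have hsurj : Function.Surjective f := by
    refine ((Nat.bijective_iff_injective_and_card f).mpr ⟨hfi, ?_⟩).2
    rw [Ideal.absNorm_apply, Ideal.absNorm_apply, Submodule.cardQuot_apply, Submodule.cardQuot_apply] at hNeq
    exact hNeq
  have hres : ∀ x : 𝓞 K, ∃ a : 𝓞 F, x - algebraMap (𝓞 F) (𝓞 K) a ∈ P := by
    intro x
    obtain ⟨y, hy⟩ := hsurj (Ideal.Quotient.mk P x)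
    obtain ⟨a, rfl⟩ := Ideal.Quotient.mk_surjective y
    refine ⟨a, ?_⟩
    rw [hf] at hy
    exact Ideal.Quotient.eq.mp hy.symm
  have hsP : P.map (sig σ) = P := by
    have h1 : (P.map (sig σ)) ^ 2 = P ^ 2 := by rw [← Ideal.map_pow, ← hmap, h.map_sig_map]
    have hPp : Prime P := Ideal.prime_of_isPrime hP0 hP
    have h2 : P ∣ P.map (sig σ) := hPp.dvd_of_dvd_pow (h1 ▸ dvd_pow_self P two_ne_zero)
    have h3 := Ideal.le_of_dvd h2
    apply le_antisymm h3
    conv_lhs => rw [← h.map_map_sig P]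
    exact Ideal.map_mono h3
  refine ⟨P, hP, hP0, hmap, hc, hres, ?_, hsP⟩
  intro x
  obtain ⟨a, ha⟩ := hres x
  have h1 : sig σ (x - algebraMap (𝓞 F) (𝓞 K) a) ∈ P := by
    rw [← h.mem_map_sig, hsP]; exact ha
  rw [map_sub, sig_alg] at h1
  have := P.sub_mem h1 ha
  convert this using 1; ring

lemma unram_le {σ : K ≃ₐ[F] K} (h : QS σ) (q : Ideal (𝓞 F))
    (hq : q.IsPrime) (hq0 : q ≠ ⊥) (hr : ¬ IsRamifiedIn F K q) (I : Ideal (𝓞 K))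
    (hI : I.map (sig σ) = I) (Q : Ideal (𝓞 K)) (hQ : Q.IsPrime)
    (hQq : Q.comap (algebraMap (𝓞 F) (𝓞 K)) = q) (hIQ : I ≤ Q) :
    I ≤ q.map (algebraMap (𝓞 F) (𝓞 K)) := by
  set R := q.map (algebraMap (𝓞 F) (𝓞 K)) with hR
  have hR0 : R ≠ 0 := map_ne_bot hq0
  have hsf : Squarefree R := by
    rw [squarefree_iff_no_irreducibles hR0]
    intro P hP hPP
    apply hr
    refine ⟨P, Ideal.isPrime_of_prime hP.prime, ?_⟩
    rwa [pow_two]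
  have hrad : R.IsRadical := by
    rintro x ⟨n, hn⟩
    rw [← Ideal.span_singleton_le_iff_mem, ← Ideal.dvd_iff_le]
    apply hsf.isRadical n
    rw [Ideal.dvd_iff_le, Ideal.span_singleton_pow, Ideal.span_singleton_le_iff_mem]
    exact hn
  rw [← hrad.radical, Ideal.radical_eq_sInf]
  apply le_sInf
  rintro Q' ⟨hle, hQ'⟩
  have hQ'q := prime_comap_eq q hq hq0 Q' hQ' hle
  have hQ'0 : Q' ≠ ⊥ := by rintro rfl; exact hR0 (le_bot_iff.mp hle)
  have hIQ2 : I ≤ Q.map (sig σ) := by rw [← hI]; exact Ideal.map_mono hIQ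
  have hmax : Q'.IsMaximal := hQ'.isMaximal hQ'0
  have hu : (Q' : Set (𝓞 K)) ⊆ Q ∪ (Q.map (sig σ) : Ideal (𝓞 K)) := by
    intro x hx
    have h1 : RingOfIntegers.norm F x ∈ q := by
      rw [← hQ'q, Ideal.mem_comap, h.sig_norm]
      exact Q'.mul_mem_right _ hx
    rw [← hQq, Ideal.mem_comap, h.sig_norm] at h1
    rcases hQ.mem_or_mem h1 with h2 | h2
    · exact Or.inl h2
    · exact Or.inr ((h.mem_map_sig Q x).mpr h2)
  rcases Ideal.subset_union.mp hu with h1 | h1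
  · rw [hmax.eq_of_le hQ.ne_top h1]; exact hIQ
  · rw [hmax.eq_of_le ?_ h1]; exact hIQ2
    intro ht
    have := h.map_map_sig Q
    rw [ht, Ideal.map_top] at this
    exact hQ.ne_top this.symm

/-- The standing data about the two ramified primes. -/
structure RamData (σ : K ≃ₐ[F] K) (p : Ideal (𝓞 F)) (P : Ideal (𝓞 K)) : Prop where
  pp : p.IsPrime
  p0 : p ≠ ⊥
  isP : P.IsPrime
  P0 : P ≠ ⊥
  mp : p.map (algebraMap (𝓞 F) (𝓞 K)) = P ^ 2
  cm : P.comap (algebraMap (𝓞 F) (𝓞 K)) = p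
  res : ∀ x : 𝓞 K, ∃ a : 𝓞 F, x - algebraMap (𝓞 F) (𝓞 K) a ∈ P
  sg : ∀ x : 𝓞 K, sig σ x - x ∈ P
  st : P.map (sig σ) = P

/-- genus data: `R` contains all the ramified primes. -/
structure Genus (σ : K ≃ₐ[F] K) (R : Finset (Ideal (𝓞 F))) (P : Ideal (𝓞 F) → Ideal (𝓞 K)) :
    Prop where
  qs : QS σ
  ram : ∀ r ∈ R, RamData σ r (P r)
  all : ∀ p : Ideal (𝓞 F), p.IsPrime → p ≠ ⊥ → IsRamifiedIn F K p → p ∈ R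

lemma ambig {σ : K ≃ₐ[F] K} {R : Finset (Ideal (𝓞 F))} {P : Ideal (𝓞 F) → Ideal (𝓞 K)}
    (g : Genus σ R P)
    (n : ℕ) : ∀ I : Ideal (𝓞 K), I ≠ ⊥ → Ideal.absNorm I ≤ n → I.map (sig σ) = I →
      ∃ (J : Ideal (𝓞 F)) (S : Finset (Ideal (𝓞 F))), J ≠ ⊥ ∧ S ⊆ R ∧
        I = J.map (algebraMap (𝓞 F) (𝓞 K)) * ∏ r ∈ S, P r := by
  have h := g.qs
  induction n with
  | zero =>
    intro I hI hn
    exact absurd (Ideal.absNorm_eq_zero_iff.mp (by omega)) hI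
  | succ n ih =>
    intro I hI hn hst
    by_cases hIt : I = ⊤
    · refine ⟨⊤, ∅, by simp, by simp, ?_⟩
      simp [hIt, Ideal.map_top]
    -- general step
    have step : ∀ R' : Ideal (𝓞 K), I ≤ R' → R' ≠ ⊤ → R'.map (sig σ) = R' →
        ∃ (J : Ideal (𝓞 F)) (S : Finset (Ideal (𝓞 F))), J ≠ ⊥ ∧ S ⊆ R ∧
        I = R' * (J.map (algebraMap (𝓞 F) (𝓞 K)) * ∏ r ∈ S, P r) := by
      intro R' hIR hRt hRs
      obtain ⟨I', rfl⟩ := Ideal.dvd_iff_le.mpr hIR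
      have hR0 : R' ≠ 0 := left_ne_zero_of_mul hI
      have hI'0 : I' ≠ 0 := right_ne_zero_of_mul hI
      have hs' : I'.map (sig σ) = I' := by
        rw [Ideal.map_mul, hRs] at hst
        exact mul_left_cancel₀ hR0 hst
      have hlt : Ideal.absNorm I' ≤ n := by
        rw [map_mul] at hn
        have a1 : Ideal.absNorm R' ≠ 1 := by rwa [Ne, Ideal.absNorm_eq_one_iff]
        have a2 : Ideal.absNorm R' ≠ 0 := by rwa [Ne, Ideal.absNorm_eq_zero_iff]
        have a3 : Ideal.absNorm I' ≠ 0 := by rwa [Ne, Ideal.absNorm_eq_zero_iff]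
        have a4 : 2 ≤ Ideal.absNorm R' := by omega
        have a5 : 0 < Ideal.absNorm I' := by omega
        nlinarith
      obtain ⟨J, S, hJ, hS, hE⟩ := ih I' hI'0 hlt hs'
      exact ⟨J, S, hJ, hS, by rw [← hE]⟩
    obtain ⟨Q, hQm, hIQ⟩ := Ideal.exists_le_maximal I hIt
    have hQ : Q.IsPrime := hQm.isPrime
    have hQ0 : Q ≠ ⊥ := by rintro rfl; exact hI (le_bot_iff.mp hIQ)
    set q := Q.comap (algebraMap (𝓞 F) (𝓞 K)) with hq
    have hqp : q.IsPrime := Ideal.comap_isPrime _ _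
    have hq0 : q ≠ ⊥ := Ideal.IsIntegralClosure.comap_ne_bot (𝓞 F) hQ0
    have hqQ : q.map (algebraMap (𝓞 F) (𝓞 K)) ≤ Q := Ideal.map_comap_le
    by_cases hr : IsRamifiedIn F K q
    · have hqR := g.all q hqp hq0 hr
      have hpP := g.ram q hqR
      have hQP : Q = P q := by
        rw [hpP.mp] at hqQ
        have := hQ.le_of_pow_le hqQ
        exact ((hpP.isP.isMaximal hpP.P0).eq_of_le hQ.ne_top this).symm
      rw [hQP] at hIQ
      obtain ⟨J, S, hJ, hS, hE⟩ := step (P q) hIQ hpP.isP.ne_top hpP.st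
      by_cases hqS : q ∈ S
      · refine ⟨q * J, S.erase q, mul_ne_zero hq0 hJ, (Finset.erase_subset _ _).trans hS, ?_⟩
        rw [hE, ← Finset.mul_prod_erase S P hqS, Ideal.map_mul, hpP.mp]; ring
      · refine ⟨J, insert q S, hJ, Finset.insert_subset hqR hS, ?_⟩
        rw [hE, Finset.prod_insert hqS]; ring
    · have := unram_le h q hqp hq0 hr I hst Q hQ rfl hIQ
      obtain ⟨J, S, hJ, hS, hE⟩ := step _ this (fun ht => hQ.ne_top (top_le_iff.mp (ht ▸ hqQ)))
        (h.map_sig_map q)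
      exact ⟨q * J, S, mul_ne_zero hq0 hJ, hS, by rw [hE, Ideal.map_mul]; ring⟩
end Ram

open NumberField
open scoped Classical

section Gen
variable {F K : Type*} [Field F] [NumberField F] [Field K] [NumberField K] [Algebra F K]
variable {σ : K ≃ₐ[F] K} {R : Finset (Ideal (𝓞 F))} {P : Ideal (𝓞 F) → Ideal (𝓞 K)}

lemma Genus.unit_data (g : Genus σ R P) (η : unitsQ F K) :
    ∃ (α : 𝓞 K) (J : Ideal (𝓞 F)) (S : Finset (Ideal (𝓞 F))), α ≠ 0 ∧
      α = (η : (𝓞 K)ˣ) * sig σ α ∧ J ≠ ⊥ ∧ S ⊆ R ∧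
      Ideal.span {α} = J.map (algebraMap (𝓞 F) (𝓞 K)) * ∏ r ∈ S, P r := by
  have hη := (g.qs.mem_unitsQ _).mp η.2
  obtain ⟨α, hα0, hα⟩ := g.qs.h90int ((η : (𝓞 K)ˣ) : 𝓞 K) (by
    have := congrArg (Units.val) hη; simpa using this)
  have hst : (Ideal.span {α}).map (sig σ) = Ideal.span {α} := by
    rw [QS.map_sig_span]
    conv_rhs => rw [hα]
    rw [Ideal.span_singleton_eq_span_singleton]
    exact ⟨(η : (𝓞 K)ˣ), by rw [mul_comm]⟩
  obtain ⟨J, S, hJ, hS, hE⟩ := ambig g _ _ (by rwa [Ne, Ideal.span_singleton_eq_bot]) le_rfl hst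
  exact ⟨α, J, S, hα0, hα, hJ, hS, hE⟩

lemma Genus.card (hF : Odd (classNumber F)) (g : Genus σ R P) 
    (hfin : (unitsD σ).relIndex (unitsQ F K) ≠ 0) :
    (unitsD σ).relIndex (unitsQ F K) ≤ 2 ^ R.card ∧
    (2 ^ R.card ≤ (unitsD σ).relIndex (unitsQ F K) → ∀ S ⊆ R,
      ∃ (α : 𝓞 K) (J : Ideal (𝓞 F)), α ≠ 0 ∧ J ≠ ⊥ ∧
        Ideal.span {α} = J.map (algebraMap (𝓞 F) (𝓞 K)) * ∏ r ∈ S, P r) := by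
  choose α J S hα0 hα hJ hS hE using g.unit_data
  set f : (unitsQ F K) ⧸ ((unitsD σ).subgroupOf (unitsQ F K)) → R.powerset :=
    fun q => ⟨S q.out, Finset.mem_powerset.mpr (hS _)⟩ with hf
  have hinj : Function.Injective f := by
    intro q q' hqq
    have hSS : S q.out = S q'.out := congrArg Subtype.val hqq
    rw [← Quotient.out_eq' q, ← Quotient.out_eq' q']
    change (QuotientGroup.mk q.out : (unitsQ F K) ⧸ ((unitsD σ).subgroupOf (unitsQ F K)))
      = QuotientGroup.mk q'.out
    set η := q.out
    set η' := q'.out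
    rw [eq_comm, QuotientGroup.eq, Subgroup.mem_subgroupOf]
    have hη' := (g.qs.mem_unitsQ _).mp η'.2
    have hη'1 : ((η' : (𝓞 K)ˣ))⁻¹ = usig σ (η' : (𝓞 K)ˣ) := by
      rw [inv_eq_iff_mul_eq_one]; exact hη'
    have hP : ∏ r ∈ S η, P r * P r = (∏ r ∈ S η, r).map (algebraMap (𝓞 F) (𝓞 K)) := by
      rw [← Ideal.mapHom_apply, map_prod]; simp only [Ideal.mapHom_apply]
      apply Finset.prod_congr rfl
      intro r hr
      rw [(g.ram r (hS _ hr)).mp, pow_two]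
    have hs : Ideal.span {sig σ (α η')} = Ideal.span {α η'} := by
      conv_rhs => rw [hα η']
      rw [Ideal.span_singleton_eq_span_singleton]
      exact ⟨(η' : (𝓞 K)ˣ), by rw [mul_comm]⟩
    refine descend hF g.qs _ (α η * sig σ (α η')) (mul_ne_zero (hα0 _) ?_) ?_
      (J η * J η' * ∏ r ∈ S η, r) ?_
    · simpa using hα0 η'
    · simp only [Subgroup.coe_mul, InvMemClass.coe_inv, Units.val_mul, map_mul, hη'1, coe_usig]
      rw [g.qs.sig_sig]
      have h1 := hα η
      have h2 : sig σ (α η') = sig σ (η' : (𝓞 K)ˣ) * α η' := by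
        conv_lhs => rw [hα η']
        rw [map_mul, g.qs.sig_sig]
      conv_lhs => rw [h1, h2]
      ring
    · rw [← Ideal.span_singleton_mul_span_singleton, hs, hE, hE, ← hSS, Ideal.map_mul, Ideal.map_mul,
        ← hP, Finset.prod_mul_distrib]
      ring
  have hfin' : Finite ((unitsQ F K) ⧸ ((unitsD σ).subgroupOf (unitsQ F K))) :=
    Nat.finite_of_card_ne_zero hfin
  have hc : Nat.card R.powerset = 2 ^ R.card := by
    rw [Nat.card_eq_fintype_card, Fintype.card_coe, Finset.card_powerset]
  have hle := Nat.card_le_card_of_injective f hinj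
  refine ⟨by rw [← hc]; exact hle, fun hge S' hS' => ?_⟩
  have hbij : Function.Bijective f := by
    rw [Nat.bijective_iff_injective_and_card]
    exact ⟨hinj, le_antisymm hle (by rw [hc]; exact hge)⟩
  obtain ⟨q, hq⟩ := hbij.2 ⟨S', Finset.mem_powerset.mpr hS'⟩
  have : S q.out = S' := congrArg Subtype.val hq
  exact ⟨α q.out, J q.out, hα0 _, hJ _, by rw [hE, this]⟩
end Gen

open NumberField
open scoped Classical

section Sq
variable {F : Type*} [Field F] [NumberField F]

def SqMod (p : Ideal (𝓞 F)) (x : 𝓞 F) : Prop := ∃ a : 𝓞 F, x - a ^ 2 ∈ p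

lemma SqMod.mul {p : Ideal (𝓞 F)} {x y : 𝓞 F} (hx : SqMod p x) (hy : SqMod p y) :
    SqMod p (x * y) := by
  obtain ⟨a, ha⟩ := hx
  obtain ⟨b, hb⟩ := hy
  refine ⟨a * b, ?_⟩
  have := p.add_mem (p.mul_mem_right y ha) (p.mul_mem_left (a ^ 2) hb)
  convert this using 1; ring

lemma SqMod.sq (p : Ideal (𝓞 F)) (x : 𝓞 F) : SqMod p (x ^ 2) := ⟨x, by simp⟩

lemma SqMod.one (p : Ideal (𝓞 F)) : SqMod p (1 : 𝓞 F) := ⟨1, by simp⟩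

lemma SqMod.prod {ι : Type*} {p : Ideal (𝓞 F)} (S : Finset ι) (f : ι → 𝓞 F)
    (h : ∀ i ∈ S, SqMod p (f i)) : SqMod p (∏ i ∈ S, f i) := by
  induction S using Finset.induction_on with
  | empty => simpa using SqMod.one p
  | insert a S ha ih =>
    rw [Finset.prod_insert ha]
    exact (h a (by simp)).mul (ih fun i hi => h i (by simp [hi]))

lemma SqMod.of_mul {p : Ideal (𝓞 F)} (hp : p.IsPrime) (hp0 : p ≠ ⊥) {x y : 𝓞 F}
    (hxy : SqMod p (x * y)) (hy : SqMod p y) (hy0 : y ∉ p) : SqMod p x := by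
  have hpm := hp.isMaximal hp0
  obtain ⟨z, hz⟩ : ∃ z, z * y - 1 ∈ p := by
    obtain ⟨z, i, hi, h⟩ := hpm.exists_inv hy0
    refine ⟨z, ?_⟩
    have : z * y - 1 = - i := by rw [← h]; ring
    rw [this]; exact p.neg_mem hi
  obtain ⟨a, ha⟩ := hxy.mul hy
  refine ⟨a * z, ?_⟩
  have h1 := p.mul_mem_left (z ^ 2) ha
  have h2 := p.mul_mem_left (x * (z * y + 1)) hz
  have := p.sub_mem h1 h2
  convert this using 1; ring

lemma SqMod.of_pow {p : Ideal (𝓞 F)} (hp : p.IsPrime) (hp0 : p ≠ ⊥) {x : 𝓞 F} {n : ℕ} (hn : Odd n)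
    (hx : SqMod p (x ^ n)) (hx0 : x ∉ p) : SqMod p x := by
  obtain ⟨k, rfl⟩ := hn
  refine SqMod.of_mul hp hp0 (y := (x ^ k) ^ 2) ?_ (SqMod.sq _ _) ?_
  · convert hx using 1; ring
  · intro h; exact hx0 (hp.mem_of_pow_mem _ (hp.mem_of_pow_mem _ h))

lemma SqMod.pow {p : Ideal (𝓞 F)} {x : 𝓞 F} (hx : SqMod p x) (n : ℕ) : SqMod p (x ^ n) := by
  obtain ⟨a, ha⟩ := hx
  refine ⟨a ^ n, ?_⟩
  have := Ideal.mem_of_dvd p (sub_dvd_pow_sub_pow x (a ^ 2) n) ha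
  convert this using 1; ring

lemma unit_notMem {p : Ideal (𝓞 F)} (hp : p.IsPrime) (u : (𝓞 F)ˣ) : (u : 𝓞 F) ∉ p :=
  fun h => hp.ne_top (Ideal.eq_top_of_isUnit_mem _ h u.isUnit)

lemma quadRes_iff (p : Ideal (𝓞 F)) (hp : p.IsPrime) (hN : Odd (Ideal.absNorm p)) (x : 𝓞 F)
    (hx : x ∉ p) : quadResSym F p x = 1 ↔ SqMod p x := by
  have hp0 : p ≠ ⊥ := by rintro rfl; simp at hN
  have hpm := hp.isMaximal hp0
  have hfin : Finite (𝓞 F ⧸ p) := (Ideal.absNorm_ne_zero_iff p).mp (by rwa [Ne, Ideal.absNorm_eq_zero_iff])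
  letI : Field (𝓞 F ⧸ p) := Ideal.Quotient.field p
  letI : Fintype (𝓞 F ⧸ p) := Fintype.ofFinite _
  have hcard : Fintype.card (𝓞 F ⧸ p) = Ideal.absNorm p := by
    rw [Ideal.absNorm_apply, Submodule.cardQuot_apply, Nat.card_eq_fintype_card]
  have hchar : ringChar (𝓞 F ⧸ p) ≠ 2 := by
    intro h
    have := FiniteField.even_card_iff_char_two.mp h
    rw [hcard] at this
    rw [Nat.odd_iff] at hN; omega
  have hx' : Ideal.Quotient.mk p x ≠ 0 := by rwa [Ne, Ideal.Quotient.eq_zero_iff_mem]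
  have h1 := FiniteField.isSquare_iff hchar hx'
  have h2 : SqMod p x ↔ IsSquare (Ideal.Quotient.mk p x) := by
    constructor
    · rintro ⟨a, ha⟩
      refine ⟨Ideal.Quotient.mk p a, ?_⟩
      rw [← map_mul, ← pow_two]; exact Ideal.Quotient.eq.mpr ha
    · rintro ⟨a, ha⟩
      obtain ⟨a, rfl⟩ := Ideal.Quotient.mk_surjective a
      refine ⟨a, ?_⟩
      rw [← map_mul, ← pow_two] at ha; exact Ideal.Quotient.eq.mp ha
  have h3 : (Ideal.absNorm p - 1) / 2 = Fintype.card (𝓞 F ⧸ p) / 2 := by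
    rw [hcard]; rw [Nat.odd_iff] at hN; omega
  rw [h2, h1, quadResSym, h3, ← map_pow, ← (Ideal.Quotient.mk p).map_one, Ideal.Quotient.eq]
  split_ifs with h4 <;> simp [h4]

lemma princ_two_odd (I : Ideal (𝓞 F)) (hI : I ≠ ⊥) (n : ℕ) (hn : Odd n) (x y : 𝓞 F)
    (hx : I ^ 2 = Ideal.span {x}) (hy : I ^ n = Ideal.span {y}) : ∃ z, I = Ideal.span {z} := by
  have hm : I ∈ nonZeroDivisors (Ideal (𝓞 F)) := mem_nonZeroDivisors_of_ne_zero hI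
  have h1 : (ClassGroup.mk0 ⟨I, hm⟩) ^ n = 1 := by
    rw [← map_pow]
    exact (ClassGroup.mk0_eq_one_iff (pow_mem hm _)).mpr (by rw [hy]; exact ⟨⟨y, rfl⟩⟩)
  have h2 : (ClassGroup.mk0 ⟨I, hm⟩) ^ 2 = 1 := by
    rw [← map_pow]
    exact (ClassGroup.mk0_eq_one_iff (pow_mem hm _)).mpr (by rw [hx]; exact ⟨⟨x, rfl⟩⟩)
  obtain ⟨k, rfl⟩ := hn
  rw [pow_succ, pow_mul, h2, one_pow, one_mul] at h1
  have := (ClassGroup.mk0_eq_one_iff hm).mp h1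
  exact ⟨_, (Ideal.span_singleton_generator I).symm⟩

lemma princ_cancel (I : Ideal (𝓞 F)) (j y : 𝓞 F) (hj : j ≠ 0)
    (h : I * Ideal.span {j} = Ideal.span {y}) : ∃ z, I = Ideal.span {z} ∧ y = z * j := by
  have h1 : y ∈ Ideal.span {j} := by
    rw [← Ideal.span_singleton_le_iff_mem, ← h]; exact Ideal.le_of_dvd ⟨I, mul_comm _ _⟩
  obtain ⟨z, rfl⟩ := Ideal.mem_span_singleton'.mp h1
  refine ⟨z, ?_, rfl⟩
  rw [← Ideal.span_singleton_mul_span_singleton] at h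
  exact mul_right_cancel₀ (b := Ideal.span {j}) (by simpa using hj) h

lemma exp_unique {P X Y : Ideal (𝓞 F)} (hP : P.IsPrime) (hP0 : P ≠ ⊥) {m n : ℕ}
    (h : P ^ m * X = P ^ n * Y) (hX : ¬ P ∣ X) (hY : ¬ P ∣ Y) : m = n := by
  have key : ∀ {X Y : Ideal (𝓞 F)} {m n : ℕ}, P ^ m * X = P ^ n * Y → ¬ P ∣ X → n ≤ m := by
    intro X Y m n h hX
    by_contra hlt
    push Not at hlt
    obtain ⟨k, rfl⟩ := Nat.exists_eq_add_of_lt hlt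
    have : X = P * (P ^ k * Y) := by
      apply mul_left_cancel₀ (pow_ne_zero m hP0 : P ^ m ≠ 0)
      rw [h]; ring
    exact hX ⟨_, this⟩
  exact le_antisymm (key h.symm hY) (key h hX)

variable {K : Type*} [Field K] [NumberField K] [Algebra F K] {σ : K ≃ₐ[F] K}

lemma RamData.norm_sq {r : Ideal (𝓞 F)} {P : Ideal (𝓞 K)} (d : RamData σ r P) (h : QS σ) (w : 𝓞 K) :
    SqMod r (RingOfIntegers.norm F w) := by
  obtain ⟨a, ha⟩ := d.res w
  refine ⟨a, ?_⟩
  rw [← d.cm, Ideal.mem_comap, map_sub, h.sig_norm, map_pow]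
  have h1 := P.mul_mem_left w (d.sg w)
  have h2 := P.mul_mem_left (w + algebraMap (𝓞 F) (𝓞 K) a) ha
  have := P.add_mem h1 h2
  convert this using 1; ring

lemma RamData.field_norm_sq {r : Ideal (𝓞 F)} {P : Ideal (𝓞 K)} (hF : Odd (classNumber F))
    (d : RamData σ r P) (h : QS σ) 
    (ε : (𝓞 F)ˣ) (hε : ε ∈ unitsNormsFromField F K) : SqMod r (ε : 𝓞 F) := by
  -- get integral equation
  obtain ⟨a, b, ha0, hb0, hab⟩ : ∃ (a : 𝓞 K) (b : 𝓞 F), a ≠ 0 ∧ b ≠ 0 ∧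
      RingOfIntegers.norm F a = ε * b ^ 2 := by
    obtain ⟨x, hx⟩ := hε
    obtain ⟨a, c, hc, hac⟩ := IsFractionRing.div_surjective (A := 𝓞 K) (x : K)
    have hc0 : c ≠ 0 := nonZeroDivisors.ne_zero hc
    have ha0 : a ≠ 0 := by
      rintro rfl
      rw [map_zero, zero_div] at hac
      exact x.ne_zero hac.symm
    have hx' : Algebra.norm F (x : K) = ((ε : 𝓞 F) : F) := congrArg Units.val hx
    have hN0 : RingOfIntegers.norm F c ≠ 0 := by
      intro h0
      have := h.sig_norm c
      rw [h0, map_zero] at this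
      exact mul_ne_zero hc0 (by simpa using hc0 : sig σ c ≠ 0) this.symm
    refine ⟨a * sig σ c, RingOfIntegers.norm F c, mul_ne_zero ha0 (by simpa using hc0), hN0, ?_⟩
    apply FaithfulSMul.algebraMap_injective (𝓞 F) (𝓞 K)
    rw [h.sig_norm, map_mul, map_mul, h.sig_sig, map_pow, h.sig_norm]
    have h1 := h.nrm (x : K)
    rw [hx', ← hac, map_div₀] at h1
    have hcK : (c : K) ≠ 0 := by simpa using hc0
    have hscK : σ (c : K) ≠ 0 := by simpa using hc0
    have h2 : algebraMap F K ((ε : 𝓞 F) : F) * (c * σ c) = a * σ a := by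
      rw [h1]
      change (a : K) / (c : K) * (σ a / σ c) * (c * σ c) = a * σ a
      field_simp
    have h3 : algebraMap (𝓞 F) (𝓞 K) (ε : 𝓞 F) * (c * sig σ c) = a * sig σ a := by
      apply RingOfIntegers.ext
      exact h2
    linear_combination (- c * sig σ c) * h3
  have hPp : Prime P := Ideal.prime_of_isPrime d.P0 d.isP
  have hpp : Prime r := Ideal.prime_of_isPrime d.p0 d.pp
  have hsa : Ideal.span {a} ≠ 0 := by simpa using ha0
  have hsb : Ideal.span {b} ≠ 0 := by simpa using hb0
  obtain ⟨s, A, hA, hsA⟩ := (FiniteMultiplicity.of_prime_left hPp hsa).exists_eq_pow_mul_and_not_dvd |>.imp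
    (fun A hA => hA) |> fun ⟨A, h1, h2⟩ => (⟨_, A, h2, h1⟩ : ∃ s A, ¬ P ∣ A ∧ Ideal.span {a} = P ^ s * A)
  obtain ⟨v, B, hB, hvB⟩ := (FiniteMultiplicity.of_prime_left hpp hsb).exists_eq_pow_mul_and_not_dvd |>.imp
    (fun A hA => hA) |> fun ⟨A, h1, h2⟩ => (⟨_, A, h2, h1⟩ : ∃ s A, ¬ r ∣ A ∧ Ideal.span {b} = r ^ s * A)
  have e1 : (Ideal.span {RingOfIntegers.norm F a}).map (algebraMap (𝓞 F) (𝓞 K)) =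
      P ^ (2 * s) * (A * A.map (sig σ)) := by
    rw [Ideal.map_span, Set.image_singleton, h.sig_norm, ← Ideal.span_singleton_mul_span_singleton,
      ← QS.map_sig_span, hsA, Ideal.map_mul, Ideal.map_pow, d.st]; ring
  have e2 : (Ideal.span {RingOfIntegers.norm F a}).map (algebraMap (𝓞 F) (𝓞 K)) =
      P ^ (4 * v) * (B.map (algebraMap (𝓞 F) (𝓞 K))) ^ 2 := by
    have : Ideal.span {RingOfIntegers.norm F a} = (Ideal.span {b}) ^ 2 := by
      rw [hab, Ideal.span_singleton_pow, mul_comm]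
      exact Ideal.span_singleton_mul_right_unit ε.isUnit _
    rw [this, hvB, Ideal.map_pow, Ideal.map_mul, Ideal.map_pow, d.mp]; ring
  have hsv : 2 * s = 4 * v := by
    refine exp_unique d.isP d.P0 (e1.symm.trans e2) ?_ ?_
    · intro hd
      rcases hPp.dvd_or_dvd hd with h1 | h1
      · exact hA h1
      · apply hA
        rw [Ideal.dvd_iff_le] at h1 ⊢
        have := Ideal.map_mono (f := sig σ) h1
        rwa [h.map_map_sig, d.st] at this
    · intro hd
      have h1 := hPp.dvd_of_dvd_pow hd
      apply hB
      rw [Ideal.dvd_iff_le] at h1 ⊢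
      rw [← d.cm]; exact Ideal.map_le_iff_le_comap.mp h1
  obtain rfl : s = 2 * v := by omega
  obtain ⟨π, hπ⟩ := princ_pow r
  set n := classNumber F with hn
  have hπ0 : π ≠ 0 := by
    rintro rfl
    have : r ^ n = 0 := by rw [hπ]; simp
    exact d.p0 (pow_eq_zero_iff (classNumber_ne_zero F) |>.mp this)
  have ea : A ^ n * Ideal.span {algebraMap (𝓞 F) (𝓞 K) (π ^ v)} = Ideal.span {a ^ n} := by
    rw [← Ideal.span_singleton_pow, hsA, ← Set.image_singleton, ← Ideal.map_span, ← Ideal.span_singleton_pow,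
      ← hπ, Ideal.map_pow, Ideal.map_pow, d.mp]; ring
  have eb : B ^ n * Ideal.span {π ^ v} = Ideal.span {b ^ n} := by
    rw [← Ideal.span_singleton_pow b, hvB, ← Ideal.span_singleton_pow, ← hπ]; ring
  have hπv : π ^ v ≠ 0 := pow_ne_zero _ hπ0
  obtain ⟨a', ha', haa⟩ := princ_cancel _ _ _ (by
    rw [Ne, FaithfulSMul.algebraMap_eq_zero_iff]; exact hπv) ea
  obtain ⟨b', hb', hbb⟩ := princ_cancel _ _ _ hπv eb
  have hb'r : b' ∉ r := by
    intro hm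
    rw [← Ideal.span_singleton_le_iff_mem, ← hb', ← Ideal.dvd_iff_le] at hm
    exact hB (hpp.dvd_of_dvd_pow hm)
  have hfin : RingOfIntegers.norm F a' = ε ^ n * b' ^ 2 := by
    have h1 : RingOfIntegers.norm F (a ^ n) = (ε : 𝓞 F) ^ n * (b ^ n) ^ 2 := by
      rw [map_pow, hab]; ring
    apply mul_right_cancel₀ (b := (π ^ v) ^ 2) (pow_ne_zero _ hπv)
    apply FaithfulSMul.algebraMap_injective (𝓞 F) (𝓞 K)
    rw [haa, hbb] at h1
    have h2 := congrArg (algebraMap (𝓞 F) (𝓞 K)) h1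
    rw [h.sig_norm, map_mul, sig_alg] at h2
    rw [map_mul, h.sig_norm]
    simp only [map_mul, map_pow] at h2 ⊢
    linear_combination h2
  have h1 := d.norm_sq h a'
  rw [hfin] at h1
  have h2 := SqMod.of_mul d.pp d.p0 h1 (SqMod.sq _ _) (fun hm => hb'r (d.pp.mem_of_pow_mem _ hm))
  exact SqMod.of_pow d.pp d.p0 hF h2 (unit_notMem d.pp ε)
end Sq

open NumberField
open scoped Classical

section Gen2
variable {F K : Type*} [Field F] [NumberField F] [Field K] [NumberField K] [Algebra F K]
variable {σ : K ≃ₐ[F] K} {R : Finset (Ideal (𝓞 F))} {P : Ideal (𝓞 F) → Ideal (𝓞 K)}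

lemma exists_two_tors (hodd : ¬ Odd (classNumber K)) : ∃ (I : Ideal (𝓞 K)) (a : 𝓞 K), I ≠ ⊥ ∧
    I ^ 2 = Ideal.span {a} ∧ ¬ ∃ z, I = Ideal.span {z} := by
  rw [Nat.not_odd_iff_even, even_iff_two_dvd] at hodd
  obtain ⟨x, hx⟩ := exists_prime_orderOf_dvd_card 2 (by rwa [classNumber] at hodd : 2 ∣ Fintype.card (ClassGroup (𝓞 K)))
  obtain ⟨⟨I, hI⟩, rfl⟩ := ClassGroup.mk0_surjective x
  have h2 := pow_orderOf_eq_one (ClassGroup.mk0 ⟨I, hI⟩)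
  rw [hx, ← map_pow] at h2
  have h3 := (ClassGroup.mk0_eq_one_iff (pow_mem hI _)).mp h2
  refine ⟨I, _, nonZeroDivisors.ne_zero hI, (Ideal.span_singleton_generator (I ^ 2)).symm, ?_⟩
  rintro ⟨z, hz⟩
  have : ClassGroup.mk0 ⟨I, hI⟩ = 1 := (ClassGroup.mk0_eq_one_iff hI).mpr (by rw [hz]; exact ⟨⟨z, rfl⟩⟩)
  rw [this, orderOf_one] at hx
  omega

lemma Genus.odd (hF : Odd (classNumber F)) (g : Genus σ R P)
    (hall : ∀ S ⊆ R, ∃ (α : 𝓞 K) (J : Ideal (𝓞 F)), α ≠ 0 ∧ J ≠ ⊥ ∧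
        Ideal.span {α} = J.map (algebraMap (𝓞 F) (𝓞 K)) * ∏ r ∈ S, P r)
    (hN : unitsNormsFromField F K ≤ relUnitNormRange F K) : Odd (classNumber K) := by
  have h := g.qs
  by_contra hodd
  -- stable ideals whose square is principal are principal
  have key : ∀ (I : Ideal (𝓞 K)) (x : 𝓞 K), I ≠ ⊥ → I.map (sig σ) = I → I ^ 2 = Ideal.span {x} →
      ∃ z, I = Ideal.span {z} := by
    intro I x hI hst hx
    obtain ⟨J0, S, hJ0, hS, hE⟩ := ambig g _ I hI le_rfl hst
    obtain ⟨α, J, hα, hJ, hαE⟩ := hall S hS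
    set n := classNumber F with hn
    have hn1 : n ≠ 0 := classNumber_ne_zero F
    obtain ⟨j, hj⟩ := princ_pow J
    obtain ⟨k, hk⟩ := hF
    set L := J ^ (2 * k) * J0 with hL
    have hL0 : L ≠ ⊥ := mul_ne_zero (pow_ne_zero _ hJ) hJ0
    have hj0 : j ≠ 0 := by
      rintro rfl
      have : J ^ n = 0 := by rw [hj]; simp
      exact hJ (pow_eq_zero_iff hn1 |>.mp this)
    have hja : algebraMap (𝓞 F) (𝓞 K) j ≠ 0 := by rwa [Ne, FaithfulSMul.algebraMap_eq_zero_iff]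
    have e1 : I * Ideal.span {algebraMap (𝓞 F) (𝓞 K) j} =
        L.map (algebraMap (𝓞 F) (𝓞 K)) * Ideal.span {α} := by
      rw [← Set.image_singleton, ← Ideal.map_span, ← hj, hαE, hE, hL, ← hn, hk, Ideal.map_mul, Ideal.map_pow,
        Ideal.map_pow]
      ring
    obtain ⟨l, hl⟩ := princ_pow L
    have hLm : L.map (algebraMap (𝓞 F) (𝓞 K)) ≠ ⊥ := map_ne_bot hL0
    have e2 : (L.map (algebraMap (𝓞 F) (𝓞 K))) ^ 2 * Ideal.span {α ^ 2} =
        Ideal.span {x * algebraMap (𝓞 F) (𝓞 K) j ^ 2} := by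
      rw [← Ideal.span_singleton_pow, ← mul_pow, ← e1, mul_pow, hx, Ideal.span_singleton_pow,
        Ideal.span_singleton_mul_span_singleton]
    obtain ⟨z, hz, -⟩ := princ_cancel _ _ _ (pow_ne_zero 2 hα) e2
    obtain ⟨y, hy⟩ := princ_two_odd _ hLm n ⟨k, hk⟩ z (algebraMap (𝓞 F) (𝓞 K) l) hz (by
      rw [← Ideal.map_pow, hl, Ideal.map_span, Set.image_singleton])
    rw [hy, Ideal.span_singleton_mul_span_singleton] at e1
    obtain ⟨w, hw, -⟩ := princ_cancel _ _ _ hja e1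
    exact ⟨w, hw⟩
  obtain ⟨A, a, hA, ha, hnp⟩ := exists_two_tors hodd
  have ha0 : a ≠ 0 := by
    rintro rfl
    have : A ^ 2 = 0 := by rw [ha]; simp
    exact hA (pow_eq_zero_iff two_ne_zero |>.mp this)
  have hsa : (A.map (sig σ)) ^ 2 = Ideal.span {sig σ a} := by
    rw [← Ideal.map_pow, ha, QS.map_sig_span]
  have hsA : A.map (sig σ) ≠ ⊥ := by
    intro h0
    have := h.map_map_sig A
    rw [h0, Ideal.map_bot] at this
    exact hA this.symm
  obtain ⟨w, hw⟩ := key (A * A.map (sig σ)) (a * sig σ a) (mul_ne_zero hA hsA)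
    (by rw [Ideal.map_mul, h.map_map_sig, mul_comm])
    (by rw [mul_pow, ha, hsa, Ideal.span_singleton_mul_span_singleton])
  have hw0 : w ≠ 0 := by
    rintro rfl
    have : A * A.map (sig σ) = 0 := by rw [hw]; simp
    exact mul_ne_zero hA hsA this
  have hNs : Ideal.span {RingOfIntegers.norm F w} = Ideal.span {RingOfIntegers.norm F a} := by
    apply map_inj (K := K)
    rw [Ideal.map_span, Ideal.map_span, Set.image_singleton, Set.image_singleton, h.sig_norm, h.sig_norm,
      ← Ideal.span_singleton_mul_span_singleton, ← Ideal.span_singleton_mul_span_singleton,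
      ← QS.map_sig_span (σ := σ), ← QS.map_sig_span (σ := σ), ← hw, ← ha, Ideal.map_mul, h.map_map_sig, Ideal.map_pow]
    ring
  obtain ⟨ε, hε⟩ := exists_unit_of_span_eq hNs
  have hεN : ε ∈ unitsNormsFromField F K := by
    have hwK : (w : K) ≠ 0 := by simpa using hw0
    have haK : (a : K) ≠ 0 := by simpa using ha0
    refine ⟨Units.mk0 ((w : K) / a) (div_ne_zero hwK haK), ?_⟩
    apply Units.ext
    have h1 : Algebra.norm F (w : K) = ((ε : 𝓞 F) : F) * Algebra.norm F (a : K) := by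
      have := congrArg (algebraMap (𝓞 F) F) hε
      rw [map_mul] at this
      exact this
    change Algebra.norm F ((w : K) / a) = ((ε : 𝓞 F) : F)
    have h0 : Algebra.norm F (a : K) ≠ 0 := by rw [Ne, Algebra.norm_eq_zero_iff]; exact haK
    apply mul_right_cancel₀ h0
    rw [← h1, ← map_mul, div_mul_cancel₀ _ haK]
  obtain ⟨ξ, hξ⟩ := hN hεN
  have hξ' : RingOfIntegers.norm F (ξ : 𝓞 K) = (ε : 𝓞 F) := congrArg Units.val hξ
  -- adjust
  set w' : 𝓞 K := (ξ⁻¹ : (𝓞 K)ˣ) * w with hw'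
  have hww : w = ξ * w' := by rw [hw', ← mul_assoc, Units.mul_inv, one_mul]
  have hw'0 : w' ≠ 0 := by intro h0; rw [h0, mul_zero] at hww; exact hw0 hww
  have hNw' : w' * sig σ w' = a * sig σ a := by
    rw [← h.sig_norm, ← h.sig_norm]
    congr 1
    apply mul_left_cancel₀ (ε.ne_zero)
    rw [← hε, ← hξ', ← map_mul, ← hww]
  have hw's : A * A.map (sig σ) = Ideal.span {w'} := by
    rw [hw, hww, mul_comm]
    exact Ideal.span_singleton_mul_right_unit ξ.isUnit _
  obtain ⟨α, hα0, hα⟩ : ∃ α : 𝓞 K, α ≠ 0 ∧ a * α = w' * sig σ α := by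
    have hwK : (w' : K) ≠ 0 := by simpa using hw'0
    have haK : (a : K) ≠ 0 := by simpa using ha0
    have hsaK : σ (a : K) ≠ 0 := by simpa using ha0
    have hn2 : (w' : K) * σ w' = a * σ a := by
      have := congrArg (algebraMap (𝓞 K) K) hNw'
      rw [map_mul, map_mul] at this
      exact this
    obtain ⟨x, hx0, hx⟩ := h.h90 ((w' : K) / a) (by
      rw [map_div₀]; field_simp; exact hn2)
    obtain ⟨b, c, hc, rfl⟩ := IsFractionRing.div_surjective (A := 𝓞 K) x
    have hc0 : c ≠ 0 := nonZeroDivisors.ne_zero hc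
    have hcK : (c : K) ≠ 0 := by simpa using hc0
    have hscK : σ (c : K) ≠ 0 := by simpa using hc0
    have hb0 : b ≠ 0 := by rintro rfl; simp at hx0
    refine ⟨b * sig σ c, mul_ne_zero hb0 (by simpa using hc0), ?_⟩
    apply RingOfIntegers.ext
    rw [map_mul (sig σ), h.sig_sig]
    change (a : K) * (b * σ c) = w' * (σ b * c)
    rw [map_div₀] at hx
    change (b : K) / c = w' / a * (σ b / σ c) at hx
    field_simp at hx
    linear_combination hx
  have hAst : (Ideal.span {α} * A).map (sig σ) = Ideal.span {α} * A := by
    have hne : Ideal.span {w'} * Ideal.span {a} ≠ 0 := mul_ne_zero (by simpa using hw'0) (by simpa using ha0)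
    apply mul_left_cancel₀ hne
    rw [Ideal.map_mul, QS.map_sig_span]
    calc _ = (Ideal.span {w'} * Ideal.span {sig σ α}) * (Ideal.span {a} * A.map (sig σ)) := by ring
      _ = (Ideal.span {a} * Ideal.span {α}) * (A * (A * A.map (sig σ))) := by
        rw [Ideal.span_singleton_mul_span_singleton, ← hα, ← Ideal.span_singleton_mul_span_singleton, ← ha]
        ring
      _ = _ := by rw [hw's]; ring
  obtain ⟨z, hz⟩ := key (Ideal.span {α} * A) (α ^ 2 * a) (mul_ne_zero (by simpa using hα0) hA) hAst
    (by rw [mul_pow, ha, Ideal.span_singleton_pow, Ideal.span_singleton_mul_span_singleton])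
  rw [mul_comm] at hz
  obtain ⟨y, hy, -⟩ := princ_cancel _ _ _ hα0 hz
  exact hnp ⟨y, hy⟩

/-- if `q` splits and `h(K)` is odd then an odd power of `q` is generated by a norm. -/
lemma recip (h : QS σ) (θ : 𝓞 K) (α : 𝓞 F) (hθ : θ ^ 2 = algebraMap (𝓞 F) (𝓞 K) α)
    (hσθ : sig σ θ = - θ) (q : Ideal (𝓞 F)) (hq : q.IsPrime) (hq0 : q ≠ ⊥) (h2 : 2 * α ∉ q)
    (hα : SqMod q α) : ∃ w : 𝓞 K, Ideal.span {RingOfIntegers.norm F w} = q ^ (classNumber K) := by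
  obtain ⟨x, hx⟩ := hα
  set ι := algebraMap (𝓞 F) (𝓞 K) with hι
  set m := q.map ι with hm
  have hx2 : 2 * x ∉ q := by
    intro hm
    rcases hq.mem_or_mem hm with h3 | h3
    · exact h2 (q.mul_mem_right _ h3)
    · apply h2
      apply q.mul_mem_left
      have := q.add_mem hx (q.mul_mem_left x h3)
      convert this using 1; ring
  have hmax := hq.isMaximal hq0
  set Q : Ideal (𝓞 K) := m ⊔ Ideal.span {θ - ι x} with hQ
  have hsQ : Q.map (sig σ) = m ⊔ Ideal.span {θ + ι x} := by
    rw [hQ, Ideal.map_sup, hm, h.map_sig_map, QS.map_sig_span, map_sub, hσθ, sig_alg]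
    congr 1
    rw [← Ideal.span_singleton_neg]; congr 2; ring
  have hQQ : Q * Q.map (sig σ) = m := by
    rw [hsQ]
    apply le_antisymm
    · rw [hQ, Ideal.sup_mul]
      apply sup_le
      · exact Ideal.le_of_dvd ⟨_, rfl⟩
      · rw [Ideal.mul_sup]
        apply sup_le
        · exact Ideal.le_of_dvd ⟨_, mul_comm _ _⟩
        · rw [Ideal.span_singleton_mul_span_singleton, Ideal.span_singleton_le_iff_mem]
          have : (θ - ι x) * (θ + ι x) = ι (α - x ^ 2) := by
            rw [map_sub, map_pow, ← hθ]; ring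
          rw [this]
          exact Ideal.mem_map_of_mem _ hx
    · rw [hm, Ideal.map_le_iff_le_comap]
      intro y hy
      rw [Ideal.mem_comap]
      obtain ⟨z, i, hi, hzi⟩ := hmax.exists_inv hx2
      have hyQ : ι y ∈ Q := Ideal.mem_sup_left (Ideal.mem_map_of_mem _ hy)
      have hyQ' : ι y ∈ m ⊔ Ideal.span {θ + ι x} := Ideal.mem_sup_left (Ideal.mem_map_of_mem _ hy)
      have hiQ' : ι i ∈ m ⊔ Ideal.span {θ + ι x} := Ideal.mem_sup_left (Ideal.mem_map_of_mem _ hi)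
      have t1 : θ - ι x ∈ Q := Ideal.mem_sup_right (Ideal.mem_span_singleton_self _)
      have t2 : θ + ι x ∈ m ⊔ Ideal.span {θ + ι x} := Ideal.mem_sup_right (Ideal.mem_span_singleton_self _)
      have e : ι y = ι z * (ι y * (θ + ι x) - (θ - ι x) * ι y) + ι y * ι i := by
        have : ι (z * (2 * x) + i) = 1 := by rw [hzi, map_one]
        rw [map_add, map_mul, map_mul, map_ofNat] at this
        linear_combination (- ι y) * this
      rw [e]
      exact Ideal.add_mem _ (Ideal.mul_mem_left _ _ (Ideal.sub_mem _ (Ideal.mul_mem_mul hyQ t2)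
        (Ideal.mul_mem_mul t1 hyQ'))) (Ideal.mul_mem_mul hyQ hiQ')
  obtain ⟨w, hw⟩ := princ_pow Q
  refine ⟨w, ?_⟩
  apply map_inj (K := K)
  rw [Ideal.map_span, Set.image_singleton, h.sig_norm, ← Ideal.span_singleton_mul_span_singleton,
    ← QS.map_sig_span, ← hw, Ideal.map_pow, ← mul_pow, hQQ, Ideal.map_pow]

lemma recip2 (hF : Odd (classNumber F)) (hK : Odd (classNumber K)) (h : QS σ) (θ : 𝓞 K) (α : 𝓞 F)
    (hθ : θ ^ 2 = algebraMap (𝓞 F) (𝓞 K) α)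
    (hσθ : sig σ θ = - θ) (q : Ideal (𝓞 F)) (hq : q.IsPrime) (hq0 : q ≠ ⊥) (h2 : 2 * α ∉ q)
    (hα : SqMod q α) (r : Ideal (𝓞 F)) (Pr : Ideal (𝓞 K)) (d : RamData σ r Pr)
    (hrq : r ≠ q) (hu : ∀ u : (𝓞 F)ˣ, SqMod r (u : 𝓞 F)) (π : 𝓞 F)
    (hπ : q ^ (classNumber F) = Ideal.span {π}) : SqMod r π := by
  obtain ⟨w, hw⟩ := recip h θ α hθ hσθ q hq hq0 h2 hα
  have hπr : π ∉ r := by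
    intro hm
    rw [← Ideal.span_singleton_le_iff_mem, ← hπ] at hm
    have := d.pp.le_of_pow_le hm
    exact hrq ((hq.isMaximal hq0).eq_of_le d.pp.ne_top this).symm
  have e : Ideal.span {π ^ (classNumber K)} = Ideal.span {(RingOfIntegers.norm F w) ^ (classNumber F)} := by
    rw [← Ideal.span_singleton_pow, ← Ideal.span_singleton_pow, ← hπ, hw]; ring
  obtain ⟨u, hu'⟩ := exists_unit_of_span_eq e
  apply SqMod.of_pow d.pp d.p0 hK _ hπr
  rw [hu']
  exact (hu u).mul ((d.norm_sq h w).pow _)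

lemma Genus.theta_mem (hF : Odd (classNumber F)) (g : Genus σ R P) (θ : 𝓞 K) (hσθ : sig σ θ = - θ)
    (J : Ideal (𝓞 F)) (hJ : J ≠ ⊥) (S : Finset (Ideal (𝓞 F))) (hS : S ⊆ R)
    (hE : Ideal.span {θ} = J.map (algebraMap (𝓞 F) (𝓞 K)) * ∏ r ∈ S, P r)
    (r : Ideal (𝓞 F)) (hr : r ∈ R) (h2 : (2 : 𝓞 F) ∉ r) : r ∈ S := by
  by_contra hrS
  have d := g.ram r hr
  obtain ⟨j, hj⟩ := princ_pow J
  have hj0 : j ≠ 0 := by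
    rintro rfl
    have : J ^ classNumber F = 0 := by rw [hj]; simp
    exact hJ (pow_eq_zero_iff (classNumber_ne_zero F) |>.mp this)
  have hja : algebraMap (𝓞 F) (𝓞 K) j ≠ 0 := by rwa [Ne, FaithfulSMul.algebraMap_eq_zero_iff]
  have e : (∏ r ∈ S, P r) ^ classNumber F * Ideal.span {algebraMap (𝓞 F) (𝓞 K) j} =
      Ideal.span {θ ^ classNumber F} := by
    rw [← Ideal.span_singleton_pow, hE, mul_pow, ← Ideal.map_pow, hj, Ideal.map_span, Set.image_singleton]
    ring
  obtain ⟨y, hy, hyj⟩ := princ_cancel _ _ _ hja e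
  have hσy : sig σ y = - y := by
    apply mul_right_cancel₀ hja
    rw [neg_mul, ← hyj]
    conv_lhs => rw [← sig_alg σ j, ← map_mul, ← hyj, map_pow, hσθ]
    exact hF.neg_pow _
  have h1 := d.sg y
  rw [hσy] at h1
  have h3 : algebraMap (𝓞 F) (𝓞 K) 2 * y ∈ P r := by
    have := (P r).neg_mem h1
    convert this using 1; rw [map_ofNat]; ring
  rcases d.isP.mem_or_mem h3 with h4 | h4
  · apply h2; rw [← d.cm]; exact h4
  · have hpr : Prime (P r) := Ideal.prime_of_isPrime d.P0 d.isP
    rw [← Ideal.span_singleton_le_iff_mem, ← hy, ← Ideal.dvd_iff_le] at h4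
    have h5 := hpr.dvd_of_dvd_pow h4
    obtain ⟨t, ht, htd⟩ := (Prime.dvd_finsetProd_iff hpr _).mp h5
    rw [Ideal.dvd_iff_le] at htd
    have d' := g.ram t (hS ht)
    have : P t = P r := (d'.isP.isMaximal d'.P0).eq_of_le d.isP.ne_top htd
    apply hrS
    rw [← d.cm, ← this, d'.cm]; exact ht
end Gen2

open NumberField
open scoped Classical

section Zeta
open Filter Topology
variable (K : Type*) [Field K] [NumberField K]

noncomputable def zw (s : ℝ) (I : Ideal (𝓞 K)) : ENNReal :=
  if I = ⊥ then 0 else ENNReal.ofReal ((Ideal.absNorm I : ℝ) ^ (-s))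

noncomputable def zE (s : ℝ) : ENNReal := ∑' I : Ideal (𝓞 K), zw K s I

lemma zE_lim : ∃ (z : ℝ → ℝ) (c : ℝ), (∀ s, 0 ≤ z s) ∧ 0 < c ∧
    (∀ᶠ s in 𝓝[>] (1 : ℝ), zE K s = ENNReal.ofReal (z s)) ∧
    Tendsto (fun s : ℝ => (s - 1) * z s) (𝓝[>] 1) (𝓝 c) := by
  have hlim := tendsto_sub_one_mul_dedekindZeta_nhdsGT K
  have hc := dedekindZeta_residue_pos K
  set c := dedekindZeta_residue K
  refine ⟨fun s => ‖dedekindZeta K s‖, c, fun s => norm_nonneg _, hc, ?_, ?_⟩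
  · have hne : ∀ᶠ s : ℝ in 𝓝[>] (1 : ℝ), ((s : ℂ) - 1) * dedekindZeta K s ≠ 0 := by
      apply hlim.eventually_ne
      exact_mod_cast hc.ne'
    filter_upwards [hne, self_mem_nhdsWithin] with s hs hs1
    have hs1 : 1 < s := hs1
    have hz := right_ne_zero_of_mul hs
    set f : ℕ → ℂ := fun n => (Nat.card {I : Ideal (𝓞 K) // Ideal.absNorm I = n} : ℂ) with hf
    set t : ℕ → ℝ := fun n => if n = 0 then 0 else (Nat.card {I : Ideal (𝓞 K) // Ideal.absNorm I = n} : ℝ) * (n : ℝ) ^ (-s) with ht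
    have ht0 : ∀ n, 0 ≤ t n := by intro n; simp only [ht]; split_ifs <;> positivity
    have hterm : ∀ n, LSeries.term f s n = ((t n : ℝ) : ℂ) := by
      intro n
      rw [LSeries.term_def]
      simp only [ht]
      split_ifs with h0
      · simp
      · rw [Complex.ofReal_mul, Complex.ofReal_cpow (by positivity), Complex.ofReal_neg, Complex.cpow_neg, div_eq_mul_inv]
        simp [hf]
    have hsum : LSeriesSummable f s := by
      by_contra hns
      apply hz
      exact tsum_eq_zero_of_not_summable hns
    have hsumt : Summable t := by
      have : Summable (fun n => ((t n : ℝ) : ℂ)) := by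
        simp only [← hterm]; exact hsum
      exact_mod_cast this
    have hzt : dedekindZeta K s = ((∑' n, t n : ℝ) : ℂ) := by
      rw [Complex.ofReal_tsum]
      exact tsum_congr hterm
    rw [hzt, Complex.norm_real, Real.norm_of_nonneg (tsum_nonneg ht0), ENNReal.ofReal_tsum_of_nonneg ht0 hsumt]
    rw [zE, ← (Equiv.sigmaFiberEquiv (fun I : Ideal (𝓞 K) => Ideal.absNorm I)).tsum_eq, ENNReal.tsum_sigma']
    refine tsum_congr fun n => ?_
    have : Finite {I : Ideal (𝓞 K) // Ideal.absNorm I = n} := Ideal.finite_setOf_absNorm_eq n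
    have hv : ∀ I : {I : Ideal (𝓞 K) // Ideal.absNorm I = n},
       zw K s ((Equiv.sigmaFiberEquiv (fun I : Ideal (𝓞 K) => Ideal.absNorm I)) ⟨n, I⟩) =
         if n = 0 then 0 else ENNReal.ofReal ((n : ℝ) ^ (-s)) := by
      rintro ⟨I, rfl⟩
      by_cases hI : I = ⊥ <;> simp [zw, Equiv.sigmaFiberEquiv, Ideal.absNorm_eq_zero_iff, hI]
    simp_rw [hv]
    simp only [ht]
    split_ifs with h0
    · simp
    · rw [ENNReal.tsum_const, ENat.card_eq_coe_natCard, ENNReal.ofReal_mul (by positivity), ENNReal.ofReal_natCast]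
      simp
  · have h1 := hlim.norm
    rw [Complex.norm_real, Real.norm_of_nonneg hc.le] at h1
    refine h1.congr' ?_
    filter_upwards [self_mem_nhdsWithin] with s hs
    have hs : 1 < s := hs
    rw [norm_mul]
    congr 1
    rw [← Complex.ofReal_one, ← Complex.ofReal_sub, Complex.norm_real, Real.norm_of_nonneg (by linarith)]
end Zeta

open NumberField
open scoped Classical

section Zeta2
variable (K : Type*) [Field K] [NumberField K]

noncomputable def zT (T : Finset (Ideal (𝓞 K))) (s : ℝ) : ENNReal :=
  ∑' I : Ideal (𝓞 K), if (∀ t ∈ T, ¬ t ∣ I) then zw K s I else 0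

lemma zw_mul (s : ℝ) (I J : Ideal (𝓞 K)) : zw K s (I * J) = zw K s I * zw K s J := by
  rw [zw, zw, zw]
  by_cases hI : I = ⊥
  · have : I * J = ⊥ := by rw [hI, Ideal.bot_mul]
    simp [hI]
  by_cases hJ : J = ⊥
  · have : I * J = ⊥ := by rw [hJ, Ideal.mul_bot]
    simp [hJ]
  have : I * J ≠ ⊥ := mul_ne_zero hI hJ
  rw [if_neg hI, if_neg hJ, if_neg this, map_mul, Nat.cast_mul, Real.mul_rpow (by positivity) (by positivity),
    ENNReal.ofReal_mul (by positivity)]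

lemma zw_prime (s : ℝ) (hs : 1 ≤ s) (p : Ideal (𝓞 K)) (hp : p.IsPrime) (hp0 : p ≠ ⊥) :
    zw K s p ≤ ENNReal.ofReal (1 / 2) := by
  rw [zw, if_neg hp0]
  apply ENNReal.ofReal_le_ofReal
  have h0 : Ideal.absNorm p ≠ 0 := by rwa [Ne, Ideal.absNorm_eq_zero_iff]
  have h1 : Ideal.absNorm p ≠ 1 := by rw [Ne, Ideal.absNorm_eq_one_iff]; exact hp.ne_top
  have h2 : 2 ≤ Ideal.absNorm p := by omega
  have h2' : (2 : ℝ) ≤ Ideal.absNorm p := by exact_mod_cast h2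
  calc (Ideal.absNorm p : ℝ) ^ (-s) ≤ (Ideal.absNorm p : ℝ) ^ (-1 : ℝ) :=
        Real.rpow_le_rpow_of_exponent_le (by linarith) (by linarith)
    _ = (Ideal.absNorm p : ℝ)⁻¹ := Real.rpow_neg_one _
    _ ≤ 1 / 2 := by rw [one_div]; exact inv_anti₀ (by norm_num) h2'

lemma zT_step (T : Finset (Ideal (𝓞 K))) (s : ℝ) (hs : 1 ≤ s) (p : Ideal (𝓞 K)) (hp : p.IsPrime) (hp0 : p ≠ ⊥) :
    zT K T s ≤ zT K (insert p T) s + ENNReal.ofReal (1 / 2) * zT K T s := by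
  have h1 : zT K T s = zT K (insert p T) s +
      ∑' I : Ideal (𝓞 K), if p ∣ I then (if (∀ t ∈ T, ¬ t ∣ I) then zw K s I else 0) else 0 := by
    rw [zT, zT, ← ENNReal.tsum_add]
    refine tsum_congr fun I => ?_
    by_cases hpI : p ∣ I <;> simp [hpI]
  conv_lhs => rw [h1]
  gcongr
  rw [← Function.Injective.tsum_eq (g := fun J : Ideal (𝓞 K) => p * J) (mul_right_injective₀ hp0)]
  · rw [zT, ← ENNReal.tsum_mul_left]
    refine ENNReal.tsum_le_tsum fun J => ?_
    rw [if_pos (Dvd.intro _ rfl)]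
    by_cases hJ : ∀ t ∈ T, ¬ t ∣ p * J
    · rw [if_pos hJ, if_pos (fun t ht hd => hJ t ht (hd.mul_left p)), zw_mul]
      gcongr
      exact zw_prime K s hs p hp hp0
    · rw [if_neg hJ]; exact zero_le
  · intro I hI
    rw [Function.mem_support] at hI
    have : p ∣ I := by by_contra h; simp [h] at hI
    obtain ⟨J, rfl⟩ := this
    exact ⟨J, rfl⟩

lemma zT_le (T : Finset (Ideal (𝓞 K))) (s : ℝ) : zT K T s ≤ zE K s := by
  rw [zT, zE]
  refine ENNReal.tsum_le_tsum fun J => ?_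
  split_ifs
  · exact le_rfl
  · exact zero_le

lemma zE_le (s : ℝ) (hs : 1 ≤ s) (hfin : zE K s ≠ ⊤) (T : Finset (Ideal (𝓞 K)))
    (hT : ∀ p ∈ T, p.IsPrime ∧ p ≠ ⊥) : zE K s ≤ 2 ^ T.card * zT K T s := by
  induction T using Finset.induction_on with
  | empty => simp [zT, zE]
  | insert p T hpT ih =>
    refine (ih fun q hq => hT q (by simp [hq])).trans ?_
    rw [Finset.card_insert_of_notMem hpT, pow_succ, mul_assoc]
    gcongr
    obtain ⟨hp, hp0⟩ := hT p (by simp)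
    have hst := zT_step K T s hs p hp hp0
    have hf : zT K T s ≠ ⊤ := ne_top_of_le_ne_top hfin (zT_le K T s)
    have hf2 : zT K (insert p T) s ≠ ⊤ := ne_top_of_le_ne_top hfin (zT_le K _ s)
    generalize zT K T s = x at *
    generalize zT K (insert p T) s = y at *
    lift x to NNReal using hf
    lift y to NNReal using hf2
    rw [ENNReal.ofReal] at hst
    norm_cast at hst ⊢
    rw [← NNReal.coe_le_coe] at hst ⊢
    push_cast at hst ⊢
    rw [Real.coe_toNNReal _ (by norm_num)] at hst
    linarith

open UniqueFactorizationMonoid in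
lemma pair_rec {F : Type*} [Field F] [NumberField F] [Algebra F K] (Q Q' : Ideal (𝓞 F) → Ideal (𝓞 K))
    (A B : Multiset (Ideal (𝓞 F)))
    (hA : ∀ p ∈ A, (Q p).comap (algebraMap (𝓞 F) (𝓞 K)) = p)
    (hB : ∀ p ∈ B, (Q' p).comap (algebraMap (𝓞 F) (𝓞 K)) = p ∧ Q p ≠ Q' p) :
    (((A.map Q + B.map Q').filter (fun P => P = Q (P.comap (algebraMap (𝓞 F) (𝓞 K))))).map
      (fun P => P.comap (algebraMap (𝓞 F) (𝓞 K)))) = A := by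
  rw [Multiset.filter_add, Multiset.filter_eq_self.mpr, Multiset.filter_eq_nil.mpr, add_zero, Multiset.map_map]
  · conv_rhs => rw [← Multiset.map_id A]
    exact Multiset.map_congr rfl fun p hp => hA p hp
  · intro P hP
    obtain ⟨p, hp, rfl⟩ := Multiset.mem_map.mp hP
    rw [(hB p hp).1]
    exact (hB p hp).2.symm
  · intro P hP
    obtain ⟨p, hp, rfl⟩ := Multiset.mem_map.mp hP
    rw [hA p hp]

open UniqueFactorizationMonoid in
lemma pair_le {F : Type*} [Field F] [NumberField F] [Algebra F K] (T : Finset (Ideal (𝓞 F)))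
    (Q Q' : Ideal (𝓞 F) → Ideal (𝓞 K))
    (h : ∀ p : Ideal (𝓞 F), p.IsPrime → p ≠ ⊥ → p ∉ T → (Q p).IsPrime ∧ (Q' p).IsPrime ∧
      (Q p).absNorm = p.absNorm ∧ (Q' p).absNorm = p.absNorm ∧
      (Q p).comap (algebraMap (𝓞 F) (𝓞 K)) = p ∧ (Q' p).comap (algebraMap (𝓞 F) (𝓞 K)) = p ∧
      Q p ≠ Q' p) (s : ℝ) : zT F T s * zT F T s ≤ zE K s := by
  set G : Set (Ideal (𝓞 F)) := {I | I ≠ ⊥ ∧ ∀ t ∈ T, ¬ t ∣ I} with hG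
  have hz : zT F T s = ∑' I : G, zw F s I := by
    rw [tsum_subtype, zT]
    refine tsum_congr fun I => ?_
    by_cases hI : I = ⊥
    · simp [zw, hI, Set.indicator, hG]
    · simp only [Set.indicator, hG, Set.mem_setOf_eq]
      simp only [ne_eq, hI, not_false_eq_true, true_and]
  have hgood : ∀ I ∈ G, ∀ p ∈ normalizedFactors I, p.IsPrime ∧ p ≠ ⊥ ∧ p ∉ T := by
    rintro I ⟨hI, hIT⟩ p hp
    have hpp := prime_of_normalized_factor p hp
    exact ⟨Ideal.isPrime_of_prime hpp, hpp.ne_zero, fun ht => hIT p ht (dvd_of_mem_normalizedFactors hp)⟩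
  have hnb : ∀ (p : Ideal (𝓞 F)) (P : Ideal (𝓞 K)), p ≠ ⊥ → P.absNorm = p.absNorm → P ≠ ⊥ := by
    intro p P hp hN hP
    rw [← Ideal.absNorm_eq_zero_iff] at hP
    rw [hP] at hN
    exact hp (Ideal.absNorm_eq_zero_iff.mp hN.symm)
  set f : (Ideal (𝓞 F) → Ideal (𝓞 K)) → Ideal (𝓞 F) → Ideal (𝓞 K) :=
    fun Q I => ((normalizedFactors I).map Q).prod with hf
  have hN : ∀ Q : Ideal (𝓞 F) → Ideal (𝓞 K), (∀ p : Ideal (𝓞 F), p.IsPrime → p ≠ ⊥ → p ∉ T →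
      (Q p).absNorm = p.absNorm) → ∀ I ∈ G, (f Q I).absNorm = I.absNorm := by
    intro Q hQ I hI
    rw [hf]
    conv_rhs => rw [← Ideal.prod_normalizedFactors_eq_self hI.1]
    rw [map_multiset_prod, map_multiset_prod, Multiset.map_map]
    congr 1
    refine Multiset.map_congr rfl fun p hp => ?_
    obtain ⟨h1, h2, h3⟩ := hgood I hI p hp
    exact hQ p h1 h2 h3
  have hNf : ∀ Q : Ideal (𝓞 F) → Ideal (𝓞 K), (∀ p : Ideal (𝓞 F), p.IsPrime → p ≠ ⊥ → p ∉ T →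
      (Q p).IsPrime ∧ (Q p).absNorm = p.absNorm) → ∀ I ∈ G, f Q I ≠ ⊥ ∧
        normalizedFactors (f Q I) = (normalizedFactors I).map Q := by
    intro Q hQ I hI
    constructor
    · exact hnb I _ hI.1 (hN Q (fun p h1 h2 h3 => (hQ p h1 h2 h3).2) I hI)
    · refine normalizedFactors_prod_of_prime ?_
      intro P hP
      obtain ⟨p, hp, rfl⟩ := Multiset.mem_map.mp hP
      obtain ⟨h1, h2, h3⟩ := hgood I hI p hp
      obtain ⟨h4, h5⟩ := hQ p h1 h2 h3
      exact Ideal.prime_of_isPrime (hnb p _ h2 h5) h4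
  have hN1 := hN Q fun p h1 h2 h3 => (h p h1 h2 h3).2.2.1
  have hN2 := hN Q' fun p h1 h2 h3 => (h p h1 h2 h3).2.2.2.1
  have hF1 := hNf Q fun p h1 h2 h3 => ⟨(h p h1 h2 h3).1, (h p h1 h2 h3).2.2.1⟩
  have hF2 := hNf Q' fun p h1 h2 h3 => ⟨(h p h1 h2 h3).2.1, (h p h1 h2 h3).2.2.2.1⟩
  set Φ : G × G → Ideal (𝓞 K) := fun x => f Q x.1 * f Q' x.2 with hΦ
  have hfac : ∀ x, normalizedFactors (Φ x) = (normalizedFactors x.1.1).map Q + (normalizedFactors x.2.1).map Q' := by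
    rintro ⟨⟨I, hI⟩, ⟨J, hJ⟩⟩
    simp only [hΦ]
    rw [normalizedFactors_mul (hF1 I hI).1 (hF2 J hJ).1, (hF1 I hI).2, (hF2 J hJ).2]
  have hinj : Function.Injective Φ := by
    intro x y hxy
    have e := congrArg normalizedFactors hxy
    rw [hfac, hfac] at e
    have r1 : ∀ x : G × G, _ := fun x => pair_rec K Q Q' (normalizedFactors x.1.1) (normalizedFactors x.2.1)
      (fun p hp => by
        obtain ⟨h1, h2, h3⟩ := hgood _ x.1.2 p hp
        exact (h p h1 h2 h3).2.2.2.2.1)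
      (fun p hp => by
        obtain ⟨h1, h2, h3⟩ := hgood _ x.2.2 p hp
        exact ⟨(h p h1 h2 h3).2.2.2.2.2.1, (h p h1 h2 h3).2.2.2.2.2.2⟩)
    have r2 : ∀ x : G × G, _ := fun x => pair_rec K Q' Q (normalizedFactors x.2.1) (normalizedFactors x.1.1)
      (fun p hp => by
        obtain ⟨h1, h2, h3⟩ := hgood _ x.2.2 p hp
        exact (h p h1 h2 h3).2.2.2.2.2.1)
      (fun p hp => by
        obtain ⟨h1, h2, h3⟩ := hgood _ x.1.2 p hp
        exact ⟨(h p h1 h2 h3).2.2.2.2.1, (h p h1 h2 h3).2.2.2.2.2.2.symm⟩)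
    have e1 : normalizedFactors x.1.1 = normalizedFactors y.1.1 := by
      rw [← r1 x, ← r1 y, e]
    have e2 : normalizedFactors x.2.1 = normalizedFactors y.2.1 := by
      rw [← r2 x, ← r2 y, add_comm, e, add_comm]
    apply Prod.ext
    · apply Subtype.ext
      rw [← Ideal.prod_normalizedFactors_eq_self x.1.2.1, e1, Ideal.prod_normalizedFactors_eq_self y.1.2.1]
    · apply Subtype.ext
      rw [← Ideal.prod_normalizedFactors_eq_self x.2.2.1, e2, Ideal.prod_normalizedFactors_eq_self y.2.2.1]
  have hval : ∀ x : G × G, zw K s (Φ x) = zw F s x.1 * zw F s x.2 := by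
    rintro ⟨⟨I, hI⟩, ⟨J, hJ⟩⟩
    simp only [hΦ]
    rw [zw_mul, zw, zw, zw, zw, if_neg hI.1, if_neg hJ.1, if_neg (hF1 I hI).1, if_neg (hF2 J hJ).1, hN1 I hI, hN2 J hJ]
  calc zT F T s * zT F T s = ∑' x : G × G, zw F s x.1 * zw F s x.2 := by
        rw [hz, ENNReal.tsum_prod', ← ENNReal.tsum_mul_right]
        refine tsum_congr fun I => ?_
        rw [← ENNReal.tsum_mul_left]
    _ = ∑' x : G × G, zw K s (Φ x) := by simp_rw [hval]
    _ ≤ zE K s := ENNReal.tsum_comp_le_tsum_of_injective hinj _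
end Zeta2

open NumberField
open scoped Classical

section NonSq
variable {F : Type*} [Field F] [NumberField F]

lemma int_sq (a : 𝓞 F) (h : IsSquare (a : F)) : IsSquare a := by
  obtain ⟨b, hb⟩ := h
  have hi : IsIntegral ℤ b := by
    apply IsIntegral.of_pow (n := 2) (by norm_num)
    rw [pow_two, ← hb]
    exact RingOfIntegers.isIntegral_coe a
  exact ⟨⟨b, hi⟩, RingOfIntegers.ext hb⟩

lemma quad_data (a : 𝓞 F) (ha : ¬ IsSquare a) {K : Type*} [Field K] [NumberField K] [Algebra F K]
    {σ : K ≃ₐ[F] K} (h : QS σ) (θ : K) (hθ : θ ^ 2 = algebraMap F K a) :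
    ∃ t : 𝓞 K, (t : K) = θ ∧ t ^ 2 = algebraMap (𝓞 F) (𝓞 K) a ∧ sig σ t = - t := by
  have hi : IsIntegral ℤ θ := by
    apply IsIntegral.of_pow (n := 2) (by norm_num)
    rw [hθ]
    exact (RingOfIntegers.isIntegral_coe a).map (IsScalarTower.toAlgHom ℤ F K)
  refine ⟨⟨θ, hi⟩, rfl, RingOfIntegers.ext hθ, RingOfIntegers.ext ?_⟩
  change σ θ = - θ
  have h1 : (σ θ) ^ 2 = θ ^ 2 := by rw [← map_pow, hθ, AlgEquiv.commutes]
  rcases sq_eq_sq_iff_eq_or_eq_neg.mp h1 with h2 | h2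
  · exfalso
    obtain ⟨y, hy⟩ := h.fix θ h2
    apply ha
    apply int_sq
    refine ⟨y, ?_⟩
    apply (algebraMap F K).injective
    rw [map_mul, hy, ← hθ, pow_two]
  · exact h2

lemma absNorm_sig {K : Type*} [Field K] [NumberField K] [Algebra F K]
    (σ : K ≃ₐ[F] K) (I : Ideal (𝓞 K)) : (I.map (sig σ)).absNorm = I.absNorm := by
  rw [Ideal.absNorm_apply, Ideal.absNorm_apply, Submodule.cardQuot_apply, Submodule.cardQuot_apply]
  exact (Nat.card_congr (Ideal.quotientEquiv I (I.map (sig σ)) (sig σ) rfl).toEquiv).symm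

lemma split_prime {K : Type*} [Field K] [NumberField K] [Algebra F K] (hdeg : Module.finrank F K = 2)
    {σ : K ≃ₐ[F] K} (h : QS σ) (a : 𝓞 F) (t : 𝓞 K) (ht : t ^ 2 = algebraMap (𝓞 F) (𝓞 K) a)
    (hst : sig σ t = -t) (p : Ideal (𝓞 F)) (hp : p.IsPrime) (hp0 : p ≠ ⊥) (h2a : 2 * a ∉ p) (hsq : SqMod p a) :
    ∃ P : Ideal (𝓞 K), P.IsPrime ∧ P.absNorm = p.absNorm ∧
      P.comap (algebraMap (𝓞 F) (𝓞 K)) = p ∧ P.map (sig σ) ≠ P := by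
  obtain ⟨x, hx⟩ := hsq
  set X := algebraMap (𝓞 F) (𝓞 K) x with hX
  have hpm := hp.isMaximal hp0
  set M := p.map (algebraMap (𝓞 F) (𝓞 K)) with hM
  have hMtop : M ≠ ⊤ := by
    intro hMt
    have h1 := absNorm_map hdeg p
    rw [← hM, hMt, Ideal.absNorm_top] at h1
    have : p.absNorm = 1 := by nlinarith
    rw [Ideal.absNorm_eq_one_iff] at this
    exact hp.ne_top this
  have hprod : (t - X) * (t + X) ∈ M := by
    have := Ideal.mem_map_of_mem (algebraMap (𝓞 F) (𝓞 K)) hx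
    convert this using 1
    rw [map_sub, map_pow, ← ht]; ring
  obtain ⟨P0, hP0, hMP0⟩ := Ideal.exists_le_maximal M hMtop
  -- a prime containing t - X
  obtain ⟨P, hP, hMP, htP⟩ : ∃ P : Ideal (𝓞 K), P.IsPrime ∧ M ≤ P ∧ t - X ∈ P := by
    rcases hP0.isPrime.mem_or_mem (hMP0 hprod) with h1 | h1
    · exact ⟨P0, hP0.isPrime, hMP0, h1⟩
    · refine ⟨P0.map (sig σ), ?_, ?_, ?_⟩
      · have := hP0.isPrime
        exact Ideal.map_isPrime_of_equiv (sig σ)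
      · rw [hM, ← h.map_sig_map p]; exact Ideal.map_mono hMP0
      · rw [h.mem_map_sig, map_sub, hst, sig_alg]
        have := P0.neg_mem h1
        convert this using 1; ring
  have hcm := prime_comap_eq p hp hp0 P hP hMP
  have hP0' : P ≠ ⊥ := by
    rintro rfl
    exact map_ne_bot (K := K) hp0 (le_bot_iff.mp hMP)
  have hne : P.map (sig σ) ≠ P := by
    intro he
    have h1 : t + X ∈ P := by
      rw [← he, h.mem_map_sig, map_add, hst, sig_alg]
      have := P.neg_mem htP
      convert this using 1; ring
    have h3 : (2 * t) ^ 2 ∈ P := by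
      rw [pow_two]; apply P.mul_mem_left
      convert P.add_mem htP h1 using 1; ring
    have h4 : algebraMap (𝓞 F) (𝓞 K) (2 * (2 * a)) ∈ P := by
      convert h3 using 1
      rw [mul_pow, ht, map_mul, map_mul, map_ofNat]; ring
    have h5 : 2 * (2 * a) ∈ p := by rw [← hcm]; exact h4
    rcases hp.mem_or_mem h5 with h6 | h6
    · exact h2a (p.mul_mem_right _ h6)
    · exact h2a h6
  refine ⟨P, hP, ?_, hcm, hne⟩
  have hMP' : M ≤ P.map (sig σ) := by rw [hM, ← h.map_sig_map p]; exact Ideal.map_mono hMP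
  have hsP : (P.map (sig σ)).IsPrime := Ideal.map_isPrime_of_equiv (sig σ)
  have hsP0 : P.map (sig σ) ≠ ⊥ := by
    intro h0
    have := h.map_map_sig P
    rw [h0, Ideal.map_bot] at this
    exact hP0' this.symm
  have hdvd : P * P.map (sig σ) ∣ M := by
    obtain ⟨J, hJ⟩ := Ideal.dvd_iff_le.mpr hMP
    have h1 : P.map (sig σ) ∣ P * J := by rw [← hJ]; exact Ideal.dvd_iff_le.mpr hMP'
    rcases (Ideal.prime_of_isPrime hsP0 hsP).dvd_or_dvd h1 with h2 | h2
    · exfalso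
      have := Ideal.dvd_iff_le.mp h2
      exact hne ((hP.isMaximal hP0').eq_of_le hsP.ne_top this).symm
    · rw [hJ]; exact mul_dvd_mul_left _ h2
  have hle : P.absNorm * P.absNorm ≤ p.absNorm ^ 2 := by
    rw [← absNorm_map hdeg, ← hM]
    have := map_dvd Ideal.absNorm hdvd
    rw [map_mul, absNorm_sig] at this
    refine Nat.le_of_dvd (Nat.pos_of_ne_zero ?_) this
    rw [Ne, Ideal.absNorm_eq_zero_iff]; exact map_ne_bot hp0
  have hge : p.absNorm ≤ P.absNorm := by
    obtain ⟨f, hf, -⟩ := res_inj p P hcm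
    rw [Ideal.absNorm_apply, Ideal.absNorm_apply, Submodule.cardQuot_apply, Submodule.cardQuot_apply]
    have : Finite (𝓞 K ⧸ P) := (Ideal.absNorm_ne_zero_iff P).mp (by rwa [Ne, Ideal.absNorm_eq_zero_iff])
    exact Nat.card_le_card_of_injective f hf
  nlinarith

open Filter Topology in
theorem exists_nonsq (a d : 𝓞 F) (ha : ¬ IsSquare a) (hd : d ≠ 0) :
    ∃ s : Ideal (𝓞 F), s.IsPrime ∧ s ≠ ⊥ ∧ d ∉ s ∧ ¬ SqMod s a := by
  by_contra hcon
  push Not at hcon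
  have ha0 : a ≠ 0 := by rintro rfl; exact ha ⟨0, by simp⟩
  obtain ⟨K, _, _, _, hdeg, ⟨θ, hθ⟩, -⟩ := exists_quad (a : F) (fun h => ha (int_sq a h))
  obtain ⟨σ, h⟩ := QS.exists hdeg
  obtain ⟨t, -, ht, hst⟩ := quad_data a ha h θ hθ
  set D : 𝓞 F := 2 * a * d with hD
  have hD0 : D ≠ 0 := mul_ne_zero (mul_ne_zero two_ne_zero ha0) hd
  set T := (UniqueFactorizationMonoid.normalizedFactors (Ideal.span {D})).toFinset with hT
  have hsD0 : Ideal.span {D} ≠ 0 := by simpa using hD0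
  have hTp : ∀ p ∈ T, p.IsPrime ∧ p ≠ ⊥ := by
    intro p hp
    have := UniqueFactorizationMonoid.prime_of_normalized_factor p (Multiset.mem_toFinset.mp hp)
    exact ⟨Ideal.isPrime_of_prime this, this.ne_zero⟩
  have hTn : ∀ p : Ideal (𝓞 F), p.IsPrime → p ≠ ⊥ → p ∉ T → D ∉ p := by
    intro p hp hp0 hpT hDp
    apply hpT
    rw [hT, Multiset.mem_toFinset, Ideal.mem_normalizedFactors_iff hsD0]
    exact ⟨hp, by rwa [Ideal.span_singleton_le_iff_mem]⟩
  have hex : ∀ p : Ideal (𝓞 F), ∃ P : Ideal (𝓞 K), p.IsPrime → p ≠ ⊥ → p ∉ T → P.IsPrime ∧ P.absNorm = p.absNorm ∧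
      P.comap (algebraMap (𝓞 F) (𝓞 K)) = p ∧ P.map (sig σ) ≠ P := by
    intro p
    by_cases hpp : p.IsPrime ∧ p ≠ ⊥ ∧ p ∉ T
    · obtain ⟨hp, hp0, hpT⟩ := hpp
      have hDp := hTn p hp hp0 hpT
      obtain ⟨P, hP⟩ := split_prime hdeg h a t ht hst p hp hp0 (fun hh => hDp (p.mul_mem_right _ hh))
        (hcon p hp hp0 (fun hh => hDp (p.mul_mem_left _ hh)))
      exact ⟨P, fun _ _ _ => hP⟩
    · exact ⟨⊥, fun h1 h2 h3 => (hpp ⟨h1, h2, h3⟩).elim⟩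
  choose Q hQ using hex
  have hpair := pair_le K T Q (fun p => (Q p).map (sig σ)) (by
    intro p hp hp0 hpT
    obtain ⟨h1, h2, h3, h4⟩ := hQ p hp hp0 hpT
    refine ⟨h1, Ideal.map_isPrime_of_equiv (sig σ), h2, by rw [absNorm_sig, h2], h3, ?_, h4.symm⟩
    refine Eq.trans ?_ h3
    ext x
    rw [Ideal.mem_comap, h.mem_map_sig, sig_alg, Ideal.mem_comap])
  obtain ⟨z, c, hz0, hc, hz, hlim⟩ := zE_lim F
  obtain ⟨z', c', hz0', hc', hz', hlim'⟩ := zE_lim K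
  set C : ℝ := 2 ^ T.card with hC
  have hev : ∀ᶠ s in 𝓝[>] (1 : ℝ), ((s - 1) * z s) ^ 2 ≤ C ^ 2 * ((s - 1) * ((s - 1) * z' s)) := by
    filter_upwards [hz, hz', self_mem_nhdsWithin] with s h1 h2 hs
    have hs : 1 < s := hs
    have hle := zE_le F s hs.le (by rw [h1]; exact ENNReal.ofReal_ne_top) T hTp
    have : z s ^ 2 ≤ C ^ 2 * z' s := by
      have e : zE F s * zE F s ≤ (2 ^ T.card * 2 ^ T.card) * zE K s :=
        calc _ ≤ (2 ^ T.card * zT F T s) * (2 ^ T.card * zT F T s) := by gcongr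
          _ = (2 ^ T.card * 2 ^ T.card) * (zT F T s * zT F T s) := by ring
          _ ≤ _ := by gcongr; exact hpair s
      rw [h1, h2, ← ENNReal.ofReal_mul (hz0 s)] at e
      have e2 : (2 : ENNReal) ^ T.card * 2 ^ T.card = ENNReal.ofReal (C ^ 2) := by
        rw [hC, ← pow_mul, ENNReal.ofReal_pow (by norm_num), ENNReal.ofReal_ofNat]; ring
      rw [e2, ← ENNReal.ofReal_mul (by positivity), ENNReal.ofReal_le_ofReal_iff (by have := hz0' s; positivity)] at e
      nlinarith
    have hq : 0 ≤ (s - 1) ^ 2 := by positivity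
    nlinarith [mul_le_mul_of_nonneg_left this hq]
  have hs1 : Tendsto (fun s : ℝ => s - 1) (𝓝[>] 1) (𝓝 0) := by
    have : Tendsto (fun s : ℝ => s - 1) (𝓝 1) (𝓝 (1 - 1)) := (continuous_id.sub continuous_const).tendsto 1
    rw [sub_self] at this
    exact this.mono_left nhdsWithin_le_nhds
  have := le_of_tendsto_of_tendsto (hlim.pow 2) ((hs1.mul hlim').const_mul (C ^ 2)) hev
  simp at this
  have : 0 < c ^ 2 := by positivity
  nlinarith
end NonSq

open NumberField
open scoped Classical

universe u
section CH

lemma ff_sq {k l : Type*} [Field k] [Field l] [Finite k] [Finite l] (f : k →+* l)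
    (hc : Nat.card l = Nat.card k ^ 2) (x : k) : IsSquare (f x) := by
  have := Fintype.ofFinite k
  have := Fintype.ofFinite l
  by_cases h2 : ringChar l = 2
  · exact FiniteField.isSquare_of_char_two h2 _
  by_cases hx : f x = 0
  · rw [hx]; exact ⟨0, by simp⟩
  rw [FiniteField.isSquare_iff h2 hx]
  have hx0 : x ≠ 0 := by rintro rfl; simp at hx
  have hk := FiniteField.pow_card_sub_one_eq_one x hx0
  rw [Nat.card_eq_fintype_card, Nat.card_eq_fintype_card] at hc
  have hodd := FiniteField.odd_card_of_char_ne_two h2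
  rw [← Nat.odd_iff] at hodd
  set q := Fintype.card k
  rw [hc] at hodd ⊢
  have hq : Odd q := by
    by_contra h; rw [Nat.not_odd_iff_even] at h
    exact Nat.not_even_iff_odd.mpr hodd (h.pow_of_ne_zero two_ne_zero)
  obtain ⟨m, hm⟩ := hq
  have : q ^ 2 / 2 = (q - 1) * (m + 1) := by
    rw [hm]
    have : (2 * m + 1) ^ 2 = 2 * (2 * m * (m + 1)) + 1 := by ring
    rw [this, Nat.add_sub_cancel]; omega
  rw [this, pow_mul, ← map_pow, hk, map_one, one_pow]

variable {F K : Type*} [Field F] [NumberField F] [Field K] [NumberField K] [Algebra F K]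

lemma res_surj (hdeg : Module.finrank F K = 2) (S : Ideal (𝓞 K)) (hS : S.IsPrime) (hS0 : S ≠ ⊥)
    (s : Ideal (𝓞 F)) (hs : s.IsPrime) (hs0 : s ≠ ⊥) (hcm : S.comap (algebraMap (𝓞 F) (𝓞 K)) = s)
    (a : 𝓞 F) (ha : ¬ SqMod S (algebraMap (𝓞 F) (𝓞 K) a)) :
    ∀ x, ∃ y, x - algebraMap (𝓞 F) (𝓞 K) y ∈ S := by
  obtain ⟨f, hf, hfa⟩ := res_inj s S hcm
  have hsm := hs.isMaximal hs0
  have hSm := hS.isMaximal hS0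
  letI : Field (𝓞 F ⧸ s) := Ideal.Quotient.field s
  letI : Field (𝓞 K ⧸ S) := Ideal.Quotient.field S
  have : Finite (𝓞 F ⧸ s) := (Ideal.absNorm_ne_zero_iff s).mp (by rwa [Ne, Ideal.absNorm_eq_zero_iff])
  have : Finite (𝓞 K ⧸ S) := (Ideal.absNorm_ne_zero_iff S).mp (by rwa [Ne, Ideal.absNorm_eq_zero_iff])
  letI : Algebra (𝓞 F ⧸ s) (𝓞 K ⧸ S) := f.toAlgebra
  have hcard : Nat.card (𝓞 K ⧸ S) = Nat.card (𝓞 F ⧸ s) ^ Module.finrank (𝓞 F ⧸ s) (𝓞 K ⧸ S) :=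
    Module.natCard_eq_pow_finrank
  have hpos : 0 < Module.finrank (𝓞 F ⧸ s) (𝓞 K ⧸ S) := Module.finrank_pos
  have h1 : Nat.card (𝓞 F ⧸ s) = s.absNorm := by
    rw [Ideal.absNorm_apply, Submodule.cardQuot_apply]
  have h2 : Nat.card (𝓞 K ⧸ S) = S.absNorm := by
    rw [Ideal.absNorm_apply, Submodule.cardQuot_apply]
  have hle : S.absNorm ≤ s.absNorm ^ 2 := by
    rw [← absNorm_map hdeg]
    refine Nat.le_of_dvd (Nat.pos_of_ne_zero ?_) (map_dvd Ideal.absNorm (Ideal.dvd_iff_le.mpr ?_))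
    · rw [Ne, Ideal.absNorm_eq_zero_iff]; exact map_ne_bot hs0
    · rw [Ideal.map_le_iff_le_comap, hcm]
  have hgt : 1 < s.absNorm := by rw [← h1]; exact Finite.one_lt_card
  have hfr : Module.finrank (𝓞 F ⧸ s) (𝓞 K ⧸ S) ≤ 2 := by
    rw [← h2, hcard, h1] at hle
    exact (Nat.pow_le_pow_iff_right hgt).mp hle
  have hne : Module.finrank (𝓞 F ⧸ s) (𝓞 K ⧸ S) ≠ 2 := by
    intro h
    rw [h] at hcard
    obtain ⟨c, hc⟩ := ff_sq f hcard (Ideal.Quotient.mk s a)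
    obtain ⟨c, rfl⟩ := Ideal.Quotient.mk_surjective c
    rw [hfa, ← map_mul, Ideal.Quotient.eq] at hc
    exact ha ⟨c, by rw [pow_two]; exact hc⟩
  have h1' : Module.finrank (𝓞 F ⧸ s) (𝓞 K ⧸ S) = 1 := by omega
  rw [h1', pow_one] at hcard
  have hsurj : Function.Surjective f :=
    ((Nat.bijective_iff_injective_and_card f).mpr ⟨hf, hcard.symm⟩).2
  intro x
  obtain ⟨y, hy⟩ := hsurj (Ideal.Quotient.mk S x)
  obtain ⟨y, rfl⟩ := Ideal.Quotient.mk_surjective y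
  rw [hfa] at hy
  exact ⟨y, Ideal.Quotient.eq.mp hy.symm⟩

theorem ch (n : ℕ) : ∀ {F : Type u} [Field F] [NumberField F] (b : List (𝓞 F)) (_ : b.length = n) (a d : 𝓞 F)
    (_ : ∀ x ∈ Submonoid.closure {y | y ∈ b}, ¬ IsSquare (a * x)) (_ : d ≠ 0),
    ∃ s : Ideal (𝓞 F), s.IsPrime ∧ s ≠ ⊥ ∧ d ∉ s ∧ (∀ y ∈ b, SqMod s y) ∧ ¬ SqMod s a := by
  induction n with
  | zero =>
    intro F _ _ b hb a d ha hd
    obtain ⟨s, h1, h2, h3, h4⟩ := exists_nonsq a d (by simpa using ha 1 (one_mem _)) hd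
    rw [List.length_eq_zero_iff] at hb
    exact ⟨s, h1, h2, h3, by simp [hb], h4⟩
  | succ n ih =>
    intro F _ _ b hb a d ha hd
    obtain ⟨b1, b', rfl⟩ := List.exists_of_length_succ b hb
    have hb' : b'.length = n := by simpa using hb
    have hmono : Submonoid.closure {y | y ∈ b'} ≤ Submonoid.closure {y | y ∈ b1 :: b'} :=
      Submonoid.closure_mono (fun y hy => List.mem_cons_of_mem _ hy)
    by_cases hsq : IsSquare b1
    · obtain ⟨s, h1, h2, h3, h4, h5⟩ := ih b' hb' a d (fun x hx => ha x (hmono hx)) hd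
      refine ⟨s, h1, h2, h3, ?_, h5⟩
      intro y hy
      rcases List.mem_cons.mp hy with rfl | hy
      · obtain ⟨c, rfl⟩ := hsq
        rw [← pow_two]; exact SqMod.sq _ _
      · exact h4 y hy
    obtain ⟨K, _, _, _, hdeg, ⟨θ, hθ⟩, -⟩ := exists_quad (b1 : F) (fun h => hsq (int_sq b1 h))
    obtain ⟨σ, h⟩ := QS.exists hdeg
    obtain ⟨t, -, ht, hst⟩ := quad_data b1 hsq h θ hθ
    set g := algebraMap (𝓞 F) (𝓞 K) with hg
    have hinj : Function.Injective g := FaithfulSMul.algebraMap_injective _ _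
    obtain ⟨S, hS, hS0, hdS, hbS, haS⟩ := ih (b'.map g) (by simpa using hb') (g a) (g d) (by
      intro x hx
      have : {y | y ∈ b'.map g} = (g : 𝓞 F →* 𝓞 K) '' {y | y ∈ b'} := by ext y; simp
      rw [this, ← MonoidHom.map_mclosure] at hx
      obtain ⟨x, hx, rfl⟩ := hx
      rintro ⟨y, hy⟩
      change g a * g x = y * y at hy
      rw [← map_mul] at hy
      have hsy : sig σ y ^ 2 = y ^ 2 := by rw [← map_pow, pow_two, ← hy, sig_alg]
      rcases sq_eq_sq_iff_eq_or_eq_neg.mp hsy with h1 | h1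
      · obtain ⟨z, hz⟩ := h.sig_fix y h1
        refine ha x (hmono hx) ⟨z, hinj ?_⟩
        rw [hy, map_mul, hz]
      · obtain ⟨z, hz⟩ := h.sig_fix (y * t) (by rw [map_mul, h1, hst]; ring)
        refine ha (x * b1) (mul_mem (hmono hx) (Submonoid.subset_closure (by simp))) ⟨z, hinj ?_⟩
        rw [← mul_assoc, map_mul, hy, map_mul, hz, ← ht]; ring) (by rwa [Ne, hg, FaithfulSMul.algebraMap_eq_zero_iff])
    have hs : (S.comap g).IsPrime := Ideal.IsPrime.comap g
    have hs0 : S.comap g ≠ ⊥ := by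
      intro h0
      exact hS0 (Ideal.eq_bot_of_comap_eq_bot h0)
    have hsur := res_surj hdeg S hS hS0 (S.comap g) hs hs0 rfl a haS
    have hdesc : ∀ y, SqMod S (g y) → SqMod (S.comap g) y := by
      rintro y ⟨c, hc⟩
      obtain ⟨c0, hc0⟩ := hsur c
      refine ⟨c0, ?_⟩
      rw [Ideal.mem_comap, map_sub, map_pow]
      have := S.add_mem hc (S.mul_mem_left (c + g c0) hc0)
      convert this using 1; ring
    refine ⟨S.comap g, hs, hs0, hdS, ?_, ?_⟩
    · intro y hy
      rcases List.mem_cons.mp hy with rfl | hy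
      · apply hdesc
        rw [← ht]; exact SqMod.sq _ _
      · exact hdesc y (hbS _ (List.mem_map_of_mem hy))
    · rintro ⟨c, hc⟩
      apply haS
      refine ⟨g c, ?_⟩
      rw [← map_pow, ← map_sub]; exact hc
end CH

open NumberField
open scoped Classical

section UnitsBasis
variable (F : Type*) [Field F] [NumberField F]

lemma units_basis : ∃ (e : Fin (Fintype.card (InfinitePlace F)) → (𝓞 F)ˣ)
    (c : Fin (Fintype.card (InfinitePlace F)) → (𝓞 F)ˣ → ZMod 2),
    (∀ i u v, c i (u * v) = c i u + c i v) ∧ (∀ i j, c i (e j) = if i = j then 1 else 0) ∧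
    ∀ u, (∀ i, c i u = 0) → ∃ v, u = v ^ 2 := by
  set m := Fintype.card (InfinitePlace F) with hm
  have hmpos : 0 < m := Fintype.card_pos
  set A := Additive (𝓞 F)ˣ with hA
  have hfin : Module.Finite ℤ A := inferInstance
  set H : AddSubgroup A := (nsmulAddMonoidHom (α := A) 2).range with hH
  have hidx : H.index = 2 ^ m := by
    have h1 := fg_index_two (A := A)
    rw [← hH, units_finrank] at h1
    have h2 : Nat.card (nsmulAddMonoidHom (α := A) 2).ker = 2 := by
      have h3 : ∀ x : A, x ∈ (nsmulAddMonoidHom (α := A) 2).ker ↔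
          x = Additive.ofMul (1 : (𝓞 F)ˣ) ∨ x = Additive.ofMul (-1 : (𝓞 F)ˣ) := by
        intro x
        rw [AddMonoidHom.mem_ker]
        change Additive.ofMul ((Additive.toMul x) ^ 2) = Additive.ofMul 1 ↔ _
        rw [Additive.ofMul.injective.eq_iff]
        constructor
        · intro h
          have : ((Additive.toMul x : (𝓞 F)ˣ) : 𝓞 F) ^ 2 = 1 := by
            have := congrArg Units.val h; simpa using this
          rcases eq_or_eq_neg_of_sq_eq_sq _ _ (this.trans (one_pow 2).symm) with h | h
          · left; exact congrArg Additive.ofMul (Units.ext h)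
          · right; exact congrArg Additive.ofMul (Units.ext h)
        · rintro (rfl | rfl)
          · simp
          · simp
      have h4 : (((nsmulAddMonoidHom (α := A) 2).ker : AddSubgroup A) : Set A) =
          {Additive.ofMul (1 : (𝓞 F)ˣ), Additive.ofMul (-1 : (𝓞 F)ˣ)} := by
        ext x; rw [SetLike.mem_coe, h3]; rfl
      change Nat.card ((((nsmulAddMonoidHom (α := A) 2).ker : AddSubgroup A) : Set A) : Type _) = 2
      rw [h4, Nat.card_coe_set_eq]
      apply Set.ncard_pair
      intro h
      have h5 : (1 : 𝓞 F) = -1 := congrArg Units.val (Additive.ofMul.injective h)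
      have h6 : (2 : 𝓞 F) = 0 := by linear_combination h5
      exact two_ne_zero h6
    rw [h2] at h1
    rw [h1, ← hm, ← pow_succ]; congr 1; omega
  set V := A ⧸ H with hV
  letI : Module (ZMod 2) V := AddCommGroup.zmodModule (by
    intro x
    obtain ⟨x, rfl⟩ := QuotientAddGroup.mk'_surjective H x
    rw [← map_nsmul]
    exact (QuotientAddGroup.eq_zero_iff _).mpr ⟨x, rfl⟩)
  have hcard : Nat.card V = 2 ^ m := hidx
  have : Finite V := Nat.finite_of_card_ne_zero (by rw [hcard]; positivity)
  have hfr : Module.finrank (ZMod 2) V = m := by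
    have := Module.natCard_eq_pow_finrank (K := ZMod 2) (V := V)
    rw [hcard, Nat.card_zmod] at this
    exact (Nat.pow_right_injective le_rfl this).symm
  let b := Module.finBasisOfFinrankEq (ZMod 2) V hfr
  choose e he using fun i => QuotientAddGroup.mk'_surjective H (b i)
  refine ⟨fun i => Additive.toMul (e i), fun i u => b.coord i (QuotientAddGroup.mk' H (Additive.ofMul u)), ?_, ?_, ?_⟩
  · intro i u v
    change b.coord i (QuotientAddGroup.mk' H (Additive.ofMul (u * v))) = b.coord i (QuotientAddGroup.mk' H (Additive.ofMul u)) + b.coord i (QuotientAddGroup.mk' H (Additive.ofMul v))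
    rw [ofMul_mul, map_add, map_add]
  · intro i j
    change b.coord i (QuotientAddGroup.mk' H (e j)) = _
    rw [he, Module.Basis.coord_apply, Module.Basis.repr_self, Finsupp.single_apply]
    simp [eq_comm]
  · intro u hu
    have h0 : QuotientAddGroup.mk' H (Additive.ofMul u) = 0 := by
      apply b.repr.injective
      rw [map_zero]
      ext i
      exact hu i
    obtain ⟨v, hv⟩ := (QuotientAddGroup.eq_zero_iff _).mp h0
    exact ⟨Additive.toMul v, Additive.ofMul.injective hv.symm⟩
end UnitsBasis

open NumberField
open scoped Classical

section Pig
variable (F : Type*) [Field F] [NumberField F]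

lemma ker_sq_card : Nat.card (powMonoidHom 2 : (𝓞 F ⧸ Ideal.span {(4 : 𝓞 F)})ˣ →* _).ker ≤
    2 ^ Module.finrank ℚ F := by
  set I4 := Ideal.span {(4 : 𝓞 F)} with hI4
  set I2 := Ideal.span {(2 : 𝓞 F)} with hI2
  have hc2 : Nat.card (𝓞 F ⧸ I2) = 2 ^ Module.finrank ℚ F := by
    have : Nat.card (𝓞 F ⧸ I2) = I2.absNorm := by rw [Ideal.absNorm_apply, Submodule.cardQuot_apply]
    rw [this, hI2, Ideal.absNorm_span_singleton]
    have h2 : (2 : 𝓞 F) = algebraMap ℤ (𝓞 F) 2 := by simp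
    rw [h2, Algebra.norm_algebraMap, RingOfIntegers.rank]
    simp [Int.natAbs_pow]
  have hfin : Finite (𝓞 F ⧸ I2) := Nat.finite_of_card_ne_zero (by rw [hc2]; positivity)
  rw [← hc2]
  have hex : ∀ y : (powMonoidHom 2 : (𝓞 F ⧸ I4)ˣ →* _).ker, ∃ t : 𝓞 F,
      ((y : (𝓞 F ⧸ I4)ˣ) : 𝓞 F ⧸ I4) = Ideal.Quotient.mk I4 (1 + 2 * t) := by
    rintro ⟨y, hy⟩
    obtain ⟨a, ha⟩ := Ideal.Quotient.mk_surjective (y : 𝓞 F ⧸ I4)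
    have h1 : (y : 𝓞 F ⧸ I4) ^ 2 = 1 := congrArg Units.val hy
    rw [← ha, ← map_pow, ← map_one (Ideal.Quotient.mk I4), Ideal.Quotient.eq, hI4, Ideal.mem_span_singleton'] at h1
    obtain ⟨w, hw⟩ := h1
    have hi : IsIntegral (𝓞 F) ((((a : F) - 1) / 2) : F) := by
      refine ⟨Polynomial.X ^ 2 + Polynomial.X - Polynomial.C w, ?_, ?_⟩
      · monicity!
      · have hw' : (w : F) * 4 = (a : F) ^ 2 - 1 := by
          have := congrArg (algebraMap (𝓞 F) F) hw
          rw [map_mul, map_sub, map_pow, map_one, map_ofNat] at this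
          exact this
        simp only [Polynomial.eval₂_sub, Polynomial.eval₂_add, Polynomial.eval₂_pow, Polynomial.eval₂_X, Polynomial.eval₂_C]
        linear_combination (-1/4) * hw'
    obtain ⟨t, ht⟩ := IsIntegrallyClosed.isIntegral_iff.mp hi
    refine ⟨t, ?_⟩
    change (y : 𝓞 F ⧸ I4) = _
    rw [← ha]
    congr 1
    apply RingOfIntegers.ext
    have : (t : F) = ((a : F) - 1) / 2 := ht
    simp only [map_add, map_mul, map_one, map_ofNat]
    rw [ht]; ring
  choose t ht using hex
  refine Nat.card_le_card_of_injective (fun y => Ideal.Quotient.mk I2 (t y)) ?_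
  intro y z hyz
  apply Subtype.ext
  apply Units.ext
  rw [ht, ht, Ideal.Quotient.eq]
  rw [Ideal.Quotient.eq, hI2, Ideal.mem_span_singleton'] at hyz
  obtain ⟨w, hw⟩ := hyz
  rw [hI4, Ideal.mem_span_singleton']
  exact ⟨w, by linear_combination 2 * hw⟩

lemma pig {ι : Type*} [Fintype ι] (hι : 2 * Fintype.card (InfinitePlace F) < Fintype.card ι)
    (x : ι → 𝓞 F) (hx : ∀ i, IsUnit (Ideal.Quotient.mk (Ideal.span {(4 : 𝓞 F)}) (x i))) (hx0 : ∀ i, x i ≠ 0) :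
    ∃ D : Finset ι, D.Nonempty ∧ (∃ β γ, ∏ i ∈ D, x i = β ^ 2 - 4 * γ) ∧
      ∀ φ : F →+* ℝ, 0 < φ ((∏ i ∈ D, x i : 𝓞 F) : F) := by
  set I4 := Ideal.span {(4 : 𝓞 F)} with hI4
  have h4 : (4 : 𝓞 F) ≠ 0 := by
    intro h
    have h2 : (2 : 𝓞 F) * 2 = 0 := by linear_combination h
    exact (mul_ne_zero two_ne_zero two_ne_zero) h2
  have hI40 : I4 ≠ ⊥ := by
    rw [hI4, Ne, Ideal.span_singleton_eq_bot]
    exact h4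
  have hfin4 : Finite (𝓞 F ⧸ I4) := (Ideal.absNorm_ne_zero_iff I4).mp (by rwa [Ne, Ideal.absNorm_eq_zero_iff])
  choose y hy using hx
  set N : Subgroup (𝓞 F ⧸ I4)ˣ := (powMonoidHom 2 : (𝓞 F ⧸ I4)ˣ →* _).range with hN
  set X : Finset ι → 𝓞 F := fun A => ∏ i ∈ A, x i with hX
  have hX0 : ∀ A, X A ≠ 0 := fun A => Finset.prod_ne_zero_iff.mpr fun i _ => hx0 i
  set f : Finset ι → ((𝓞 F ⧸ I4)ˣ ⧸ N) × ({w : InfinitePlace F // w.IsReal} → Bool) :=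
    fun A => (QuotientGroup.mk (∏ i ∈ A, y i),
      fun w => decide (0 < InfinitePlace.embedding_of_isReal w.2 (X A : F))) with hf
  have hcard : Nat.card (((𝓞 F ⧸ I4)ˣ ⧸ N) × ({w : InfinitePlace F // w.IsReal} → Bool)) < Nat.card (Finset ι) := by
    rw [Nat.card_prod]
    have h1 : Nat.card ((𝓞 F ⧸ I4)ˣ ⧸ N) ≤ 2 ^ Module.finrank ℚ F := by
      refine le_trans (le_of_eq ?_) (ker_sq_card F)
      exact Subgroup.index_range
    have h2 : Nat.card ({w : InfinitePlace F // w.IsReal} → Bool) = 2 ^ InfinitePlace.nrRealPlaces F := by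
      rw [Nat.card_eq_fintype_card, Fintype.card_fun, Fintype.card_bool]
    have h3 : Nat.card (Finset ι) = 2 ^ Fintype.card ι := by
      rw [Nat.card_eq_fintype_card, Fintype.card_finset]
    rw [h2, h3]
    calc _ ≤ 2 ^ Module.finrank ℚ F * 2 ^ InfinitePlace.nrRealPlaces F := by gcongr
      _ = 2 ^ (2 * Fintype.card (InfinitePlace F)) := by
        rw [← pow_add]; congr 1
        rw [InfinitePlace.card_eq_nrRealPlaces_add_nrComplexPlaces, ← InfinitePlace.card_add_two_mul_card_eq_rank]
        ring
      _ < _ := Nat.pow_lt_pow_right (by norm_num) hι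
  obtain ⟨A, B, hAB, hfe⟩ : ∃ A B, A ≠ B ∧ f A = f B := by
    by_contra hcon
    push Not at hcon
    have : Function.Injective f := fun A B h => by by_contra hne; exact hcon A B hne h
    exact absurd (Nat.card_le_card_of_injective f this) (by omega)
  rw [hf, Prod.mk.injEq] at hfe
  obtain ⟨hfe1, hfe2⟩ := hfe
  have hmkX : ∀ A, Ideal.Quotient.mk I4 (X A) = ((∏ i ∈ A, y i : (𝓞 F ⧸ I4)ˣ) : 𝓞 F ⧸ I4) := by
    intro A
    rw [hX, map_prod, Units.coe_prod]
    exact Finset.prod_congr rfl fun i _ => (hy i).symm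
  have hdec : ∀ A B : Finset ι, X A * X B = X (symmDiff A B) * X (A ∩ B) ^ 2 := by
    intro A B
    have e1 : X (symmDiff A B) = X (A \ B) * X (B \ A) := by
      rw [hX, symmDiff_def]
      exact Finset.prod_union (disjoint_sdiff_sdiff)
    have e2 : X A = X (A \ B) * X (A ∩ B) := by
      rw [hX]; simp only
      rw [← Finset.prod_union (Finset.disjoint_sdiff_inter A B), Finset.sdiff_union_inter]
    have e3 : X B = X (B \ A) * X (A ∩ B) := by
      rw [hX]; simp only
      rw [Finset.inter_comm A B, ← Finset.prod_union (Finset.disjoint_sdiff_inter B A), Finset.sdiff_union_inter]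
    rw [e1, e2, e3]; ring
  refine ⟨symmDiff A B, Finset.nonempty_iff_ne_empty.mpr (fun h => hAB (symmDiff_eq_bot.mp h)), ?_, ?_⟩
  · rw [QuotientGroup.eq] at hfe1
    obtain ⟨z, hz⟩ := hfe1
    change z ^ 2 = _ at hz
    obtain ⟨β, hβ⟩ := Ideal.Quotient.mk_surjective
      (((∏ i ∈ A, y i) * z * (∏ i ∈ A ∩ B, y i)⁻¹ : (𝓞 F ⧸ I4)ˣ) : 𝓞 F ⧸ I4)
    have h1 : Ideal.Quotient.mk I4 (X (symmDiff A B)) = Ideal.Quotient.mk I4 (β ^ 2) := by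
      rw [hmkX, map_pow, hβ, ← Units.val_pow_eq_pow_val]
      congr 1
      have h2 : (∏ i ∈ A, y i) * (∏ i ∈ B, y i) = (∏ i ∈ symmDiff A B, y i) * (∏ i ∈ A ∩ B, y i) ^ 2 := by
        apply Units.ext
        rw [Units.val_mul, Units.val_mul, Units.val_pow_eq_pow_val, ← hmkX, ← hmkX, ← hmkX, ← hmkX, ← map_mul, hdec, map_mul, map_pow]
      rw [mul_pow, mul_pow, hz, inv_pow]
      rw [eq_mul_inv_iff_mul_eq, ← h2, pow_two, mul_assoc, mul_inv_cancel_left]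
    rw [Ideal.Quotient.eq, hI4, Ideal.mem_span_singleton'] at h1
    obtain ⟨w, hw⟩ := h1
    exact ⟨β, -w, by change X (symmDiff A B) = _; linear_combination -hw⟩
  · intro φ
    change 0 < φ (X (symmDiff A B) : F)
    have hφ : (0 < φ (X A : F)) ↔ 0 < φ (X B : F) := by
      set ψ : F →+* ℂ := Complex.ofRealHom.comp φ with hψ
      have hre : ComplexEmbedding.IsReal ψ := by
        rw [ComplexEmbedding.isReal_iff]
        ext a
        simp [hψ, ComplexEmbedding.conjugate_coe_eq]
      have hw : (InfinitePlace.mk ψ).IsReal := ⟨ψ, hre, rfl⟩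
      have hval : ∀ a, InfinitePlace.embedding_of_isReal hw a = φ a := by
        intro a
        have h1 := InfinitePlace.embedding_of_isReal_apply hw a
        rw [InfinitePlace.embedding_mk_eq_of_isReal hre] at h1
        have : ((InfinitePlace.embedding_of_isReal hw a : ℝ) : ℂ) = ((φ a : ℝ) : ℂ) := h1
        exact_mod_cast this
      have := congrFun hfe2 ⟨_, hw⟩
      simp only [hval, decide_eq_decide] at this
      exact this
    have hne : ∀ A, φ (X A : F) ≠ 0 := by
      intro A h0
      rw [map_eq_zero] at h0
      exact hX0 A (RingOfIntegers.ext h0)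
    have hprod : 0 < φ (X A : F) * φ (X B : F) := by
      rcases lt_or_gt_of_ne (hne A) with h1 | h1
      · have : φ (X B : F) < 0 := by
          rcases lt_or_gt_of_ne (hne B) with h2 | h2
          · exact h2
          · exact absurd (hφ.mpr h2) (not_lt.mpr h1.le)
        exact mul_pos_of_neg_of_neg h1 this
      · exact mul_pos h1 (hφ.mp h1)
    have h3 : φ (X A : F) * φ (X B : F) = φ (X (symmDiff A B) : F) * φ (X (A ∩ B) : F) ^ 2 := by
      rw [← map_mul, ← map_mul, hdec, map_mul, map_pow, map_mul, map_pow]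
    rw [h3] at hprod
    exact pos_of_mul_pos_left hprod (sq_nonneg _)
end Pig

open NumberField
open scoped Classical

section Dir2
variable {F K : Type*} [Field F] [NumberField F] [Field K] [NumberField K] [Algebra F K]
variable {σ : K ≃ₐ[F] K} {R : Finset (Ideal (𝓞 F))} {P : Ideal (𝓞 F) → Ideal (𝓞 K)}

lemma Genus.pkg (hF : Odd (classNumber F)) (hdeg : Module.finrank F K = 2)
    (hinf : UnramifiedAtInfinitePlaces F K) (g : Genus σ R P) :
    2 * (relUnitNormRange F K).index ≤ 2 ^ R.card ∧ (relUnitNormRange F K).index ≠ 0 ∧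
    (2 ^ R.card ≤ 2 * (relUnitNormRange F K).index → ∀ S ⊆ R,
      ∃ (α : 𝓞 K) (J : Ideal (𝓞 F)), α ≠ 0 ∧ J ≠ ⊥ ∧
        Ideal.span {α} = J.map (algebraMap (𝓞 F) (𝓞 K)) * ∏ r ∈ S, P r) := by
  obtain ⟨h1, h2⟩ := herbrand g.qs hdeg hinf
  obtain ⟨h3, h4⟩ := g.card hF (by rw [h1]; exact mul_ne_zero two_ne_zero h2)
  rw [h1] at h3 h4
  exact ⟨h3, h2, h4⟩

lemma relUnit_le : relUnitNormRange F K ≤ unitsNormsFromField F K := by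
  rintro _ ⟨u, rfl⟩
  refine ⟨Units.map (algebraMap (𝓞 K) K).toMonoidHom u, ?_⟩
  apply Units.ext
  rfl

lemma dir2 (hF : Odd (classNumber F)) (hdeg : Module.finrank F K = 2)
    (hinf : UnramifiedAtInfinitePlaces F K) (g : Genus σ R P) (hR : R.card = 2)
    (r : Ideal (𝓞 F)) (hr : r ∈ R) (ε : (𝓞 F)ˣ) (hε : ¬ SqMod r (ε : 𝓞 F)) :
    Odd (classNumber K) ∧ (relUnitNormRange F K).index = 2 ∧ (unitsNormsFromField F K).index = 2 := by
  obtain ⟨h1, h2, h3⟩ := g.pkg hF hdeg hinf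
  rw [hR] at h1 h3
  have h4 : ε ∉ unitsNormsFromField F K := fun h => hε ((g.ram r hr).field_norm_sq hF g.qs ε h)
  have h5 : (unitsNormsFromField F K).index ≠ 1 := by
    intro h
    rw [Subgroup.index_eq_one] at h
    rw [h] at h4
    exact h4 trivial
  have h6 := Subgroup.relIndex_mul_index (relUnit_le (F := F) (K := K))
  set i := (relUnitNormRange F K).index
  set j := (unitsNormsFromField F K).index
  set l := (relUnitNormRange F K).relIndex (unitsNormsFromField F K) with hl
  have hi : i ≤ 2 := by omega
  have hj0 : j ≠ 0 := by rintro h; rw [h] at h6; omega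
  have hl0 : l ≠ 0 := by rintro h; rw [h] at h6; omega
  have hl1 : l = 1 := by
    by_contra hne
    have : 2 * 2 ≤ l * j := Nat.mul_le_mul (by omega) (by omega)
    omega
  rw [hl1] at h6
  refine ⟨g.odd hF (h3 (by omega)) (Subgroup.relIndex_eq_one.mp hl1), by omega, by omega⟩

lemma odd_of_one (hF : Odd (classNumber F)) (hdeg : Module.finrank F K = 2)
    (hinf : UnramifiedAtInfinitePlaces F K) (g : Genus σ R P) (hR : R.card = 1) :
    Odd (classNumber K) := by
  obtain ⟨h1, h2, h3⟩ := g.pkg hF hdeg hinf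
  rw [hR] at h1 h3
  have h4 : (relUnitNormRange F K).index = 1 := by omega
  refine g.odd hF (h3 (by omega)) ?_
  rw [Subgroup.index_eq_one.mp h4]
  exact le_top

lemma genus_of (hdeg : Module.finrank F K = 2) (h : QS σ)
    (hR : ∀ p : Ideal (𝓞 F), p.IsPrime → p ≠ ⊥ → (IsRamifiedIn F K p ↔ p ∈ R))
    (hRp : ∀ p ∈ R, p.IsPrime ∧ p ≠ ⊥) : ∃ P, Genus σ R P := by
  have : ∀ p : Ideal (𝓞 F), ∃ Q : Ideal (𝓞 K), p ∈ R → RamData σ p Q := by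
    intro p
    by_cases hp : p ∈ R
    · obtain ⟨Q, a1, a2, a3, a4, a5, a6, a7⟩ := ram_facts hdeg h p (hRp p hp).1 (hRp p hp).2
        ((hR p (hRp p hp).1 (hRp p hp).2).mpr hp)
      exact ⟨Q, fun _ => ⟨(hRp p hp).1, (hRp p hp).2, a1, a2, a3, a4, a5, a6, a7⟩⟩
    · exact ⟨⊤, fun h => absurd h hp⟩
  choose P hP using this
  exact ⟨P, h, hP, fun p hp hp0 hr => (hR p hp hp0).mp hr⟩
end Dir2

open NumberField
open scoped Classical

section Val
variable {F : Type*} [Field F] [NumberField F]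
open UniqueFactorizationMonoid

noncomputable def vv (r I : Ideal (𝓞 F)) : ℕ := (normalizedFactors I).count r

lemma vv_mul (r : Ideal (𝓞 F)) {I J : Ideal (𝓞 F)} (hI : I ≠ ⊥) (hJ : J ≠ ⊥) :
    vv r (I * J) = vv r I + vv r J := by
  unfold vv
  rw [normalizedFactors_mul hI hJ, Multiset.count_add]

lemma vv_pow (r : Ideal (𝓞 F)) (I : Ideal (𝓞 F)) (n : ℕ) : vv r (I ^ n) = n * vv r I := by
  unfold vv
  rw [normalizedFactors_pow, Multiset.count_nsmul]

lemma vv_prime (r s : Ideal (𝓞 F)) (hs : s.IsPrime) (hs0 : s ≠ ⊥) :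
    vv r s = if r = s then 1 else 0 := by
  unfold vv
  rw [normalizedFactors_irreducible (Ideal.prime_of_isPrime hs0 hs).irreducible, normalize_eq,
    Multiset.count_singleton]

lemma vv_top (r : Ideal (𝓞 F)) : vv r ⊤ = 0 := by
  unfold vv
  rw [← Ideal.one_eq_top, normalizedFactors_one, Multiset.count_zero]

lemma prod_pow_ne_bot (R : Finset (Ideal (𝓞 F))) (n : ℕ) (hR : ∀ s ∈ R, s.IsPrime ∧ s ≠ ⊥) :
    ∏ s ∈ R, s ^ n ≠ ⊥ :=
  Finset.prod_ne_zero_iff.mpr fun s hs => pow_ne_zero _ (hR s hs).2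

lemma vv_prod (r : Ideal (𝓞 F)) (n : ℕ) (R : Finset (Ideal (𝓞 F))) (hR : ∀ s ∈ R, s.IsPrime ∧ s ≠ ⊥) :
    vv r (∏ s ∈ R, s ^ n) = if r ∈ R then n else 0 := by
  induction R using Finset.induction_on with
  | empty => simp [vv_top]
  | insert a S ha ih =>
    have h1 : ∀ s ∈ S, s.IsPrime ∧ s ≠ ⊥ := fun s hs => hR s (Finset.mem_insert_of_mem hs)
    have h2 := hR a (Finset.mem_insert_self _ _)
    rw [Finset.prod_insert ha, vv_mul r (pow_ne_zero _ h2.2) (prod_pow_ne_bot S n h1), ih h1, vv_pow,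
      vv_prime r a h2.1 h2.2]
    by_cases hra : r = a
    · subst hra; simp [ha]
    · simp [hra]

lemma vv_sq_odd {r : Ideal (𝓞 F)} {x : 𝓞 F} (hx : x ≠ 0) (h : Odd (vv r (Ideal.span {x}))) : ¬ IsSquare x := by
  rintro ⟨y, rfl⟩
  have hy : Ideal.span {y} ≠ ⊥ := by
    rw [Ne, Ideal.span_singleton_eq_bot]; rintro rfl; simp at hx
  rw [← Ideal.span_singleton_mul_span_singleton, vv_mul r hy hy] at h
  exact (Nat.not_odd_iff_even.mpr ⟨_, rfl⟩) h

lemma prime_mem_of_dvd {R : Finset (Ideal (𝓞 F))} {n : ℕ} (hR : ∀ s ∈ R, s.IsPrime ∧ s ≠ ⊥)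
    {q : Ideal (𝓞 F)} (hq : q.IsPrime) (hq0 : q ≠ ⊥) (h : ∏ s ∈ R, s ^ n ≤ q) : q ∈ R := by
  obtain ⟨s, hs, hle⟩ := (hq.prod_le).mp h
  have h1 : s ≤ q := Ideal.IsPrime.le_of_pow_le hle
  have h2 := ((hR s hs).1.isMaximal (hR s hs).2).eq_of_le hq.ne_top h1
  rwa [← h2]
end Val

section QF
universe u1
lemma quadfield {F : Type u1} [Field F] [NumberField F] (hF : Odd (classNumber F)) (α β γ : 𝓞 F)
    (h4 : α = β ^ 2 - 4 * γ) (hpos : ∀ φ : F →+* ℝ, 0 < φ (α : F)) (R : Finset (Ideal (𝓞 F)))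
    (hRne : R.Nonempty) (hR : ∀ s ∈ R, s.IsPrime ∧ s ≠ ⊥)
    (hspan : Ideal.span {α} = ∏ s ∈ R, s ^ classNumber F) :
    ∃ (K : Type u1) (_ : Field K) (_ : NumberField K) (_ : Algebra F K) (σ : K ≃ₐ[F] K)
      (P : Ideal (𝓞 F) → Ideal (𝓞 K)) (θ : 𝓞 K), Module.finrank F K = 2 ∧
      UnramifiedAtInfinitePlaces F K ∧ Genus σ R P ∧ θ ^ 2 = algebraMap (𝓞 F) (𝓞 K) α ∧
      sig σ θ = - θ := by
  have hα0 : α ≠ 0 := by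
    rintro rfl
    exact prod_pow_ne_bot R _ hR (by rw [← hspan]; simp)
  have hvv : ∀ r ∈ R, Odd (vv r (Ideal.span {α})) := by
    intro r hr
    rw [hspan, vv_prod r _ R hR, if_pos hr]; exact hF
  have hns : ¬ IsSquare α := by
    obtain ⟨r, hr⟩ := hRne
    exact vv_sq_odd hα0 (hvv r hr)
  obtain ⟨K, _, _, _, hdeg, ⟨θ, hθ⟩, hext⟩ := exists_quad (α : F) (fun h => hns (int_sq _ h))
  obtain ⟨σ, hσ⟩ := QS.exists hdeg
  obtain ⟨t, ht, ht2, hσt⟩ := quad_data α hns hσ θ hθ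
  have hxi : IsIntegral ℤ ((θ + algebraMap F K β) / 2) := by
    have hq : ((θ + algebraMap F K β) / 2) ^ 2 - algebraMap F K β * ((θ + algebraMap F K β) / 2)
        + algebraMap F K γ = 0 := by
      have : (α : F) = (β : F) ^ 2 - 4 * (γ : F) := by
        have := congrArg (algebraMap (𝓞 F) F) h4
        rw [map_sub, map_pow, map_mul, map_ofNat] at this; exact this
      have h2 := congrArg (algebraMap F K) this
      rw [← hθ] at h2
      simp only [map_sub, map_pow, map_mul, map_ofNat] at h2
      field_simp
      linear_combination h2
    have h3 : IsIntegral (𝓞 F) ((θ + algebraMap F K β) / 2) := by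
      refine ⟨Polynomial.X ^ 2 - Polynomial.C β * Polynomial.X + Polynomial.C γ, by monicity!, ?_⟩
      simpa [IsScalarTower.algebraMap_apply (𝓞 F) F K] using hq
    exact isIntegral_trans (R := ℤ) (A := 𝓞 F) _ h3
  set x : 𝓞 K := ⟨_, hxi⟩ with hx
  have h2x : 2 * x = t + algebraMap (𝓞 F) (𝓞 K) β := by
    apply RingOfIntegers.ext
    have ht' : algebraMap (𝓞 K) K t = θ := ht
    change algebraMap (𝓞 K) K (2 * x) = algebraMap (𝓞 K) K (t + algebraMap (𝓞 F) (𝓞 K) β)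
    rw [map_mul, map_add, map_ofNat, ht']
    change 2 * ((θ + algebraMap F K β) / 2) = θ + algebraMap F K β
    field_simp
  have hxx : sig σ x - x = - t := by
    have h1 := congrArg (sig σ) h2x
    rw [map_mul, map_add, map_ofNat, hσt, sig_alg] at h1
    have h5 : (2 : 𝓞 K) * (sig σ x - x) = 2 * (- t) := by linear_combination h1 - h2x
    exact mul_left_cancel₀ two_ne_zero h5
  have hramR : ∀ q : Ideal (𝓞 F), q.IsPrime → q ≠ ⊥ → IsRamifiedIn F K q → q ∈ R := by
    intro q hq hq0 hr
    obtain ⟨Q, a1, a2, a3, a4, a5, a6, a7⟩ := ram_facts hdeg hσ q hq hq0 hr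
    have htQ : t ∈ Q := by
      have := a6 x
      rw [hxx] at this
      exact neg_mem_iff.mp this
    have h1 : α ∈ q := by
      rw [← a4, Ideal.mem_comap, ← ht2, pow_two]
      exact Q.mul_mem_left _ htQ
    refine prime_mem_of_dvd hR hq hq0 ?_ (n := classNumber F)
    rw [← hspan, Ideal.span_singleton_le_iff_mem]; exact h1
  set R' := R.filter (fun q => IsRamifiedIn F K q) with hR'
  obtain ⟨P, g⟩ : ∃ P, Genus σ R' P := genus_of hdeg hσ (fun p hp hp0 => by
      rw [hR', Finset.mem_filter]
      exact ⟨fun h => ⟨hramR p hp hp0 h, h⟩, fun h => h.2⟩)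
    (fun p hp => hR p (Finset.mem_filter.mp hp).1)
  have ht0 : t ≠ 0 := by
    rintro rfl
    rw [zero_pow two_ne_zero, eq_comm, FaithfulSMul.algebraMap_eq_zero_iff] at ht2
    exact hα0 ht2
  obtain ⟨J, S, hJ, hS, hE⟩ := ambig g _ (Ideal.span {t}) (by rwa [Ne, Ideal.span_singleton_eq_bot]) le_rfl
    (by rw [QS.map_sig_span, hσt, Ideal.span_singleton_neg])
  have hS' : ∀ s ∈ S, s.IsPrime ∧ s ≠ ⊥ := fun s hs => hR s (Finset.mem_filter.mp (hS hs)).1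
  have hαE : Ideal.span {α} = J ^ 2 * ∏ s ∈ S, s ^ 1 := by
    apply map_inj (K := K)
    rw [Ideal.map_span, Set.image_singleton, ← ht2, ← Ideal.span_singleton_pow, hE, mul_pow, Ideal.map_mul,
      Ideal.map_pow, ← Finset.prod_pow]
    congr 1
    rw [← Ideal.mapHom_apply, map_prod]
    refine Finset.prod_congr rfl fun s hs => ?_
    rw [pow_one, Ideal.mapHom_apply, (g.ram s (hS hs)).mp]
  have hRR : R' = R := by
    apply Finset.Subset.antisymm (Finset.filter_subset _ _)
    intro r hr
    have h1 := hvv r hr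
    rw [hαE, vv_mul r (pow_ne_zero _ hJ) (prod_pow_ne_bot S 1 hS'), vv_pow, vv_prod r 1 S hS'] at h1
    by_contra hrS
    rw [if_neg (fun h => hrS (hS h))] at h1
    exact (Nat.not_odd_iff_even.mpr (by simp)) h1
  rw [hRR] at g
  exact ⟨K, _, _, _, σ, P, t, hdeg, fun φ => hext φ (hpos φ).le, g, ht2, hσt⟩
end QF

open NumberField
open scoped Classical

section StepC
lemma gen_unit4 {F : Type*} [Field F] [NumberField F] (r : Ideal (𝓞 F)) (hr : r.IsPrime) (hr0 : r ≠ ⊥)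
    (h2 : (2 : 𝓞 F) ∉ r) (n : ℕ) (π : 𝓞 F) (hπ : r ^ n = Ideal.span {π}) :
    IsUnit (Ideal.Quotient.mk (Ideal.span {(4 : 𝓞 F)}) π) := by
  have hm := hr.isMaximal hr0
  obtain ⟨y, i, hi, hyi⟩ := hm.exists_inv h2
  have h1 : i ^ n ∈ Ideal.span {π} := by rw [← hπ]; exact Ideal.pow_mem_pow hi n
  obtain ⟨a, ha⟩ := Ideal.mem_span_singleton'.mp h1
  have hu : IsUnit (Ideal.Quotient.mk (Ideal.span {(4 : 𝓞 F)}) i) := by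
    refine IsUnit.of_mul_eq_one (Ideal.Quotient.mk _ (1 + 2 * y)) ?_
    rw [← map_mul, ← map_one (Ideal.Quotient.mk _), Ideal.Quotient.eq, Ideal.mem_span_singleton']
    exact ⟨- y ^ 2, by linear_combination (-1 - 2 * y) * hyi⟩
  have h3 := hu.pow n
  rw [← map_pow, ← ha, map_mul] at h3
  exact isUnit_of_mul_isUnit_right h3

lemma sq_prod_iff {F : Type*} [Field F] [NumberField F] {ι : Type*} (e : ι → (𝓞 F)ˣ)
    (q : Ideal (𝓞 F)) (hq : q.IsPrime) (hq0 : q ≠ ⊥) (i : ι) (h1 : ∀ j, j ≠ i → SqMod q (e j : 𝓞 F))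
    (h2 : ¬ SqMod q (e i : 𝓞 F)) (A : Finset ι) : SqMod q ((∏ j ∈ A, e j : (𝓞 F)ˣ) : 𝓞 F) ↔ i ∉ A := by
  have h3 : ∀ A : Finset ι, i ∉ A → SqMod q ((∏ j ∈ A, e j : (𝓞 F)ˣ) : 𝓞 F) := by
    intro A hA
    rw [Units.coe_prod]
    exact SqMod.prod _ _ fun j hj => h1 j (by rintro rfl; exact hA hj)
  refine ⟨fun h hi => ?_, h3 A⟩
  rw [← Finset.mul_prod_erase A e hi, Units.val_mul] at h
  exact h2 (SqMod.of_mul hq hq0 h (h3 _ (Finset.notMem_erase i A)) (unit_notMem hq _))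

lemma RamData.norm_gen {F K : Type*} [Field F] [NumberField F] [Field K] [NumberField K] [Algebra F K]
    {σ : K ≃ₐ[F] K} {r : Ideal (𝓞 F)} {P : Ideal (𝓞 K)} (d : RamData σ r P) (h : QS σ)
    (α : 𝓞 K) (J : Ideal (𝓞 F)) (hJ : J ≠ ⊥)
    (hE : Ideal.span {α} = J.map (algebraMap (𝓞 F) (𝓞 K)) * P) :
    ∃ y : 𝓞 K, Ideal.span {RingOfIntegers.norm F y} = r ^ classNumber F := by
  obtain ⟨j, hj⟩ := princ_pow J
  have hj0 : j ≠ 0 := by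
    rintro rfl
    have : J ^ classNumber F = 0 := by rw [hj]; simp
    exact hJ (pow_eq_zero_iff (classNumber_ne_zero F) |>.mp this)
  have hja : algebraMap (𝓞 F) (𝓞 K) j ≠ 0 := by rwa [Ne, FaithfulSMul.algebraMap_eq_zero_iff]
  have e : P ^ classNumber F * Ideal.span {algebraMap (𝓞 F) (𝓞 K) j} =
      Ideal.span {α ^ classNumber F} := by
    rw [← Ideal.span_singleton_pow, hE, mul_pow, ← Ideal.map_pow, hj, Ideal.map_span, Set.image_singleton]
    ring
  obtain ⟨y, hy, hyj⟩ := princ_cancel _ _ _ hja e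
  refine ⟨y, map_inj (K := K) ?_⟩
  rw [Ideal.map_span, Set.image_singleton, h.sig_norm, ← Ideal.span_singleton_mul_span_singleton,
      ← QS.map_sig_span, ← hy, Ideal.map_pow, d.st, Ideal.map_pow, d.mp]
  ring

universe u2
lemma stepC {F : Type u2} [Field F] [NumberField F] (hF : Odd (classNumber F)) {m : ℕ}
    (hm : Fintype.card (InfinitePlace F) = m) (e : Fin m → (𝓞 F)ˣ) (c : Fin m → (𝓞 F)ˣ → ZMod 2)
    (hc : ∀ i u v, c i (u * v) = c i u + c i v) (hce : ∀ i j, c i (e j) = if i = j then 1 else 0)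
    (q : Fin m → Ideal (𝓞 F)) (hq : ∀ i, (q i).IsPrime) (hq0 : ∀ i, q i ≠ ⊥) (hq2 : ∀ i, (2 : 𝓞 F) ∉ q i)
    (hqe : ∀ i j, j ≠ i → SqMod (q i) (e j : 𝓞 F)) (hqn : ∀ i, ¬ SqMod (q i) (e i : 𝓞 F))
    (s : Ideal (𝓞 F)) (hs : s.IsPrime) (hs0 : s ≠ ⊥) (hs2 : (2 : 𝓞 F) ∉ s)
    (hsu : ∀ u : (𝓞 F)ˣ, SqMod s (u : 𝓞 F)) (π : Ideal (𝓞 F) → 𝓞 F)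
    (hπ : ∀ r, r ^ classNumber F = Ideal.span {π r}) (hsπ : ∀ i, ¬ SqMod s (π (q i))) :
    ∃ (u : (𝓞 F)ˣ) (β γ : 𝓞 F), u * π s = β ^ 2 - 4 * γ ∧
      ∀ φ : F →+* ℝ, 0 < φ ((u * π s : 𝓞 F) : F) := by
  set pr : Option (Fin m) → Ideal (𝓞 F) := fun o => o.elim s q with hpr
  have hprp : ∀ o, (pr o).IsPrime ∧ pr o ≠ ⊥ ∧ (2 : 𝓞 F) ∉ pr o := by
    rintro (_ | i)
    · exact ⟨hs, hs0, hs2⟩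
    · exact ⟨hq i, hq0 i, hq2 i⟩
  have hsq : ∀ i, s ≠ q i := fun i h => hqn i (h ▸ hsu (e i))
  have hprinj : Function.Injective pr := by
    rintro (_ | i) (_ | j) h
    · rfl
    · exact absurd h (hsq j)
    · exact absurd h.symm (hsq i)
    · congr 1
      by_contra hij
      apply hqn i
      have h' : q i = q j := h
      rw [h']
      exact hqe j i hij
  have hπ0 : ∀ o, π (pr o) ≠ 0 := by
    intro o h0
    have := hπ (pr o)
    rw [h0] at this
    have h1 : (pr o) ^ classNumber F = 0 := by rw [this]; simp
    exact (hprp o).2.1 (pow_eq_zero_iff (classNumber_ne_zero F) |>.mp h1)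
  obtain ⟨D, hD, ⟨β, γ, hβγ⟩, hpos⟩ := pig F (ι := Fin m ⊕ Option (Fin m)) (by
      rw [hm, Fintype.card_sum, Fintype.card_option, Fintype.card_fin]; omega)
    (Sum.elim (fun i => (e i : 𝓞 F)) (fun o => π (pr o))) (by
      rintro (i | o)
      · exact (e i).isUnit.map _
      · exact gen_unit4 _ (hprp o).1 (hprp o).2.1 (hprp o).2.2 _ _ (hπ _)) (by
      rintro (i | o)
      · exact (e i).ne_zero
      · exact hπ0 o)
  set D1 := D.toLeft with hD1
  set D2 := D.toRight with hD2
  set u : (𝓞 F)ˣ := ∏ i ∈ D1, e i with hu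
  have hprod : ∏ i ∈ D, (Sum.elim (fun i => (e i : 𝓞 F)) (fun o => π (pr o))) i = u * ∏ o ∈ D2, π (pr o) := by
    rw [← Finset.toLeft_disjSum_toRight (u := D), Finset.prod_disjSum, hu, Units.coe_prod]
    rfl
  rw [hprod] at hβγ hpos
  by_cases hD2e : D2 = ∅
  · exfalso
    rw [hD2e, Finset.prod_empty, mul_one] at hβγ hpos
    obtain ⟨v, hv⟩ := lemmaV hF u β γ hβγ hpos
    obtain ⟨i, hi⟩ : D1.Nonempty := by
      rw [Finset.nonempty_iff_ne_empty]
      intro h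
      apply hD.ne_empty
      rw [← Finset.toLeft_disjSum_toRight (u := D), ← hD1, ← hD2, h, hD2e]
      rfl
    have hc1 : c i 1 = 0 := by
      have := hc i 1 1
      rw [mul_one] at this
      exact left_eq_add.mp this
    have h1 : ∀ A : Finset (Fin m), c i (∏ j ∈ A, e j) = if i ∈ A then 1 else 0 := by
      intro A
      induction A using Finset.induction_on with
      | empty => simpa using hc1
      | insert a S ha ih =>
        rw [Finset.prod_insert ha, hc, ih, hce]
        by_cases hia : i = a
        · subst hia; simp [ha]
        · simp [hia]
    have h2 := h1 D1
    rw [if_pos hi, ← hu, hv, pow_two, hc] at h2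
    rw [CharTwo.add_self_eq_zero] at h2
    exact zero_ne_one h2
  set R := D2.image pr with hR
  have hRp : ∀ r ∈ R, r.IsPrime ∧ r ≠ ⊥ := by
    intro r hr
    obtain ⟨o, _, rfl⟩ := Finset.mem_image.mp hr
    exact ⟨(hprp o).1, (hprp o).2.1⟩
  have hspan : Ideal.span {(u : 𝓞 F) * ∏ o ∈ D2, π (pr o)} = ∏ r ∈ R, r ^ classNumber F := by
    rw [mul_comm, Ideal.span_singleton_mul_right_unit u.isUnit, hR, Finset.prod_image hprinj.injOn,
      ← Ideal.prod_span_singleton]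
    exact Finset.prod_congr rfl fun o _ => (hπ _).symm
  have hRc : R.card = D2.card := Finset.card_image_of_injective _ hprinj
  obtain ⟨K, _, _, _, σ, P, θ, hdeg, hinf, g, hθ, hσθ⟩ := quadfield hF _ β γ hβγ hpos R
    ((Finset.nonempty_iff_ne_empty.mpr hD2e).image _) hRp hspan
  obtain ⟨hle, hne, hall⟩ := g.pkg hF hdeg hinf
  set D3 := Finset.eraseNone D2 with hD3
  have hidx : 2 ^ D3.card ≤ (relUnitNormRange F K).index := by
    have : Finite ((𝓞 F)ˣ ⧸ relUnitNormRange F K) := Nat.finite_of_card_ne_zero hne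
    have key : ∀ A B : Finset (Fin m), B ⊆ D3 → 
        (∏ i ∈ A, e i)⁻¹ * (∏ i ∈ B, e i) ∈ relUnitNormRange F K → B ⊆ A := by
      intro A B hB ⟨w, hw⟩ i hi
      have d := g.ram (q i) (Finset.mem_image.mpr ⟨some i, Finset.mem_eraseNone.mp (hB hi), rfl⟩)
      have h1 : SqMod (q i) ((((∏ i ∈ A, e i)⁻¹ * (∏ i ∈ B, e i) : (𝓞 F)ˣ)) : 𝓞 F) := by
        rw [← hw]; exact d.norm_sq g.qs w
      by_contra hiA
      have h2 := (sq_prod_iff e (q i) (hq i) (hq0 i) i (hqe i) (hqn i) A).mpr hiA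
      have h3 := h2.mul h1
      rw [← Units.val_mul, mul_inv_cancel_left] at h3
      exact (sq_prod_iff e (q i) (hq i) (hq0 i) i (hqe i) (hqn i) B).mp h3 hi
    have hinj : Function.Injective (fun A : D3.powerset =>
        (QuotientGroup.mk (∏ i ∈ A.1, e i) : (𝓞 F)ˣ ⧸ relUnitNormRange F K)) := by
      rintro ⟨A, hA⟩ ⟨B, hB⟩ hAB
      rw [Finset.mem_powerset] at hA hB
      apply Subtype.ext
      exact Finset.Subset.antisymm (key B A hA (QuotientGroup.eq.mp hAB.symm)) (key A B hB (QuotientGroup.eq.mp hAB))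
    have := Nat.card_le_card_of_injective _ hinj
    rw [Nat.card_eq_fintype_card, Fintype.card_coe, Finset.card_powerset] at this
    exact this
  have hnone : none ∈ D2 := by
    by_contra hn
    have h1 : D3.card = D2.card := by
      rw [hD3]; exact Finset.card_eraseNone_of_not_mem hn
    rw [hRc, ← h1] at hle
    have : 0 < 2 ^ D3.card := by positivity
    omega
  have hD3c : D2.card = D3.card + 1 := by
    have := Finset.card_eraseNone_of_mem hnone
    have h1 : 0 < D2.card := Finset.card_pos.mpr ⟨_, hnone⟩
    rw [hD3, this]; omega
  by_cases hD3e : D3 = ∅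
  · have h1 : D2 = {none} := by
      ext o
      rcases o with _ | i
      · simp [hnone]
      · have : i ∉ D3 := by rw [hD3e]; simp
        rw [hD3, Finset.mem_eraseNone] at this
        simp [this]
    rw [h1, Finset.prod_singleton] at hβγ hpos
    exact ⟨u, β, γ, hβγ, hpos⟩
  · exfalso
    obtain ⟨i, hi⟩ := Finset.nonempty_iff_ne_empty.mpr hD3e
    have hiR : q i ∈ R := Finset.mem_image.mpr ⟨some i, Finset.mem_eraseNone.mp hi, rfl⟩
    have hsR : s ∈ R := Finset.mem_image.mpr ⟨none, hnone, rfl⟩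
    obtain ⟨α, J, hα, hJ, hE⟩ := hall (by rw [hRc, hD3c, pow_succ]; omega) {q i} (by simpa using hiR)
    rw [Finset.prod_singleton] at hE
    obtain ⟨y, hy⟩ := (g.ram _ hiR).norm_gen g.qs α J hJ hE
    rw [hπ] at hy
    obtain ⟨w, hw⟩ := exists_unit_of_span_eq hy.symm
    apply hsπ i
    rw [hw]
    exact (hsu w).mul ((g.ram s hsR).norm_sq g.qs y)
end StepC

open NumberField
open scoped Classical

section Dir1
universe u3
lemma stepA {F : Type u3} [Field F] [NumberField F] {m : ℕ} (e : Fin m → (𝓞 F)ˣ) (c : Fin m → (𝓞 F)ˣ → ZMod 2)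
    (hc : ∀ i u v, c i (u * v) = c i u + c i v) (hce : ∀ i j, c i (e j) = if i = j then 1 else 0)
    (i : Fin m) : ∃ q : Ideal (𝓞 F), q.IsPrime ∧ q ≠ ⊥ ∧ (2 : 𝓞 F) ∉ q ∧
      (∀ j, j ≠ i → SqMod q (e j : 𝓞 F)) ∧ ¬ SqMod q (e i : 𝓞 F) := by
  have hc1 : c i 1 = 0 := by
    have := hc i 1 1
    rw [mul_one] at this
    exact left_eq_add.mp this
  obtain ⟨q, h1, h2, h3, h4, h5⟩ := ch _ (((Finset.univ.erase i).toList).map fun j => (e j : 𝓞 F)) rfl (e i : 𝓞 F) 2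
    (by
      intro x hx
      have hx' : ∃ u : (𝓞 F)ˣ, x = u ∧ c i u = 0 := by
        induction hx using Submonoid.closure_induction with
        | mem x hx =>
          obtain ⟨j, hj, rfl⟩ := List.mem_map.mp hx
          rw [Finset.mem_toList, Finset.mem_erase] at hj
          exact ⟨e j, rfl, by rw [hce, if_neg hj.1.symm]⟩
        | one => exact ⟨1, rfl, hc1⟩
        | mul x y _ _ hx hy =>
          obtain ⟨u, rfl, hu⟩ := hx
          obtain ⟨v, rfl, hv⟩ := hy
          exact ⟨u * v, rfl, by rw [hc, hu, hv, add_zero]⟩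
      obtain ⟨u, rfl, hu⟩ := hx'
      rintro ⟨y, hy⟩
      obtain ⟨v, hv⟩ := unit_sq_of_field_sq (e i * u) ⟨(y : F), by
        rw [Units.val_mul, hy]; exact map_mul (algebraMap (𝓞 F) F) y y⟩
      have h1 : c i (e i * u) = 1 := by rw [hc, hce, if_pos rfl, hu, add_zero]
      rw [hv, pow_two, hc, CharTwo.add_self_eq_zero] at h1
      exact zero_ne_one h1) two_ne_zero
  refine ⟨q, h1, h2, h3, fun j hj => h4 _ ?_, h5⟩
  exact List.mem_map.mpr ⟨j, by rw [Finset.mem_toList, Finset.mem_erase]; exact ⟨hj, Finset.mem_univ _⟩, rfl⟩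

lemma stepB {F : Type u3} [Field F] [NumberField F] (hF : Odd (classNumber F)) {m : ℕ} (e : Fin m → (𝓞 F)ˣ)
    (c : Fin m → (𝓞 F)ˣ → ZMod 2)
    (hc : ∀ i u v, c i (u * v) = c i u + c i v) (hce : ∀ i j, c i (e j) = if i = j then 1 else 0)
    (hcs : ∀ u, (∀ i, c i u = 0) → ∃ v, u = v ^ 2)
    (T : Finset (Ideal (𝓞 F))) (hT : ∀ s ∈ T, s.IsPrime ∧ s ≠ ⊥) (p : Ideal (𝓞 F)) (hp : p ∈ T)
    (π : Ideal (𝓞 F) → 𝓞 F) (hπ : ∀ r, r ^ classNumber F = Ideal.span {π r}) (d : 𝓞 F) (hd : d ≠ 0) :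
    ∃ s : Ideal (𝓞 F), s.IsPrime ∧ s ≠ ⊥ ∧ d ∉ s ∧ (∀ u : (𝓞 F)ˣ, SqMod s (u : 𝓞 F)) ∧
      (∀ r ∈ T, π r ∉ s) ∧ (∀ r ∈ T, ¬ SqMod s (π r)) ∧ ∀ r ∈ T, SqMod s (π r * π p) := by
  have hπ0 : ∀ r ∈ T, π r ≠ 0 := by
    intro r hr h0
    have := hπ r
    rw [h0] at this
    have h1 : r ^ classNumber F = 0 := by rw [this]; simp
    exact (hT r hr).2 (pow_eq_zero_iff (classNumber_ne_zero F) |>.mp h1)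
  set V : 𝓞 F → ℕ := fun x => ∑ r ∈ T, vv r (Ideal.span {x}) with hV
  have hVmul : ∀ x y, x ≠ 0 → y ≠ 0 → V (x * y) = V x + V y := by
    intro x y hx hy
    rw [hV]; simp only
    rw [← Finset.sum_add_distrib]
    refine Finset.sum_congr rfl fun r _ => ?_
    rw [← Ideal.span_singleton_mul_span_singleton, vv_mul r (by rwa [Ne, Ideal.span_singleton_eq_bot])
      (by rwa [Ne, Ideal.span_singleton_eq_bot])]
  have hVu : ∀ u : (𝓞 F)ˣ, V u = 0 := by
    intro u
    rw [hV]
    refine Finset.sum_eq_zero fun r _ => ?_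
    rw [Ideal.span_singleton_eq_top.mpr u.isUnit, vv_top]
  have hVπ : ∀ r ∈ T, V (π r) = classNumber F := by
    intro r hr
    rw [hV]; simp only
    rw [← hπ, Finset.sum_congr rfl fun s hs => by rw [vv_pow, vv_prime s r (hT r hr).1 (hT r hr).2]]
    simp [hr]
  obtain ⟨s, h1, h2, h3, h4, h5⟩ := ch _ ((List.ofFn fun j => (e j : 𝓞 F)) ++ T.toList.map fun r => π r * π p) rfl
    (π p) (d * ∏ r ∈ T, π r) (by
      intro x hx
      have hx' : x ≠ 0 ∧ Even (V x) := by
        induction hx using Submonoid.closure_induction with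
        | mem x hx =>
          rcases List.mem_append.mp hx with hx | hx
          · obtain ⟨j, rfl⟩ := List.mem_ofFn.mp hx
            exact ⟨(e j).ne_zero, by rw [hVu]; exact Even.zero⟩
          · obtain ⟨r, hr, rfl⟩ := List.mem_map.mp hx
            rw [Finset.mem_toList] at hr
            refine ⟨mul_ne_zero (hπ0 r hr) (hπ0 p hp), ?_⟩
            rw [hVmul _ _ (hπ0 r hr) (hπ0 p hp), hVπ r hr, hVπ p hp]
            exact ⟨_, rfl⟩
        | one => exact ⟨one_ne_zero, by rw [← Units.val_one, hVu]; exact Even.zero⟩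
        | mul x y _ _ hx hy =>
          refine ⟨mul_ne_zero hx.1 hy.1, ?_⟩
          rw [hVmul _ _ hx.1 hy.1]
          exact hx.2.add hy.2
      rintro ⟨y, hy⟩
      have hne : π p * x ≠ 0 := mul_ne_zero (hπ0 p hp) hx'.1
      have hy0 : y ≠ 0 := by rintro rfl; rw [hy] at hne; simp at hne
      have h1 := hVmul _ _ (hπ0 p hp) hx'.1
      rw [hy, hVmul y y hy0 hy0, hVπ p hp] at h1
      have h2 : Odd (V y + V y) := by rw [h1]; exact hF.add_even hx'.2
      exact (Nat.not_odd_iff_even.mpr ⟨_, rfl⟩) h2)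
    (mul_ne_zero hd (Finset.prod_ne_zero_iff.mpr hπ0))
  have hds : d ∉ s := fun h => h3 (s.mul_mem_right _ h)
  have hπs : ∀ r ∈ T, π r ∉ s := fun r hr h => h3 (s.mul_mem_left _ (by
    rw [← Finset.mul_prod_erase T _ hr]; exact s.mul_mem_right _ h))
  have hes : ∀ j, SqMod s (e j : 𝓞 F) := fun j => h4 _ (List.mem_append_left _ (List.mem_ofFn.mpr ⟨j, rfl⟩))
  have hps : ∀ r ∈ T, SqMod s (π r * π p) := fun r hr => h4 _ (List.mem_append_right _
    (List.mem_map.mpr ⟨r, Finset.mem_toList.mpr hr, rfl⟩))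
  refine ⟨s, h1, h2, hds, ?_, hπs, ?_, hps⟩
  · intro u
    set A : Finset (Fin m) := Finset.univ.filter (fun i => c i u = 1) with hA
    have hcA : ∀ (i) (B : Finset (Fin m)), c i (∏ j ∈ B, e j) = if i ∈ B then 1 else 0 := by
      intro i B
      induction B using Finset.induction_on with
      | empty =>
        have := hc i 1 1
        rw [mul_one] at this
        simpa using left_eq_add.mp this
      | insert a S ha ih =>
        rw [Finset.prod_insert ha, hc, ih, hce]
        by_cases hia : i = a
        · subst hia; simp [ha]
        · simp [hia]
    obtain ⟨v, hv⟩ := hcs (u * ∏ j ∈ A, e j) (by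
      intro i
      rw [hc, hcA]
      have h01 : ∀ z : ZMod 2, z = 0 ∨ z = 1 := by decide
      rcases h01 (c i u) with h | h
      · rw [if_neg (by rw [hA, Finset.mem_filter, h]; simp), h, add_zero]
      · rw [if_pos (by rw [hA, Finset.mem_filter, h]; simp), h]; decide)
    have h6 : SqMod s (((∏ j ∈ A, e j : (𝓞 F)ˣ)) : 𝓞 F) := by
      rw [Units.coe_prod]; exact SqMod.prod _ _ fun j _ => hes j
    refine SqMod.of_mul h1 h2 ?_ h6 (unit_notMem h1 _)
    rw [← Units.val_mul, hv, Units.val_pow_eq_pow_val]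
    exact SqMod.sq _ _
  · intro r hr h
    apply h5
    have := hps r hr
    rw [mul_comm] at this
    exact SqMod.of_mul h1 h2 this h (hπs r hr)

lemma two_notMem {F : Type*} [Field F] [NumberField F] (p : Ideal (𝓞 F)) (hp : p.IsPrime)
    (hN : Odd (Ideal.absNorm p)) : (2 : 𝓞 F) ∉ p := by
  intro h
  have h1 : Ideal.absNorm p ∣ Ideal.absNorm (Ideal.span {(2 : 𝓞 F)}) :=
    Ideal.absNorm_dvd_absNorm_of_le ((Ideal.span_singleton_le_iff_mem _).mpr h)
  have h2 : (2 : 𝓞 F) = algebraMap ℤ (𝓞 F) 2 := by simp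
  rw [h2, Ideal.absNorm_span_singleton, Algebra.norm_algebraMap, Int.natAbs_pow] at h1
  have h3 : Nat.Coprime (Ideal.absNorm p) (Int.natAbs 2 ^ Module.finrank ℤ (𝓞 F)) :=
    Nat.Coprime.pow_right _ (Nat.coprime_two_right.mpr hN)
  have h4 := Nat.Coprime.eq_one_of_dvd h3 h1
  exact hp.ne_top (Ideal.absNorm_eq_one_iff.mp h4)

lemma theta_int {F K : Type*} [Field F] [NumberField F] [Field K] [NumberField K] [Algebra F K]
    {σ : K ≃ₐ[F] K} (h : QS σ) : ∃ (t : 𝓞 K) (α : 𝓞 F), t ≠ 0 ∧ α ≠ 0 ∧ 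
      t ^ 2 = algebraMap (𝓞 F) (𝓞 K) α ∧ sig σ t = - t := by
  obtain ⟨θ, hθ0, hθ⟩ := h.neg
  obtain ⟨a, c, hc, hac⟩ := IsFractionRing.div_surjective (A := 𝓞 K) θ
  have hc0 : c ≠ 0 := nonZeroDivisors.ne_zero hc
  have hcK : algebraMap (𝓞 K) K c ≠ 0 := by simpa using hc0
  have hscK : σ (algebraMap (𝓞 K) K c) ≠ 0 := by simpa using hc0
  have ha0 : a ≠ 0 := by
    rintro rfl
    rw [map_zero, zero_div] at hac
    exact hθ0 hac.symm
  have hσt : sig σ (a * sig σ c) = - (a * sig σ c) := by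
    rw [map_mul, h.sig_sig]
    apply RingOfIntegers.ext
    rw [← hac, map_div₀, ← neg_div, div_eq_div_iff hscK hcK] at hθ
    change σ (algebraMap (𝓞 K) K a) * algebraMap (𝓞 K) K c = - (algebraMap (𝓞 K) K a * σ (algebraMap (𝓞 K) K c))
    rw [hθ]; ring
  have ht0 : a * sig σ c ≠ 0 := mul_ne_zero ha0 (by simpa using hc0)
  obtain ⟨α, hα⟩ := h.sig_fix ((a * sig σ c) ^ 2) (by rw [map_pow, hσt, neg_sq])
  refine ⟨a * sig σ c, α, ht0, ?_, hα.symm, hσt⟩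
  rintro rfl
  rw [map_zero] at hα
  exact pow_ne_zero 2 ht0 hα.symm

lemma dir1 {F : Type u3} {K : Type*} [Field F] [NumberField F] [Field K] [NumberField K] [Algebra F K]
    {σ : K ≃ₐ[F] K} {P : Ideal (𝓞 F) → Ideal (𝓞 K)} (hF : Odd (classNumber F)) (hK : Odd (classNumber K))
    (p1 p2 : Ideal (𝓞 F)) (hne : p1 ≠ p2) (h21 : (2 : 𝓞 F) ∉ p1) (h22 : (2 : 𝓞 F) ∉ p2)
    (g : Genus σ {p1, p2} P) (hu : ∀ u : (𝓞 F)ˣ, SqMod p1 (u : 𝓞 F)) : False := by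
  have h1R : p1 ∈ ({p1, p2} : Finset (Ideal (𝓞 F))) := by simp
  have h2R : p2 ∈ ({p1, p2} : Finset (Ideal (𝓞 F))) := by simp
  have d1 := g.ram p1 h1R
  have d2 := g.ram p2 h2R
  obtain ⟨e, c, hc, hce, hcs⟩ := units_basis F
  choose q hq hq0 hq2 hqe hqn using stepA e c hc hce
  choose π hπ using princ_pow (F := F)
  obtain ⟨t, α, ht0, hα0, htα, hσt⟩ := theta_int g.qs
  set T : Finset (Ideal (𝓞 F)) := {p1, p2} ∪ Finset.univ.image q with hT
  have h1T : p1 ∈ T := Finset.mem_union_left _ h1R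
  have h2T : p2 ∈ T := Finset.mem_union_left _ h2R
  have hqT : ∀ i, q i ∈ T := fun i => Finset.mem_union_right _ (Finset.mem_image_of_mem _ (Finset.mem_univ i))
  have hTp : ∀ s ∈ T, s.IsPrime ∧ s ≠ ⊥ := by
    intro s hs
    rcases Finset.mem_union.mp hs with h | h
    · exact ⟨(g.ram s h).pp, (g.ram s h).p0⟩
    · obtain ⟨i, _, rfl⟩ := Finset.mem_image.mp h
      exact ⟨hq i, hq0 i⟩
  obtain ⟨s, hs, hs0, hds, hsu, hπs, hnsq, hsq⟩ := stepB hF e c hc hce hcs T hTp p1 h1T π hπ (2 * α)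
    (mul_ne_zero two_ne_zero hα0)
  have hs2 : (2 : 𝓞 F) ∉ s := fun h => hds (s.mul_mem_right _ h)
  have hsα : α ∉ s := fun h => hds (s.mul_mem_left _ h)
  have hs1 : p1 ≠ s := by
    rintro rfl
    apply hπs p1 h1T
    have : π p1 ∈ p1 ^ classNumber F := by rw [hπ]; exact Ideal.mem_span_singleton_self _
    exact Ideal.pow_le_self (classNumber_ne_zero F) this
  -- step 3
  have hαs : SqMod s α := by
    obtain ⟨J, S, hJ, hS, hE⟩ := ambig g _ (Ideal.span {t}) (by rwa [Ne, Ideal.span_singleton_eq_bot]) le_rfl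
      (by rw [QS.map_sig_span, hσt, Ideal.span_singleton_neg])
    have hSR : S = {p1, p2} := by
      apply Finset.Subset.antisymm hS
      intro r hr
      refine g.theta_mem hF t hσt J hJ S hS hE r hr ?_
      rcases Finset.mem_insert.mp hr with h | h
      · rwa [h]
      · rwa [Finset.mem_singleton.mp h]
    rw [hSR, Finset.prod_pair hne] at hE
    have hαE : Ideal.span {α} = J ^ 2 * (p1 * p2) := by
      apply map_inj (K := K)
      rw [Ideal.map_span, Set.image_singleton, ← htα, ← Ideal.span_singleton_pow, hE, Ideal.map_mul, Ideal.map_mul,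
        Ideal.map_pow, d1.mp, d2.mp]
      ring
    have h1 : Ideal.span {α ^ classNumber F} = Ideal.span {π J ^ 2 * (π p2 * π p1)} := by
      rw [← Ideal.span_singleton_pow, hαE, ← Ideal.span_singleton_mul_span_singleton,
        ← Ideal.span_singleton_mul_span_singleton, ← Ideal.span_singleton_pow, ← hπ, ← hπ, ← hπ]
      ring
    obtain ⟨u, hu'⟩ := exists_unit_of_span_eq h1
    refine SqMod.of_pow hs hs0 hF ?_ hsα
    rw [hu']
    exact (hsu u).mul ((SqMod.sq _ _).mul (hsq p2 h2T))
  have h3 : SqMod p1 (π s) := recip2 hF hK g.qs t α htα hσt s hs hs0 hds hαs p1 (P p1) d1 hs1 hu (π s) (hπ s)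
  obtain ⟨u, β, γ, hβγ, hpos⟩ := stepC hF rfl e c hc hce q hq hq0 hq2 hqe hqn s hs hs0 hs2 hsu π hπ
    (fun i => hnsq _ (hqT i))
  obtain ⟨K', _, _, _, σ', P', θ', hdeg', hinf', g', hθ', hσθ'⟩ := quadfield hF _ β γ hβγ hpos {s} (by simp)
    (by simpa using ⟨hs, hs0⟩) (by
      rw [mul_comm, Ideal.span_singleton_mul_right_unit u.isUnit, Finset.prod_singleton, hπ])
  have hK' : Odd (classNumber K') := odd_of_one hF hdeg' hinf' g' (by simp)
  have hπs1 : π s ∉ p1 := by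
    intro hm
    rw [← Ideal.span_singleton_le_iff_mem, ← hπ] at hm
    have := d1.pp.le_of_pow_le hm
    exact hs1 ((hs.isMaximal hs0).eq_of_le d1.pp.ne_top this).symm
  have h5 : SqMod s (π p1) := recip2 hF hK' g'.qs θ' _ hθ' hσθ' p1 d1.pp d1.p0 (by
      intro h
      rcases d1.pp.mem_or_mem h with h | h
      · exact h21 h
      · rcases d1.pp.mem_or_mem h with h | h
        · exact unit_notMem d1.pp u h
        · exact hπs1 h) ((hu u).mul h3) s (P' s) (g'.ram s (by simp)) hs1.symm hsu (π p1) (hπ p1)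
  exact hnsq p1 h1T h5
end Dir1

/-- In the two-ramified-primes situation, the class number of `k` is odd iff `𝔭₁` is
not primary; and in that case `(E_F : N_{k/F} E_k) = 2` and
`(E_F : E_F ∩ N_{k/F} k^×) = 2`. -/
theorem classNumber_odd_iff_not_primary
    (F : Type*) [Field F] [NumberField F]
    (hoddF : Odd (NumberField.classNumber F))
    (k : Type*) [Field k] [NumberField k] [Algebra F k]
    (hdeg : Module.finrank F k = 2)
    (𝔭₁ 𝔭₂ : Ideal (𝓞 F)) (hp1 : 𝔭₁.IsPrime) (hp2 : 𝔭₂.IsPrime) (hne : 𝔭₁ ≠ 𝔭₂)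
    (hN1 : Odd (Ideal.absNorm 𝔭₁)) (hN2 : Odd (Ideal.absNorm 𝔭₂))
    (hram : ∀ 𝔭 : Ideal (𝓞 F), 𝔭.IsPrime → 𝔭 ≠ ⊥ →
      (IsRamifiedIn F k 𝔭 ↔ 𝔭 = 𝔭₁ ∨ 𝔭 = 𝔭₂))
    (hinf : UnramifiedAtInfinitePlaces F k)
    : (Odd (NumberField.classNumber k) ↔ ¬ IsPrimaryIdeal F 𝔭₁) ∧
      (Odd (NumberField.classNumber k) →
        (relUnitNormRange F k).index = 2 ∧ (unitsNormsFromField F k).index = 2) := by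
  have hp10 : 𝔭₁ ≠ ⊥ := by rintro rfl; simp at hN1
  have hp20 : 𝔭₂ ≠ ⊥ := by rintro rfl; simp at hN2
  obtain ⟨σ, hσ⟩ := QS.exists hdeg
  obtain ⟨P, g⟩ : ∃ P, Genus σ {𝔭₁, 𝔭₂} P := genus_of hdeg hσ
    (fun p hp hp0 => by rw [hram p hp hp0, Finset.mem_insert, Finset.mem_singleton])
    (fun p hp => by
      rcases Finset.mem_insert.mp hp with h | h
      · rw [h]; exact ⟨hp1, hp10⟩
      · rw [Finset.mem_singleton.mp h]; exact ⟨hp2, hp20⟩)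
  have hD1 : Odd (NumberField.classNumber k) → ¬ IsPrimaryIdeal F 𝔭₁ := fun hK hprim =>
    dir1 hoddF hK 𝔭₁ 𝔭₂ hne (two_notMem _ hp1 hN1) (two_notMem _ hp2 hN2) g
      (fun u => (quadRes_iff 𝔭₁ hp1 hN1 _ (unit_notMem hp1 u)).mp (hprim u))
  have hD2 : ¬ IsPrimaryIdeal F 𝔭₁ → Odd (classNumber k) ∧ (relUnitNormRange F k).index = 2 ∧
      (unitsNormsFromField F k).index = 2 := by
    intro h
    unfold IsPrimaryIdeal at h
    push Not at h
    obtain ⟨ε, hε⟩ := h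
    exact dir2 hoddF hdeg hinf g (Finset.card_pair hne) 𝔭₁ (by simp) ε
      (fun h => hε ((quadRes_iff 𝔭₁ hp1 hN1 _ (unit_notMem hp1 ε)).mpr h))
  exact ⟨⟨hD1, fun h => (hD2 h).1⟩, fun h => (hD2 (hD1 h)).2⟩
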